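/- arXiv:1811.09183 — 2 statements merged into one kernel-verified Lean document; each statement's English description precedes it below -/
import Mathlib

section
/- Let E be an infinite dimensional Banach space with cot E < ∞. Then for every a ≥ 1, the identity map id_E : E → E is not absolutely (a, (cot E)*)-summing. -/
open scoped ENNReal NNReal BigOperators ZeroAtInfty

noncomputable section

/-- The `k`-th Rademacher function on `[0,1]`. -/
def Rademacher (k : ℕ) (t : ℝ) : ℝ := (-1 : ℝ) ^ ⌊(2 : ℝ) ^ (k + 1) * t⌋

/-- A Banach space `E` has cotype `q` (for `2 ≤ q < ∞`). -/
def HasCotype (q : ℝ) (E : Type*) [NormedAddCommGroup E] [NormedSpace ℝ E] : Prop :=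
  2 ≤ q ∧ ∃ C > 0, ∀ (n : ℕ) (x : Fin n → E),
    (∑ k : Fin n, ‖x k‖ ^ q) ^ (1 / q) ≤
      C * (∫ t in (0:ℝ)..(1:ℝ), ‖∑ k : Fin n, Rademacher k.1 t • x k‖ ^ 2) ^ ((1:ℝ) / 2)

/-- `cot E`, the infimum of the cotypes of `E` (`∞` if `E` has no finite cotype). -/
def cot (E : Type*) [NormedAddCommGroup E] [NormedSpace ℝ E] : ℝ≥0∞ :=
  sInf {c : ℝ≥0∞ | ∃ q : ℝ, HasCotype q E ∧ c = ENNReal.ofReal q}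

/-- Conjugate exponent in `ℝ≥0∞` : `p* = p/(p-1)`, with `1* = ∞` and `∞* = 1`. -/
def conjE (p : ℝ≥0∞) : ℝ≥0∞ := 1 + 1 / (p - 1)

/-- A sequence is weakly `p`-summable. -/
def WeaklySummable {E : Type*} [NormedAddCommGroup E] [NormedSpace ℝ E]
    (p : ℝ) (x : ℕ → E) : Prop :=
  ∀ φ : E →L[ℝ] ℝ, Summable fun j => |φ (x j)| ^ p

/-- `u : E → F` is absolutely `(q,p)`-summing. -/
def AbsolutelySumming {E F : Type*} [NormedAddCommGroup E] [NormedSpace ℝ E]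
    [NormedAddCommGroup F] [NormedSpace ℝ F] (q p : ℝ) (u : E →L[ℝ] F) : Prop :=
  ∀ x : ℕ → E, WeaklySummable p x → Summable fun j => ‖u (x j)‖ ^ q

/-- The weak `ℓ_p` norm of a sequence. -/
def weakNorm {E : Type*} [NormedAddCommGroup E] [NormedSpace ℝ E] (p : ℝ) (x : ℕ → E) : ℝ :=
  ⨆ φ : {φ : E →L[ℝ] ℝ // ‖φ‖ ≤ 1}, (∑' j, |φ.1 (x j)| ^ p) ^ (1 / p)

/-- A continuous `m`-linear operator is multiple `(q,p)`-summing. -/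
def MultipleSumming {m : ℕ} {E : Fin m → Type*} [∀ i, NormedAddCommGroup (E i)]
    [∀ i, NormedSpace ℝ (E i)] {F : Type*} [NormedAddCommGroup F] [NormedSpace ℝ F]
    (q p : ℝ) (T : ContinuousMultilinearMap ℝ E F) : Prop :=
  ∃ C > 0, ∀ x : (i : Fin m) → ℕ → E i, (∀ i, WeaklySummable p (x i)) →
    (Summable fun j : Fin m → ℕ => ‖T (fun i => x i (j i))‖ ^ q) ∧
    (∑' j : Fin m → ℕ, ‖T (fun i => x i (j i))‖ ^ q) ^ (1 / q) ≤
      C * ∏ i, weakNorm p (x i)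

/-! ### Uniform averages over finite function spaces -/

lemma Fintype.expect_comp_injective {ι κ α : Type*} [Fintype ι] [DecidableEq ι] [Fintype κ]
    [DecidableEq κ] [Fintype α] [Nonempty α] {g : κ → ι} (hg : Function.Injective g)
    (F : (κ → α) → ℝ) : 𝔼 ε : ι → α, F (ε ∘ g) = 𝔼 ε : κ → α, F ε := by
  classical
  let e := Equiv.piEquivPiSubtypeProd (fun i => i ∈ Set.range g) (fun _ => α)
  let e' := (Equiv.ofInjective g hg).arrowCongr (Equiv.refl α)
  rw [Fintype.expect_equiv e (fun ε => F (ε ∘ g))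
    (fun p => F (e'.symm p.1)) (fun ε => by
      congr 1), ← Finset.univ_product_univ,
    Finset.expect_product (f := fun p : _ × _ => F (e'.symm p.1))]
  simp only [Fintype.expect_const]
  exact (Fintype.expect_equiv e' _ _ (fun ε => by simp)).symm

lemma Fintype.expect_eval {κ α : Type*} [Fintype κ] [DecidableEq κ] [Fintype α] [Nonempty α]
    (k : κ) (F : α → ℝ) : 𝔼 f : κ → α, F (f k) = 𝔼 a, F a := by
  have h := Fintype.expect_comp_injective (α := α) (g := fun _ : Unit => k)
    (fun _ _ _ => rfl) (fun u => F (u ()))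
  simp only [Function.comp_def] at h
  rw [h]
  exact Fintype.expect_equiv (Equiv.funUnique Unit α) _ _ (fun _ => rfl)

/-! ### Random signs -/

/-- The sign encoded by a Boolean, with `true` encoding `-1`. -/
def boolSign (b : Bool) : ℝ := if b then -1 else 1

@[simp] lemma boolSign_true : boolSign true = -1 := rfl

@[simp] lemma boolSign_false : boolSign false = 1 := rfl

lemma boolSign_xor (a b : Bool) : boolSign (xor a b) = boolSign a * boolSign b := by
  cases a <;> cases b <;> simp

@[simp] lemma boolSign_not (b : Bool) : boolSign (!b) = -boolSign b := by
  cases b <;> simp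

@[simp] lemma boolSign_mul_self (b : Bool) : boolSign b * boolSign b = 1 := by
  cases b <;> simp

@[simp] lemma abs_boolSign (b : Bool) : |boolSign b| = 1 := by
  cases b <;> simp

/-- Changing the signs prescribed by `δ`. -/
def flipSigns {ι : Type*} (δ : ι → Bool) : Equiv.Perm (ι → Bool) :=
  Function.Involutive.toPerm (fun ε i => xor (ε i) (δ i)) (fun ε => by ext i; simp)

@[simp] lemma flipSigns_apply {ι : Type*} (δ ε : ι → Bool) (i : ι) :
    flipSigns δ ε i = xor (ε i) (δ i) := rfl

lemma expect_flipSigns {ι : Type*} [Fintype ι] [DecidableEq ι] (δ : ι → Bool)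
    (F : (ι → Bool) → ℝ) : 𝔼 ε, F (flipSigns δ ε) = 𝔼 ε, F ε :=
  Fintype.expect_equiv (flipSigns δ) _ _ (fun _ => rfl)

section RadSq

variable {ι κ : Type*} [Fintype ι] [DecidableEq ι] [Fintype κ] [DecidableEq κ]
  {E : Type*} [NormedAddCommGroup E] [NormedSpace ℝ E]

/-- The mean square of the norm of a random signed sum of the vectors `x i`. -/
def radSq (x : ι → E) : ℝ := 𝔼 ε : ι → Bool, ‖∑ i, boolSign (ε i) • x i‖ ^ 2

lemma radSq_nonneg (x : ι → E) : 0 ≤ radSq x :=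
  Finset.expect_nonneg fun _ _ => by positivity

lemma radSq_comp_equiv (e : κ ≃ ι) (x : ι → E) : radSq (x ∘ e) = radSq x := by
  unfold radSq
  refine Fintype.expect_equiv (e.arrowCongr (Equiv.refl Bool)) _ _ (fun ε => ?_)
  rw [← e.sum_comp]
  simp

/-- Randomizing the signs of the blocks of a partition does not change the mean square. -/
lemma radSq_eq_expect_blocks (g : ι → κ) (x : ι → E) :
    radSq x = 𝔼 ε : ι → Bool,
      radSq (fun l => ∑ i with g i = l, boolSign (ε i) • x i) := by
  unfold radSq
  rw [Finset.expect_comm]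
  rw [← Fintype.expect_const (ι := κ → Bool)
    (𝔼 ε : ι → Bool, ‖∑ i, boolSign (ε i) • x i‖ ^ 2)]
  refine Finset.expect_congr rfl (fun δ _ => ?_)
  rw [← expect_flipSigns (δ ∘ g)]
  refine Finset.expect_congr rfl (fun ε _ => ?_)
  congr 2
  rw [← Finset.sum_fiberwise (s := Finset.univ) (g := g)]
  refine Finset.sum_congr rfl (fun l _ => ?_)
  rw [Finset.smul_sum]
  refine Finset.sum_congr rfl (fun i hi => ?_)
  simp only [Finset.mem_filter, Finset.mem_univ, true_and] at hi
  rw [flipSigns_apply, boolSign_xor, smul_smul, Function.comp_apply, hi, mul_comm]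

lemma norm_sq_le_radSq (x : ι → E) (i : ι) : ‖x i‖ ^ 2 ≤ radSq x := by
  have key : ∀ ε : ι → Bool, ‖x i‖ ^ 2 ≤
      (‖∑ j, boolSign (ε j) • x j‖ ^ 2 +
        ‖∑ j, boolSign (flipSigns (fun j => !decide (j = i)) ε j) • x j‖ ^ 2) / 2 := by
    intro ε
    have h : boolSign (ε i) • x i = (1 / 2 : ℝ) • ((∑ j, boolSign (ε j) • x j) +
        ∑ j, boolSign (flipSigns (fun j => !decide (j = i)) ε j) • x j) := by
      rw [← Finset.sum_add_distrib, Finset.smul_sum, Finset.sum_eq_single i]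
      · simp only [flipSigns_apply, decide_true, Bool.not_true, Bool.xor_false]
        rw [← two_smul ℝ, smul_smul]; norm_num
      · intro j _ hj
        simp [hj]
      · simp
    have h2 : ‖x i‖ = ‖boolSign (ε i) • x i‖ := by
      rw [norm_smul, Real.norm_eq_abs, abs_boolSign, one_mul]
    rw [h2, h, norm_smul, Real.norm_of_nonneg (by norm_num)]
    have h3 := norm_add_le (∑ j, boolSign (ε j) • x j)
      (∑ j, boolSign (flipSigns (fun j => !decide (j = i)) ε j) • x j)
    set u := ‖∑ j, boolSign (ε j) • x j‖
    set v := ‖∑ j, boolSign (flipSigns (fun j => !decide (j = i)) ε j) • x j‖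
    have := pow_le_pow_left₀ (norm_nonneg _) h3 2
    nlinarith [sq_nonneg (u - v)]
  calc ‖x i‖ ^ 2 = 𝔼 _ε : ι → Bool, ‖x i‖ ^ 2 := (Fintype.expect_const _).symm
    _ ≤ _ := Finset.expect_le_expect fun ε _ => key ε
    _ = radSq x := by
      rw [← Finset.expect_div, Finset.expect_add_distrib,
        expect_flipSigns (fun j => !decide (j = i)) (fun ε => ‖∑ j, boolSign (ε j) • x j‖ ^ 2)]
      unfold radSq; ring

lemma radSq_comp_injective_le {f : κ → ι} (hf : Function.Injective f) (x : ι → E) :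
    radSq (x ∘ f) ≤ radSq x := by
  classical
  rw [radSq_eq_expect_blocks (fun i => decide (i ∈ Set.range f)) x]
  calc radSq (x ∘ f)
      = 𝔼 ε : ι → Bool, ‖∑ k, boolSign ((ε ∘ f) k) • x (f k)‖ ^ 2 :=
        (Fintype.expect_comp_injective hf
          (fun ε => ‖∑ k, boolSign (ε k) • x (f k)‖ ^ 2)).symm
    _ ≤ _ := Finset.expect_le_expect fun ε _ => by
        refine le_trans (le_of_eq ?_) (norm_sq_le_radSq _ true)
        congr 2
        simp only [Function.comp_apply, decide_eq_true_eq]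
        rw [← Finset.sum_image (s := Finset.univ) (g := f)
          (f := fun i => boolSign (ε i) • x i) hf.injOn]
        congr 1
        ext i; simp

/-- Coordinates with respect to a functional are square summable with the Rademacher bound. -/
lemma sum_sq_le_radSq (x : ι → E) (φ : E →L[ℝ] ℝ) (hφ : ‖φ‖ ≤ 1) :
    ∑ i, φ (x i) ^ 2 ≤ radSq x := by
  have h1 : 𝔼 ε : ι → Bool, (∑ i, boolSign (ε i) * φ (x i)) ^ 2 ≤ radSq x := by
    refine Finset.expect_le_expect fun ε _ => ?_
    have : ∑ i, boolSign (ε i) * φ (x i) = φ (∑ i, boolSign (ε i) • x i) := by simp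
    rw [this, ← sq_abs, ← Real.norm_eq_abs]
    gcongr
    exact (φ.le_of_opNorm_le hφ _).trans_eq (one_mul _)
  refine le_trans (le_of_eq ?_) h1
  have h2 : ∀ i j, 𝔼 ε : ι → Bool, boolSign (ε i) * φ (x i) * (boolSign (ε j) * φ (x j)) =
      if i = j then φ (x i) ^ 2 else 0 := by
    intro i j
    split_ifs with hij
    · subst hij
      rw [← Fintype.expect_const (ι := ι → Bool) (φ (x i) ^ 2)]
      refine Finset.expect_congr rfl fun ε _ => ?_
      linear_combination φ (x i) ^ 2 * boolSign_mul_self (ε i)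
    · have h3 := expect_flipSigns (fun k => decide (k = i))
        (fun ε : ι → Bool => boolSign (ε i) * φ (x i) * (boolSign (ε j) * φ (x j)))
      have h4 : ∀ ε : ι → Bool, boolSign (flipSigns (fun k => decide (k = i)) ε i) * φ (x i) *
          (boolSign (flipSigns (fun k => decide (k = i)) ε j) * φ (x j)) =
          -(boolSign (ε i) * φ (x i) * (boolSign (ε j) * φ (x j))) := by
        intro ε
        simp [Ne.symm hij]
      simp only [h4, Finset.expect_neg_distrib] at h3
      linarith
  simp only [sq (∑ i, _), Finset.sum_mul_sum, Finset.expect_sum_comm, h2]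
  simp

end RadSq

/-! ### Comparison, symmetrization and random transversals -/

/-- Exchanging the coordinates of two functions where `ε` is `true`. -/
def swapWhere {κ β : Type*} (ε : κ → Bool) : Equiv.Perm ((κ → β) × (κ → β)) :=
  Function.Involutive.toPerm
    (fun p => (fun k => if ε k then p.2 k else p.1 k, fun k => if ε k then p.1 k else p.2 k))
    (fun p => by
      ext k <;> by_cases h : ε k <;> simp [h])

@[simp] lemma swapWhere_fst {κ β : Type*} (ε : κ → Bool) (p : (κ → β) × (κ → β)) (k : κ) :
    (swapWhere ε p).1 k = if ε k then p.2 k else p.1 k := rfl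

@[simp] lemma swapWhere_snd {κ β : Type*} (ε : κ → Bool) (p : (κ → β) × (κ → β)) (k : κ) :
    (swapWhere ε p).2 k = if ε k then p.1 k else p.2 k := rfl

section Comparison

variable {ι κ β : Type*} [Fintype ι] [DecidableEq ι] [Fintype κ] [DecidableEq κ]
  [Fintype β] {E : Type*} [NormedAddCommGroup E] [NormedSpace ℝ E]

lemma expect_sum_sign_ite_abs_le (x : ι → E) (S : Finset ι) :
    ∀ Φ : (ι → Bool) → E →L[ℝ] ℝ, (∀ ε, ‖Φ ε‖ ≤ 1) →
      𝔼 ε, ∑ i, boolSign (ε i) * (if i ∈ S then |Φ ε (x i)| else Φ ε (x i)) ≤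
        𝔼 ε : ι → Bool, ‖∑ i, boolSign (ε i) • x i‖ := by
  induction S using Finset.induction_on with
  | empty =>
    intro Φ hΦ
    refine Finset.expect_le_expect fun ε _ => ?_
    have h : ∑ i, boolSign (ε i) * (if i ∈ (∅ : Finset ι) then |Φ ε (x i)| else Φ ε (x i)) =
        Φ ε (∑ i, boolSign (ε i) • x i) := by simp
    rw [h]
    exact (le_abs_self _).trans (((Φ ε).le_of_opNorm_le (hΦ ε) _).trans_eq (one_mul _))
  | insert j S hj ih =>
    intro Φ hΦ
    set τ := flipSigns (fun k : ι => decide (k = j)) with hτ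
    have hττ : ∀ ε, τ (τ ε) = ε := fun ε => by ext i; simp [hτ]
    have hτj : ∀ ε, boolSign (τ ε j) = -boolSign (ε j) := fun ε => by simp [hτ]
    have hτi : ∀ ε i, i ≠ j → τ ε i = ε i := fun ε i hi => by simp [hτ, hi]
    let Φ' : (ι → Bool) → E →L[ℝ] ℝ := fun ε =>
      if 0 ≤ boolSign (ε j) * (Φ ε (x j) - Φ (τ ε) (x j)) then Φ ε else Φ (τ ε)
    have hΦ' : ∀ ε, ‖Φ' ε‖ ≤ 1 := by
      intro ε
      simp only [Φ']
      split_ifs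
      exacts [hΦ _, hΦ _]
    refine le_trans ?_ (ih Φ' hΦ')
    let a : (ι → Bool) → (E →L[ℝ] ℝ) → ℝ := fun ε φ =>
      ∑ i ∈ Finset.univ.erase j, boolSign (ε i) * (if i ∈ S then |φ (x i)| else φ (x i))
    have ha : ∀ ε φ, a (τ ε) φ = a ε φ := fun ε φ =>
      Finset.sum_congr rfl fun i hi => by rw [hτi ε i (Finset.ne_of_mem_erase hi)]
    have h1 : ∀ ε φ, ∑ i, boolSign (ε i) *
        (if i ∈ insert j S then |φ (x i)| else φ (x i)) =
        a ε φ + boolSign (ε j) * |φ (x j)| := by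
      intro ε φ
      rw [← Finset.sum_erase_add _ _ (Finset.mem_univ j)]
      congr 1
      · refine Finset.sum_congr rfl fun i hi => ?_
        simp [Finset.mem_insert, Finset.ne_of_mem_erase hi]
      · simp
    have h2 : ∀ ε φ, ∑ i, boolSign (ε i) * (if i ∈ S then |φ (x i)| else φ (x i)) =
        a ε φ + boolSign (ε j) * φ (x j) := by
      intro ε φ
      rw [← Finset.sum_erase_add _ _ (Finset.mem_univ j), if_neg hj]
    have key : ∀ ε, (a ε (Φ ε) + boolSign (ε j) * |Φ ε (x j)|) +
        (a (τ ε) (Φ (τ ε)) + boolSign (τ ε j) * |Φ (τ ε) (x j)|) ≤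
        (a ε (Φ' ε) + boolSign (ε j) * Φ' ε (x j)) +
        (a (τ ε) (Φ' (τ ε)) + boolSign (τ ε j) * Φ' (τ ε) (x j)) := by
      intro ε
      have e1 : boolSign (τ ε j) * (Φ (τ ε) (x j) - Φ (τ (τ ε)) (x j)) =
          boolSign (ε j) * (Φ ε (x j) - Φ (τ ε) (x j)) := by
        rw [hττ, hτj]; ring
      have e2 : boolSign (ε j) * (|Φ ε (x j)| - |Φ (τ ε) (x j)|) ≤
          |boolSign (ε j) * (Φ ε (x j) - Φ (τ ε) (x j))| := by
        refine (le_abs_self _).trans ?_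
        rw [abs_mul, abs_mul, abs_boolSign, one_mul, one_mul]
        exact abs_abs_sub_abs_le_abs_sub _ _
      by_cases hc : 0 ≤ boolSign (ε j) * (Φ ε (x j) - Φ (τ ε) (x j))
      · have p1 : Φ' ε = Φ ε := if_pos hc
        have p2 : Φ' (τ ε) = Φ (τ ε) := if_pos (e1 ▸ hc)
        rw [p1, p2, hτj]
        rw [abs_of_nonneg hc] at e2
        linarith
      · have p1 : Φ' ε = Φ (τ ε) := if_neg hc
        have p2 : Φ' (τ ε) = Φ ε := by
          have : Φ' (τ ε) = Φ (τ (τ ε)) := if_neg (e1 ▸ hc)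
          rw [this, hττ]
        rw [p1, p2, hτj, ha, ha]
        rw [abs_of_neg (not_le.mp hc)] at e2
        linarith
    simp only [h1, h2]
    have hsum := Finset.expect_le_expect (s := Finset.univ) fun ε _ => key ε
    have e1 := expect_flipSigns (fun k => decide (k = j))
      (fun ε => a ε (Φ ε) + boolSign (ε j) * |Φ ε (x j)|)
    have e2 := expect_flipSigns (fun k => decide (k = j))
      (fun ε => a ε (Φ' ε) + boolSign (ε j) * Φ' ε (x j))
    simp only [Finset.expect_add_distrib, hτ] at hsum e1 e2 ⊢
    linarith

/-- Contraction principle for the absolute value, for a sign-dependent choice of functionals. -/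
lemma expect_sum_sign_abs_le (x : ι → E) (Φ : (ι → Bool) → E →L[ℝ] ℝ) (hΦ : ∀ ε, ‖Φ ε‖ ≤ 1) :
    𝔼 ε, ∑ i, boolSign (ε i) * |Φ ε (x i)| ≤
      𝔼 ε : ι → Bool, ‖∑ i, boolSign (ε i) • x i‖ := by
  simpa using expect_sum_sign_ite_abs_le x Finset.univ Φ hΦ

lemma expect_sum_abs_transversal_le [Nonempty β] (x : κ → β → E)
    (φ : (κ → β) → E →L[ℝ] ℝ) (hφ : ∀ f, ‖φ f‖ ≤ 1) {W : ℝ}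
    (hW : ∀ ψ : E →L[ℝ] ℝ, ‖ψ‖ ≤ 1 → ∑ k, ∑ l, |ψ (x k l)| ≤ W) :
    𝔼 f, ∑ k, |φ f (x k (f k))| ≤ W / Fintype.card β +
      2 * 𝔼 f : κ → β, 𝔼 ε : κ → Bool, ‖∑ k, boolSign (ε k) • x k (f k)‖ := by
  let G : (κ → β) × (κ → β) → ℝ := fun p =>
    ∑ k, (|φ p.1 (x k (p.1 k))| - |φ p.1 (x k (p.2 k))|)
  have h1 : 𝔼 f, ∑ k, |φ f (x k (f k))| =
      𝔼 f, 𝔼 h : κ → β, ∑ k, |φ f (x k (h k))| + 𝔼 p, G p := by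
    rw [← Finset.univ_product_univ, Finset.expect_product, ← Finset.expect_add_distrib]
    refine Finset.expect_congr rfl fun f _ => ?_
    simp only [G, Finset.sum_sub_distrib, Finset.expect_sub_distrib, Fintype.expect_const]
    ring
  have h2 : 𝔼 f, 𝔼 h : κ → β, ∑ k, |φ f (x k (h k))| ≤ W / Fintype.card β := by
    refine Finset.expect_le Finset.univ_nonempty fun f _ => ?_
    rw [Finset.expect_sum_comm]
    simp only [fun k => Fintype.expect_eval k (fun l => |φ f (x k l)|),
      Fintype.expect_eq_sum_div_card, ← Finset.sum_div]
    gcongr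
    exact hW _ (hφ f)
  have h3 : 𝔼 p, G p = 𝔼 p, 𝔼 ε : κ → Bool, G (swapWhere ε p) := by
    rw [Finset.expect_comm, ← Fintype.expect_const (ι := κ → Bool) (𝔼 p, G p)]
    refine Finset.expect_congr rfl fun ε _ => ?_
    exact (Fintype.expect_equiv (swapWhere ε) _ _ fun _ => rfl).symm
  have h4 : ∀ (p : (κ → β) × (κ → β)) (ε : κ → Bool), G (swapWhere ε p) =
      ∑ k, boolSign (ε k) * |φ (swapWhere ε p).1 (x k (p.1 k))| +
      ∑ k, boolSign (!ε k) * |φ (swapWhere ε p).1 (x k (p.2 k))| := by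
    intro p ε
    rw [← Finset.sum_add_distrib]
    refine Finset.sum_congr rfl fun k _ => ?_
    generalize hψ : φ (swapWhere ε p).1 = ψ
    by_cases h : ε k <;> simp [h, sub_eq_add_neg, add_comm]
  have h5 : ∀ p : (κ → β) × (κ → β), 𝔼 ε : κ → Bool, G (swapWhere ε p) ≤
      𝔼 ε : κ → Bool, ‖∑ k, boolSign (ε k) • x k (p.1 k)‖ +
      𝔼 ε : κ → Bool, ‖∑ k, boolSign (ε k) • x k (p.2 k)‖ := by
    intro p
    simp only [h4, Finset.expect_add_distrib]
    refine add_le_add (expect_sum_sign_abs_le _ (fun ε => φ (swapWhere ε p).1) fun _ => hφ _) ?_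
    rw [← expect_flipSigns (fun _ => true)]
    have h6 : ∀ ε : κ → Bool, ∀ k, (!flipSigns (fun _ => true) ε k) = ε k := by simp
    simp only [h6]
    exact expect_sum_sign_abs_le _ (fun ε => φ (swapWhere (flipSigns (fun _ => true) ε) p).1)
      fun _ => hφ _
  have h6 : 𝔼 p, 𝔼 ε : κ → Bool, G (swapWhere ε p) ≤
      2 * 𝔼 f : κ → β, 𝔼 ε : κ → Bool, ‖∑ k, boolSign (ε k) • x k (f k)‖ := by
    refine (Finset.expect_le_expect fun p _ => h5 p).trans_eq ?_
    rw [← Finset.univ_product_univ, Finset.expect_product]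
    simp only [Finset.expect_add_distrib, Fintype.expect_const]
    ring
  rw [h1, h3]
  exact add_le_add h2 h6

end Comparison

/-! ### Rademacher functions and random signs -/

/-- The Boolean encoding the sign of the `k`-th Rademacher function at `t`. -/
def rademacherBit (k : ℕ) (t : ℝ) : Bool := decide (Odd ⌊(2 : ℝ) ^ (k + 1) * t⌋)

lemma Rademacher_eq_boolSign (k : ℕ) (t : ℝ) :
    Rademacher k t = boolSign (rademacherBit k t) := by
  unfold Rademacher rademacherBit
  by_cases h : Odd ⌊(2 : ℝ) ^ (k + 1) * t⌋
  · simp [h, h.neg_one_zpow]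
  · simp [h, (Int.not_odd_iff_even.mp h).neg_one_zpow]

lemma measurable_rademacherBit (k : ℕ) : Measurable (rademacherBit k) :=
  (Measurable.of_discrete (f := fun z : ℤ => decide (Odd z))).comp
    (Int.measurable_floor.comp (measurable_const.mul measurable_id))

lemma intervalIntegrable_rademacherBits {n : ℕ} (F : (Fin n → Bool) → ℝ) (a b : ℝ) :
    IntervalIntegrable (fun t => F fun k => rademacherBit k t) MeasureTheory.volume a b := by
  have hm : Measurable (fun t => F fun k => rademacherBit k t) :=
    (Measurable.of_discrete (f := F)).comp
      (measurable_pi_lambda _ fun k => measurable_rademacherBit k)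
  refine (intervalIntegrable_const (c := ∑ ε, |F ε|)).mono_fun hm.aestronglyMeasurable ?_
  refine Filter.Eventually.of_forall fun t => ?_
  refine le_trans ?_ (le_abs_self _)
  exact Finset.single_le_sum (f := fun ε => |F ε|) (fun _ _ => abs_nonneg _) (Finset.mem_univ _)

lemma rademacherBit_zero_half {t : ℝ} (ht : t ∈ Set.Ico (0 : ℝ) 1) :
    rademacherBit 0 (t / 2) = false := by
  have : ⌊(2 : ℝ) ^ (0 + 1) * (t / 2)⌋ = 0 := by
    rw [Int.floor_eq_zero_iff]; constructor <;> linarith [ht.1, ht.2]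
  simp only [rademacherBit, this]; decide

lemma rademacherBit_zero_half_add {t : ℝ} (ht : t ∈ Set.Ico (0 : ℝ) 1) :
    rademacherBit 0 (1 / 2 + t / 2) = true := by
  have : ⌊(2 : ℝ) ^ (0 + 1) * (1 / 2 + t / 2)⌋ = 1 := by
    rw [Int.floor_eq_iff]; constructor <;> norm_num <;> linarith [ht.1, ht.2]
  simp only [rademacherBit, this]; decide

lemma rademacherBit_succ_half (k : ℕ) (t : ℝ) :
    rademacherBit (k + 1) (t / 2) = rademacherBit k t := by
  unfold rademacherBit
  have : (2 : ℝ) ^ (k + 1 + 1) * (t / 2) = 2 ^ (k + 1) * t := by ring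
  rw [this]

lemma rademacherBit_succ_half_add (k : ℕ) (t : ℝ) :
    rademacherBit (k + 1) (1 / 2 + t / 2) = rademacherBit k t := by
  unfold rademacherBit
  have : (2 : ℝ) ^ (k + 1 + 1) * (1 / 2 + t / 2) =
      2 ^ (k + 1) * t + ((2 ^ (k + 1) : ℤ) : ℝ) := by push_cast; ring
  rw [this, Int.floor_add_intCast]
  have h2 : Even ((2 : ℤ) ^ (k + 1)) := (even_two).pow_of_ne_zero (Nat.succ_ne_zero k)
  simp [Int.odd_add, h2]

lemma integral_rademacherBits : ∀ {n : ℕ} (F : (Fin n → Bool) → ℝ),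
    ∫ t in (0 : ℝ)..1, F (fun k => rademacherBit k t) = 𝔼 ε, F ε := by
  intro n
  induction n with
  | zero =>
    intro F
    have : ∀ ε, F ε = F default := fun ε => congrArg F (Subsingleton.elim _ _)
    simp only [this]
    simp
  | succ n ih =>
    intro F
    set f : ℝ → ℝ := fun t => F fun k => rademacherBit k t with hf
    have hint := fun a b => intervalIntegrable_rademacherBits F a b
    have h1 : ∫ t in (0 : ℝ)..1, f (t / 2) = 𝔼 ε, F (Fin.cons false ε) := by
      rw [← ih fun ε => F (Fin.cons false ε)]
      refine intervalIntegral.integral_congr_ae ?_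
      filter_upwards [MeasureTheory.Measure.ae_ne MeasureTheory.volume (1 : ℝ)] with t ht ht'
      rw [Set.uIoc_of_le zero_le_one] at ht'
      have ht2 : t ∈ Set.Ico (0 : ℝ) 1 := ⟨ht'.1.le, lt_of_le_of_ne ht'.2 ht⟩
      simp only [hf]
      congr 1
      ext k
      refine Fin.cases ?_ (fun k => ?_) k
      · simpa using rademacherBit_zero_half ht2
      · simpa using rademacherBit_succ_half k t
    have h2 : ∫ t in (0 : ℝ)..1, f (1 / 2 + t / 2) = 𝔼 ε, F (Fin.cons true ε) := by
      rw [← ih fun ε => F (Fin.cons true ε)]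
      refine intervalIntegral.integral_congr_ae ?_
      filter_upwards [MeasureTheory.Measure.ae_ne MeasureTheory.volume (1 : ℝ)] with t ht ht'
      rw [Set.uIoc_of_le zero_le_one] at ht'
      have ht2 : t ∈ Set.Ico (0 : ℝ) 1 := ⟨ht'.1.le, lt_of_le_of_ne ht'.2 ht⟩
      simp only [hf]
      congr 1
      ext k
      refine Fin.cases ?_ (fun k => ?_) k
      · simpa using rademacherBit_zero_half_add ht2
      · simpa using rademacherBit_succ_half_add k t
    rw [intervalIntegral.integral_comp_div f two_ne_zero] at h1
    rw [intervalIntegral.integral_comp_add_div f two_ne_zero] at h2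
    have h3 := intervalIntegral.integral_add_adjacent_intervals (hint 0 (1 / 2)) (hint (1 / 2) 1)
    have h4 : 𝔼 ε, F ε = (𝔼 ε, F (Fin.cons false ε) + 𝔼 ε, F (Fin.cons true ε)) / 2 := by
      rw [← Fintype.expect_equiv (Fin.consEquiv fun _ : Fin (n + 1) => Bool)
        (fun p => F (Fin.cons p.1 p.2)) F (fun _ => rfl), ← Finset.univ_product_univ,
        Finset.expect_product, Fintype.expect_eq_sum_div_card]
      simp [add_comm]
    rw [← h3, h4, ← h1, ← h2]
    simp only [hf, smul_eq_mul]
    norm_num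
    ring

section CotypeBound

variable {E : Type*} [NormedAddCommGroup E] [NormedSpace ℝ E]

lemma integral_norm_rademacher_sq {n : ℕ} (x : Fin n → E) :
    ∫ t in (0 : ℝ)..1, ‖∑ k : Fin n, Rademacher k.1 t • x k‖ ^ 2 = radSq x := by
  simp only [Rademacher_eq_boolSign]
  exact integral_rademacherBits fun ε => ‖∑ k, boolSign (ε k) • x k‖ ^ 2

/-- The cotype `q` inequality with constant `C`, for families indexed by finite types. -/
def CotypeBound (q C : ℝ) (E : Type*) [NormedAddCommGroup E] [NormedSpace ℝ E] : Prop :=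
  ∀ (ι : Type) [Fintype ι] [DecidableEq ι] (x : ι → E),
    ∑ i, ‖x i‖ ^ q ≤ (C * √(radSq x)) ^ q

lemma HasCotype.exists_cotypeBound {q : ℝ} (h : HasCotype q E) :
    ∃ C > 0, CotypeBound q C E := by
  obtain ⟨hq, C, hC, h⟩ := h
  refine ⟨C, hC, fun ι _ _ x => ?_⟩
  have h1 := h _ (x ∘ (Fintype.equivFin ι).symm)
  rw [integral_norm_rademacher_sq, radSq_comp_equiv, ← Real.sqrt_eq_rpow] at h1
  have h2 : ∑ k, ‖(x ∘ (Fintype.equivFin ι).symm) k‖ ^ q = ∑ i, ‖x i‖ ^ q :=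
    (Fintype.equivFin ι).symm.sum_comp fun i => ‖x i‖ ^ q
  rw [h2] at h1
  have h3 : 0 ≤ ∑ i, ‖x i‖ ^ q := Finset.sum_nonneg fun _ _ => by positivity
  calc ∑ i, ‖x i‖ ^ q = ((∑ i, ‖x i‖ ^ q) ^ (1 / q)) ^ q := by
        rw [← Real.rpow_mul h3, one_div_mul_cancel (by linarith), Real.rpow_one]
    _ ≤ _ := Real.rpow_le_rpow (by positivity) h1 (by linarith)

lemma hasCotype_of_cotypeBound {q C : ℝ} (hq : 2 ≤ q) (hC : 0 < C)
    (h : CotypeBound q C E) : HasCotype q E := by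
  refine ⟨hq, C, hC, fun n x => ?_⟩
  rw [integral_norm_rademacher_sq, ← Real.sqrt_eq_rpow]
  calc (∑ k, ‖x k‖ ^ q) ^ (1 / q) ≤ ((C * √(radSq x)) ^ q) ^ (1 / q) :=
        Real.rpow_le_rpow (Finset.sum_nonneg fun _ _ => by positivity) (h _ x) (by positivity)
    _ = C * √(radSq x) := by
        rw [← Real.rpow_mul (by positivity), mul_one_div_cancel (by linarith), Real.rpow_one]

lemma CotypeBound.mono {p q C : ℝ} (hp : 0 < p) (hpq : p ≤ q) (hC : 0 < C)
    (h : CotypeBound p C E) : CotypeBound q C E := by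
  intro ι _ _ x
  set S := C * √(radSq x)
  have hS : 0 ≤ S := by positivity
  have h1 : ∀ i, ‖x i‖ ≤ S := fun i => by
    refine (Real.rpow_le_rpow_iff (norm_nonneg _) hS hp).mp (le_trans ?_ (h ι x))
    exact Finset.single_le_sum (f := fun i => ‖x i‖ ^ p) (fun _ _ => by positivity)
      (Finset.mem_univ i)
  calc ∑ i, ‖x i‖ ^ q ≤ ∑ i, S ^ (q - p) * ‖x i‖ ^ p := by
        refine Finset.sum_le_sum fun i _ => ?_
        have h2 : ‖x i‖ ^ q = ‖x i‖ ^ (q - p) * ‖x i‖ ^ p := by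
          rw [← Real.rpow_add_of_nonneg (norm_nonneg _) (by linarith) hp.le, sub_add_cancel]
        rw [h2]
        gcongr
        · exact h1 i
    _ ≤ S ^ (q - p) * S ^ p := by
        rw [← Finset.mul_sum]
        gcongr
        exact h ι x
    _ = S ^ q := by
        rw [← Real.rpow_add_of_nonneg hS (by linarith) hp.le, sub_add_cancel]

/-- Cotype `q ≥ 2` bounds sums of squares of at most `N` norms. -/
lemma CotypeBound.sum_sq_le {q C : ℝ} (hq : 2 ≤ q) (hC : 0 < C) (h : CotypeBound q C E)
    {ι : Type} [Fintype ι] [DecidableEq ι] [Nonempty ι] (x : ι → E) :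
    ∑ i, ‖x i‖ ^ 2 ≤ (Fintype.card ι : ℝ) * (Fintype.card ι : ℝ) ^ (-(2 / q)) *
      (C ^ 2 * radSq x) := by
  have hq0 : 0 < q := by linarith
  have hN : (0 : ℝ) < Fintype.card ι := by exact_mod_cast Fintype.card_pos
  have h1 := Real.rpow_sum_le_const_mul_sum_rpow_of_nonneg (s := Finset.univ)
    (f := fun i => ‖x i‖ ^ 2) (p := q / 2) (by linarith) (fun i _ => by positivity)
  have h2 : ∀ i, (‖x i‖ ^ 2) ^ (q / 2) = ‖x i‖ ^ q := fun i => by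
    rw [← Real.rpow_natCast, ← Real.rpow_mul (norm_nonneg _)]
    congr 1; push_cast; ring
  simp only [h2, Finset.card_univ] at h1
  have h3 : (C * √(radSq x)) ^ q = (C ^ 2 * radSq x) ^ (q / 2) := by
    have : C ^ 2 * radSq x = (C * √(radSq x)) ^ (2 : ℝ) := by
      rw [Real.rpow_two, mul_pow, Real.sq_sqrt (radSq_nonneg x)]
    rw [this, ← Real.rpow_mul (by positivity)]
    congr 1; ring
  have h4 : (∑ i, ‖x i‖ ^ 2) ^ (q / 2) ≤ ((Fintype.card ι : ℝ) *
      (Fintype.card ι : ℝ) ^ (-(2 / q)) * (C ^ 2 * radSq x)) ^ (q / 2) := by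
    refine h1.trans ?_
    rw [Real.mul_rpow (by positivity) (mul_nonneg (by positivity) (radSq_nonneg x)), ← h3]
    have h5 : (Fintype.card ι : ℝ) * (Fintype.card ι : ℝ) ^ (-(2 / q)) =
        (Fintype.card ι : ℝ) ^ (1 - 2 / q) := by
      rw [sub_eq_add_neg, Real.rpow_add hN, Real.rpow_one]
    have h6 : (1 - 2 / q) * (q / 2) = q / 2 - 1 := by field_simp
    rw [h5, ← Real.rpow_mul hN.le, h6]
    gcongr
    exact h ι x
  exact (Real.rpow_le_rpow_iff (Finset.sum_nonneg fun _ _ => by positivity)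
    (mul_nonneg (by positivity) (mul_nonneg (by positivity) (radSq_nonneg x)))
    (by positivity)).mp h4

end CotypeBound

/-! ### Families with small absolute sums against functionals -/

lemma sq_expect_le_expect_sq {α : Type*} [Fintype α] [Nonempty α] (g : α → ℝ) :
    (𝔼 a, g a) ^ 2 ≤ 𝔼 a, g a ^ 2 := by
  simpa [Fintype.expect_const] using
    Finset.expect_mul_sq_le_sq_mul_sq (Finset.univ : Finset α) g (fun _ => 1)

section Selection

variable {E : Type*} [NormedAddCommGroup E] [NormedSpace ℝ E]

lemma radSq_smul {ι : Type*} [Fintype ι] [DecidableEq ι] (c : ℝ) (x : ι → E) :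
    radSq (fun i => c • x i) = c ^ 2 * radSq x := by
  unfold radSq
  rw [Finset.mul_expect]
  refine Finset.expect_congr rfl fun ε _ => ?_
  simp only [smul_comm _ c]
  rw [← Finset.smul_sum, norm_smul, mul_pow, Real.norm_eq_abs, sq_abs]

lemma CotypeBound.sum_radSq_fibers_le {q C : ℝ} (hq : 2 ≤ q) (hC : 0 < C)
    (h : CotypeBound q C E) {κ β : Type} [Fintype κ] [DecidableEq κ] [Fintype β] [DecidableEq β]
    [Nonempty β] (y : κ × β → E) :
    ∑ l, radSq (fun k => y (k, l)) ≤ (Fintype.card β : ℝ) * (Fintype.card β : ℝ) ^ (-(2 / q)) *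
      (C ^ 2 * radSq y) := by
  have h1 : ∀ l, radSq (fun k => y (k, l)) =
      𝔼 ε : κ × β → Bool, ‖∑ i with i.2 = l, boolSign (ε i) • y i‖ ^ 2 := by
    intro l
    have h2 := Fintype.expect_comp_injective (α := Bool) (g := fun k : κ => (k, l))
      (fun _ _ hk => congrArg Prod.fst hk)
      (fun ε => ‖∑ k, boolSign (ε k) • y (k, l)‖ ^ 2)
    unfold radSq
    rw [← h2]
    refine Finset.expect_congr rfl fun ε _ => ?_
    rw [Finset.sum_filter, Fintype.sum_prod_type]
    simp
  simp only [h1]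
  rw [← Finset.expect_sum_comm, radSq_eq_expect_blocks Prod.snd y, Finset.mul_expect,
    Finset.mul_expect]
  exact Finset.expect_le_expect fun ε _ => h.sum_sq_le hq hC _

lemma sum_abs_le_sqrt_card_mul {ι : Type*} [Fintype ι] [DecidableEq ι] (x : ι → E)
    (ψ : E →L[ℝ] ℝ) (hψ : ‖ψ‖ ≤ 1) :
    ∑ i, |ψ (x i)| ≤ √(Fintype.card ι) * √(radSq x) := by
  rw [← Real.sqrt_mul (by positivity)]
  refine Real.le_sqrt_of_sq_le ?_
  refine (sq_sum_le_card_mul_sum_sq (s := Finset.univ)).trans ?_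
  rw [Finset.card_univ]
  gcongr
  simp only [sq_abs]
  exact sum_sq_le_radSq x ψ hψ

lemma CotypeBound.exists_transversal {q C : ℝ} (hq : 2 ≤ q) (hC : 0 < C)
    (h : CotypeBound q C E) {κ β : Type} [Fintype κ] [DecidableEq κ] [Fintype β] [DecidableEq β]
    [AddGroup β] (x : κ × β → E) :
    ∃ f : κ → β, ∀ ψ : E →L[ℝ] ℝ, ‖ψ‖ ≤ 1 → ∑ k, |ψ (x (k, f k))| ≤
      √(radSq x) * (√(Fintype.card κ * Fintype.card β) / Fintype.card β +
        2 * C * (Fintype.card β : ℝ) ^ (-(1 / q))) := by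
  set N : ℝ := (Fintype.card β : ℝ) with hN
  have hN0 : 0 < N := Nat.cast_pos.mpr Fintype.card_pos
  let Q : (κ → β) → ℝ := fun f => radSq (fun k => x (k, f k))
  have hQ : ∀ f : κ → β, ∑ l, Q (fun k => f k + l) ≤ N * N ^ (-(2 / q)) * (C ^ 2 * radSq x) := by
    intro f
    let e : κ × β ≃ κ × β := Equiv.prodShear (Equiv.refl κ) fun k => Equiv.addLeft (f k)
    have h1 := h.sum_radSq_fibers_le hq hC (x ∘ e)
    rw [radSq_comp_equiv] at h1
    exact h1
  have hshift : ∀ l : β, 𝔼 f : κ → β, Q (fun k => f k + l) = 𝔼 f : κ → β, Q f := fun l =>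
    Fintype.expect_equiv ((Equiv.refl κ).arrowCongr (Equiv.addRight l)) _ _
      fun f => rfl
  have hEQ : 𝔼 f : κ → β, Q f ≤ (C * N ^ (-(1 / q)) * √(radSq x)) ^ 2 := by
    have h1 := Finset.expect_le (s := Finset.univ) Finset.univ_nonempty fun f _ => hQ f
    rw [Finset.expect_sum_comm] at h1
    simp only [hshift, Finset.sum_const, Finset.card_univ, nsmul_eq_mul, ← hN] at h1
    have h2 : (C * N ^ (-(1 / q)) * √(radSq x)) ^ 2 = N ^ (-(2 / q)) * (C ^ 2 * radSq x) := by
      rw [mul_pow, mul_pow, Real.sq_sqrt (radSq_nonneg x), ← Real.rpow_natCast (N ^ _),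
        ← Real.rpow_mul hN0.le]
      have : -(1 / q) * ((2 : ℕ) : ℝ) = -(2 / q) := by push_cast; ring
      rw [this]; ring
    rw [h2]
    rw [mul_assoc] at h1
    exact le_of_mul_le_mul_left h1 hN0
  have hE1 : 𝔼 f : κ → β, 𝔼 ε : κ → Bool, ‖∑ k, boolSign (ε k) • x (k, f k)‖ ≤
      C * N ^ (-(1 / q)) * √(radSq x) := by
    refine abs_le_of_sq_le_sq' ?_ (by positivity) |>.2
    refine (sq_expect_le_expect_sq _).trans (le_trans ?_ hEQ)
    exact Finset.expect_le_expect fun f _ => sq_expect_le_expect_sq _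
  by_contra! hcon
  choose φ hφ1 hφ2 using hcon
  have h3 := expect_sum_abs_transversal_le (fun k l => x (k, l)) φ hφ1
    (W := √(Fintype.card κ * Fintype.card β) * √(radSq x)) (fun ψ hψ => by
      have h4 := sum_abs_le_sqrt_card_mul x ψ hψ
      rw [Fintype.sum_prod_type, Fintype.card_prod] at h4
      exact_mod_cast h4)
  obtain ⟨f, _, hf⟩ := Finset.exists_le_of_expect_le (s := Finset.univ)
    Finset.univ_nonempty h3
  refine absurd (hφ2 f) (not_lt.mpr (hf.trans ?_))
  rw [← hN]
  have : √(radSq x) * (√(Fintype.card κ * N) / N + 2 * C * N ^ (-(1 / q))) =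
      √(Fintype.card κ * N) * √(radSq x) / N + 2 * (C * N ^ (-(1 / q)) * √(radSq x)) := by ring
  rw [this]
  gcongr

end Selection

/-! ### Detecting cotype on vectors of norm at least one -/

lemma sum_rpow_le_of_exists_le {ι : Type*} [DecidableEq ι] {f : ι → ℝ} (hf : ∀ i, 0 ≤ f i)
    (g : ℕ → ℝ) {p : ℝ} (hp : 0 ≤ p) (A : Finset ι) :
    (∀ B ⊆ A, B.Nonempty → ∃ i ∈ B, f i ≤ g B.card) →
      ∑ i ∈ A, f i ^ p ≤ ∑ k ∈ Finset.range A.card, g (k + 1) ^ p := by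
  induction hn : A.card generalizing A with
  | zero =>
    intro _
    simp [Finset.card_eq_zero.mp hn]
  | succ n ih =>
    intro h
    obtain ⟨i, hi, hle⟩ := h A subset_rfl (Finset.card_pos.mp (by omega))
    rw [← Finset.sum_erase_add _ _ hi, Finset.sum_range_succ]
    refine add_le_add (ih _ (by rw [Finset.card_erase_of_mem hi, hn]; rfl) fun B hB =>
      h B (hB.trans (Finset.erase_subset _ _))) ?_
    rw [hn] at hle
    exact Real.rpow_le_rpow (hf i) hle hp

/-- A positive upper bound for the partial sums of `∑ (k + 1) ^ (-r)`. -/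
lemma exists_sum_rpow_neg_le {r : ℝ} (hr : 1 < r) :
    ∃ Z > 0, ∀ n : ℕ, ∑ k ∈ Finset.range n, ((k + 1 : ℕ) : ℝ) ^ (-r) ≤ Z := by
  have hs : Summable fun k : ℕ => ((k + 1 : ℕ) : ℝ) ^ (-r) :=
    (summable_nat_add_iff 1).mpr (Real.summable_nat_rpow.mpr (by linarith))
  have h0 : ∀ k : ℕ, 0 ≤ ((k + 1 : ℕ) : ℝ) ^ (-r) := fun k => by positivity
  refine ⟨(∑' k : ℕ, ((k + 1 : ℕ) : ℝ) ^ (-r)) + 1, by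
    have : 0 ≤ ∑' k : ℕ, ((k + 1 : ℕ) : ℝ) ^ (-r) := tsum_nonneg h0
    linarith, fun n => ?_⟩
  have := hs.sum_le_tsum (Finset.range n) fun k _ => h0 k
  linarith

section Levels

variable {E : Type*} [NormedAddCommGroup E] [NormedSpace ℝ E]

lemma exists_cotypeBound_of_le_sqrt_radSq {s r c : ℝ} (hr : 0 < r) (hrs : r < s) (hc : 0 < c)
    (h : ∀ (n : ℕ) (x : Fin n → E), 0 < n → (∀ i, 1 ≤ ‖x i‖) →
      c * (n : ℝ) ^ (1 / r) ≤ √(radSq x)) : ∃ C > 0, CotypeBound s C E := by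
  have hs : 0 < s := hr.trans hrs
  obtain ⟨Z, hZ0, hZ⟩ := exists_sum_rpow_neg_le (r := s / r) ((one_lt_div hr).mpr hrs)
  refine ⟨Z ^ (1 / s) / c, by positivity, fun ι _ _ x => ?_⟩
  set R := √(radSq x) with hR
  have hR0 : 0 ≤ R := Real.sqrt_nonneg _
  have key := sum_rpow_le_of_exists_le (f := fun i => ‖x i‖) (fun i => norm_nonneg _)
    (fun k => R / c * (k : ℝ) ^ (-(1 / r))) hs.le Finset.univ (fun B _ hB => by
      obtain ⟨i, hi, hmin⟩ := Finset.exists_min_image B (fun i => ‖x i‖) hB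
      refine ⟨i, hi, ?_⟩
      rcases (norm_nonneg (x i)).eq_or_lt with h0 | h0
      · rw [← h0]; positivity
      have hB0 : (0 : ℝ) < B.card := by exact_mod_cast hB.card_pos
      let e : Fin B.card → ι := fun j => (B.equivFin.symm j : ι)
      have he : Function.Injective e := Subtype.val_injective.comp B.equivFin.symm.injective
      have h1 := h B.card (fun j => ‖x i‖⁻¹ • (x ∘ e) j) hB.card_pos (fun j => by
        rw [norm_smul, norm_inv, norm_norm, ← div_eq_inv_mul, one_le_div h0]
        exact hmin _ (B.equivFin.symm j).2)
      rw [radSq_smul, Real.sqrt_mul (by positivity), Real.sqrt_sq (by positivity)] at h1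
      have h2 : √(radSq (x ∘ e)) ≤ R := Real.sqrt_le_sqrt (radSq_comp_injective_le he x)
      have h3 : c * (B.card : ℝ) ^ (1 / r) * ‖x i‖ ≤ R := by
        calc c * (B.card : ℝ) ^ (1 / r) * ‖x i‖
            ≤ (‖x i‖⁻¹ * √(radSq (x ∘ e))) * ‖x i‖ := by gcongr
          _ = √(radSq (x ∘ e)) := by field_simp
          _ ≤ R := h2
      rw [Real.rpow_neg hB0.le]
      have h4 : (0 : ℝ) < (B.card : ℝ) ^ (1 / r) := by positivity
      rw [← div_eq_mul_inv, div_div, le_div_iff₀ (by positivity)]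
      linarith)
  refine key.trans ?_
  have h1 : ∀ k : ℕ, (R / c * ((k + 1 : ℕ) : ℝ) ^ (-(1 / r))) ^ s =
      (R / c) ^ s * ((k + 1 : ℕ) : ℝ) ^ (-(s / r)) := by
    intro k
    rw [Real.mul_rpow (by positivity) (by positivity), ← Real.rpow_mul (by positivity)]
    congr 2; ring
  simp only [h1, ← Finset.mul_sum]
  have h2 : (Z ^ (1 / s) / c * R) ^ s = (R / c) ^ s * Z := by
    have : Z ^ (1 / s) / c * R = R / c * Z ^ (1 / s) := by ring
    rw [this, Real.mul_rpow (by positivity) (by positivity), ← Real.rpow_mul hZ0.le,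
      one_div_mul_cancel hs.ne', Real.rpow_one]
  rw [h2]
  gcongr
  exact hZ _

/-- If cotype `s` fails, there are arbitrarily long families of vectors of norm at least one
whose random signed sums are small. -/
lemma exists_sqrt_radSq_le_of_not_hasCotype {s r : ℝ} (hs : 2 ≤ s) (hr : 0 < r) (hrs : r < s)
    (h : ¬ HasCotype s E) (n₀ : ℕ) :
    ∃ n : ℕ, n₀ ≤ n ∧ ∃ x : Fin n → E, (∀ i, 1 ≤ ‖x i‖) ∧ √(radSq x) ≤ (n : ℝ) ^ (1 / r) := by
  have h1 : ∃ n : ℕ, ∃ x : Fin n → E, 0 < n ∧ (∀ i, 1 ≤ ‖x i‖) ∧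
      √(radSq x) < ((n₀ + 1 : ℕ) : ℝ) ^ (-(1 / r)) * (n : ℝ) ^ (1 / r) := by
    by_contra! hcon
    obtain ⟨C, hC, hb⟩ := exists_cotypeBound_of_le_sqrt_radSq hr hrs
      (c := ((n₀ + 1 : ℕ) : ℝ) ^ (-(1 / r))) (by positivity) hcon
    exact h (hasCotype_of_cotypeBound hs hC hb)
  obtain ⟨n, x, hn, hx, hlt⟩ := h1
  have hr' : 0 < 1 / r := by positivity
  refine ⟨n, ?_, x, hx, hlt.le.trans ?_⟩
  · have h2 : 1 ≤ √(radSq x) := by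
      rw [Real.one_le_sqrt]
      exact (one_le_pow₀ (hx ⟨0, hn⟩)).trans (norm_sq_le_radSq x ⟨0, hn⟩)
    have h3 := h2.trans_lt hlt
    rw [Real.rpow_neg (by positivity), ← div_eq_inv_mul, one_lt_div (by positivity)] at h3
    have h4 := (Real.rpow_lt_rpow_iff (by positivity) (by positivity) hr').mp h3
    have h5 : n₀ + 1 < n := by exact_mod_cast h4
    omega
  · refine mul_le_of_le_one_left (by positivity) ?_
    exact Real.rpow_le_one_of_one_le_of_nonpos (by norm_cast; omega) (by linarith)

end Levels

/-! ### A uniform bound for absolutely summing identities -/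

section Uniform

variable {E : Type*} [NormedAddCommGroup E] [NormedSpace ℝ E]

/-- A quantitative form of absolute `(a, p)`-summability of the identity, for finite families. -/
def SummingBound (a p K : ℝ) (E : Type*) [NormedAddCommGroup E] [NormedSpace ℝ E] : Prop :=
  ∀ {ι : Type} (A : Finset ι) (x : ι → E) (M : ℝ), 0 < M →
    (∀ φ : E →L[ℝ] ℝ, ‖φ‖ ≤ 1 → ∑ i ∈ A, |φ (x i)| ^ p ≤ M ^ p) →
    ∑ i ∈ A, ‖x i‖ ^ a ≤ (K * M) ^ a

lemma AbsolutelySumming.exists_summingBound_fin {a p : ℝ} (hp : 1 ≤ p)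
    (h : AbsolutelySumming a p (ContinuousLinearMap.id ℝ E)) :
    ∃ K > 0, ∀ (n : ℕ) (x : Fin n → E) (M : ℝ), 0 < M →
      (∀ φ : E →L[ℝ] ℝ, ‖φ‖ ≤ 1 → ∑ i, |φ (x i)| ^ p ≤ M ^ p) →
      ∑ i, ‖x i‖ ^ a ≤ (K * M) ^ a := by
  by_contra! hcon
  choose n x M hM hw hs using fun k : ℕ => hcon ((2 : ℝ) ^ k) (by positivity)
  have hn : ∀ k, 0 < n k := by
    intro k
    rw [Nat.pos_iff_ne_zero]
    intro h0
    have h1 : ∑ i, ‖x k i‖ ^ a = 0 := by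
      have : IsEmpty (Fin (n k)) := by rw [h0]; infer_instance
      exact Fintype.sum_empty _
    have h2 := hs k
    have h3 := hM k
    rw [h1] at h2
    exact absurd h2 (not_lt.mpr (by positivity))
  let y : (Σ k, Fin (n k)) → E := fun s => ((2 : ℝ) ^ s.1 * M s.1)⁻¹ • x s.1 s.2
  have : Infinite (Σ k, Fin (n k)) :=
    Infinite.of_injective (fun k : ℕ => (⟨k, ⟨0, hn k⟩⟩ : Σ k, Fin (n k)))
      fun k l hkl => congrArg Sigma.fst hkl
  obtain ⟨hden⟩ := nonempty_denumerable (Σ k, Fin (n k))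
  let e : ℕ ≃ Σ k, Fin (n k) := (Denumerable.eqv _).symm
  have hweak : WeaklySummable p (y ∘ e) := by
    intro φ
    have h1 : Summable fun s => |φ (y s)| ^ p := by
      rw [summable_sigma_of_nonneg fun _ => by positivity]
      refine ⟨fun k => Summable.of_finite, ?_⟩
      set t : ℝ := ‖φ‖ + 1
      have ht : 0 < t := by positivity
      refine Summable.of_nonneg_of_le (fun k => tsum_nonneg fun _ => by positivity) (fun k => ?_)
        ((summable_geometric_of_lt_one (r := (1 / 2 : ℝ)) (by norm_num) (by norm_num)).mul_left
          (t ^ p))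
      rw [tsum_fintype]
      have hMk := hM k
      have h2 := hw k (t⁻¹ • φ) (by
        rw [norm_smul, norm_inv, Real.norm_of_nonneg ht.le, ← div_eq_inv_mul, div_le_one ht]
        simp [t])
      have h3 : ∀ i, |φ (y ⟨k, i⟩)| ^ p =
          (t * (2 ^ k * M k)⁻¹) ^ p * |(t⁻¹ • φ) (x k i)| ^ p := by
        intro i
        rw [← Real.mul_rpow (by positivity) (by positivity)]
        congr 1
        simp only [y, map_smul, smul_apply, smul_eq_mul, abs_mul, abs_inv,
          abs_of_pos ht, abs_of_pos hMk, abs_pow, abs_two]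
        field_simp
      simp only [h3, ← Finset.mul_sum]
      calc (t * (2 ^ k * M k)⁻¹) ^ p * ∑ i, |(t⁻¹ • φ) (x k i)| ^ p
          ≤ (t * (2 ^ k * M k)⁻¹) ^ p * M k ^ p := by gcongr
        _ = t ^ p * ((1 / 2) ^ k) ^ p := by
            rw [← Real.mul_rpow (by positivity) (by positivity),
              ← Real.mul_rpow (by positivity) (by positivity)]
            congr 1
            rw [one_div, inv_pow]
            field_simp
        _ ≤ t ^ p * (1 / 2) ^ k := by
            gcongr
            refine (Real.rpow_le_rpow_of_exponent_ge (by positivity)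
              (pow_le_one₀ (by norm_num) (by norm_num)) hp).trans_eq (Real.rpow_one _)
    exact e.summable_iff.mpr h1
  have h1 : Summable fun s => ‖y s‖ ^ a := e.summable_iff.mp (h _ hweak)
  have h2 := ((summable_sigma_of_nonneg fun _ => by positivity).mp h1).2
  have h3 : ∀ k, 1 ≤ ∑' i, ‖y ⟨k, i⟩‖ ^ a := by
    intro k
    have hMk := hM k
    rw [tsum_fintype]
    have h4 : ∀ i, ‖y ⟨k, i⟩‖ ^ a = ((2 ^ k * M k) ^ a)⁻¹ * ‖x k i‖ ^ a := by
      intro i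
      simp only [y]
      rw [norm_smul, Real.mul_rpow (by positivity) (by positivity), norm_inv,
        Real.norm_of_nonneg (by positivity), Real.inv_rpow (by positivity)]
    simp only [h4, ← Finset.mul_sum]
    rw [← div_eq_inv_mul, one_le_div (by positivity)]
    exact (hs k).le
  have h5 := ge_of_tendsto' h2.tendsto_atTop_zero h3
  linarith

lemma AbsolutelySumming.exists_summingBound {a p : ℝ} (hp : 1 ≤ p)
    (h : AbsolutelySumming a p (ContinuousLinearMap.id ℝ E)) :
    ∃ K > 0, SummingBound a p K E := by
  obtain ⟨K, hK, hb⟩ := h.exists_summingBound_fin hp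
  refine ⟨K, hK, fun A x M hM hw => ?_⟩
  have h1 : ∀ f : E → ℝ, ∑ j, f (x (A.equivFin.symm j)) = ∑ i ∈ A, f (x i) := fun f => by
    rw [A.equivFin.symm.sum_comp fun i => f (x i), Finset.sum_coe_sort A fun i => f (x i)]
  have h2 := hb A.card (fun j => x (A.equivFin.symm j)) M hM fun φ hφ => by
    rw [h1 fun v => |φ v| ^ p]
    exact hw φ hφ
  rwa [h1 fun v => ‖v‖ ^ a] at h2

end Uniform

/-! ### Lower bounds for absolute sums against functionals -/

section LowerBound

variable {E : Type*} [NormedAddCommGroup E] [NormedSpace ℝ E]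

lemma SummingBound.exists_subset {a p q K Z D : ℝ} (ha : 0 < a) (hp : 0 < p)
    (hb : SummingBound a p K E) (hZ0 : 0 < Z)
    (hZ : ∀ n : ℕ, ∑ k ∈ Finset.range n, ((k + 1 : ℕ) : ℝ) ^ (-((1 - 1 / q) * p)) ≤ Z)
    (hD : 0 < D) {κ : Type} [DecidableEq κ] (x : κ → E) (hx : ∀ i, 1 ≤ ‖x i‖) (U : Finset κ)
    (hU : (K * (D * Z ^ (1 / p))) ^ a < U.card) :
    ∃ A ⊆ U, A.Nonempty ∧ ∃ φ : E →L[ℝ] ℝ, ‖φ‖ ≤ 1 ∧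
      D * (A.card : ℝ) ^ (1 / q) ≤ ∑ i ∈ A, |φ (x i)| := by
  by_contra! hcon
  have h1 := hb U x (D * Z ^ (1 / p)) (by positivity) fun φ hφ => by
    have h2 := sum_rpow_le_of_exists_le (f := fun i => |φ (x i)|) (fun _ => abs_nonneg _)
      (fun k => D * (k : ℝ) ^ (1 / q - 1)) hp.le U (fun B hB hB0 => by
        obtain ⟨i, hi, hmin⟩ := Finset.exists_min_image B (fun i => |φ (x i)|) hB0
        refine ⟨i, hi, ?_⟩
        have hc : (0 : ℝ) < B.card := by exact_mod_cast hB0.card_pos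
        have h3 := Finset.card_nsmul_le_sum B (fun i => |φ (x i)|) _ hmin
        rw [nsmul_eq_mul] at h3
        have h4 := hcon B hB hB0 φ hφ
        rw [Real.rpow_sub_one hc.ne', ← mul_div_assoc, le_div_iff₀ hc]
        linarith)
    refine h2.trans ?_
    have h5 : ∀ k : ℕ, (D * ((k + 1 : ℕ) : ℝ) ^ (1 / q - 1)) ^ p =
        D ^ p * ((k + 1 : ℕ) : ℝ) ^ (-((1 - 1 / q) * p)) := by
      intro k
      rw [Real.mul_rpow hD.le (by positivity), ← Real.rpow_mul (by positivity)]
      congr 2; ring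
    simp only [h5, ← Finset.mul_sum]
    rw [Real.mul_rpow hD.le (by positivity), ← Real.rpow_mul hZ0.le, one_div_mul_cancel hp.ne',
      Real.rpow_one]
    gcongr
    exact hZ _
  have h2 : (U.card : ℝ) ≤ ∑ i ∈ U, ‖x i‖ ^ a := by
    have := Finset.card_nsmul_le_sum U (fun i => ‖x i‖ ^ a) 1
      fun i _ => Real.one_le_rpow (hx i) ha.le
    simpa using this
  linarith

/-- A maximal disjoint family of sets with a property that every large set contains. -/
lemma exists_disjoint_family {κ : Type*} [Fintype κ] [DecidableEq κ] (good : Finset κ → Prop)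
    (h : ∀ U : Finset κ, Fintype.card κ ≤ 2 * U.card → ∃ A ⊆ U, A.Nonempty ∧ good A) :
    ∃ P : Finset (Finset κ), (P : Set (Finset κ)).PairwiseDisjoint id ∧ (∀ A ∈ P, good A) ∧
      Fintype.card κ ≤ 2 * (P.biUnion id).card := by
  classical
  obtain ⟨P, hP, hmax⟩ := Finset.exists_max_image
    (Finset.univ.filter fun P : Finset (Finset κ) =>
      (P : Set (Finset κ)).PairwiseDisjoint id ∧ ∀ A ∈ P, good A)
    (fun P => (P.biUnion id).card) ⟨∅, by simp⟩
  rw [Finset.mem_filter] at hP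
  refine ⟨P, hP.2.1, hP.2.2, ?_⟩
  by_contra! hlt
  set V := P.biUnion id
  obtain ⟨A, hA, hA0, hgood⟩ := h Vᶜ (by
    have := Finset.card_compl_add_card V
    omega)
  have hAV : Disjoint A V := Finset.disjoint_left.mpr fun i hi hiV =>
    Finset.mem_compl.mp (hA hi) hiV
  have h1 := hmax (insert A P) (by
    rw [Finset.mem_filter]
    refine ⟨Finset.mem_univ _, ?_, ?_⟩
    · rw [Finset.coe_insert, Set.pairwiseDisjoint_insert]
      refine ⟨hP.2.1, fun B hB _ => hAV.mono_right ?_⟩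
      exact Finset.subset_biUnion_of_mem id hB
    · intro B hB
      rcases Finset.mem_insert.mp hB with rfl | hB
      · exact hgood
      · exact hP.2.2 B hB)
  rw [Finset.biUnion_insert, id, Finset.card_union_of_disjoint hAV] at h1
  have := hA0.card_pos
  omega

lemma CotypeBound.card_rpow_le {a p q C K Z W : ℝ} (ha : 0 < a) (hp : 0 < p) (hq : 0 < q)
    (hC : 0 < C) (hK : 0 < K) (h : CotypeBound q C E) (hb : SummingBound a p K E) (hZ0 : 0 < Z)
    (hZ : ∀ n : ℕ, ∑ k ∈ Finset.range n, ((k + 1 : ℕ) : ℝ) ^ (-((1 - 1 / q) * p)) ≤ Z)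
    {κ : Type} [Fintype κ] [DecidableEq κ] [Nonempty κ] (x : κ → E) (hx : ∀ i, 1 ≤ ‖x i‖)
    (hW : ∀ ψ : E →L[ℝ] ℝ, ‖ψ‖ ≤ 1 → ∑ i, |ψ (x i)| ≤ W) :
    ((Fintype.card κ : ℝ) / 2) ^ (1 / a) * ((Fintype.card κ : ℝ) / 2) ^ (1 / q) ≤
      2 * K * Z ^ (1 / p) * C * W := by
  classical
  set m : ℝ := (Fintype.card κ : ℝ) with hm
  have hm0 : 0 < m := Nat.cast_pos.mpr Fintype.card_pos
  have hW0 : 0 ≤ W := (Finset.sum_nonneg fun _ _ => abs_nonneg _).trans (hW 0 (by simp))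
  set D : ℝ := (m / 2) ^ (1 / a) / (2 * K * Z ^ (1 / p)) with hDdef
  have hD : 0 < D := by positivity
  obtain ⟨P, hdisj, hgood, hcard⟩ := exists_disjoint_family
    (fun A : Finset κ => ∃ φ : E →L[ℝ] ℝ, ‖φ‖ ≤ 1 ∧
      D * (A.card : ℝ) ^ (1 / q) ≤ ∑ i ∈ A, |φ (x i)|) (fun U hU => by
      refine hb.exists_subset ha hp hZ0 hZ hD x hx U ?_
      have h1 : K * (D * Z ^ (1 / p)) = 1 / 2 * (m / 2) ^ (1 / a) := by
        rw [hDdef]; field_simp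
      rw [h1, Real.mul_rpow (by positivity) (by positivity), ← Real.rpow_mul (by positivity),
        one_div_mul_cancel ha.ne', Real.rpow_one]
      have h2 : ((1 : ℝ) / 2) ^ a < 1 := Real.rpow_lt_one (by norm_num) (by norm_num) ha
      have h3 : m ≤ 2 * U.card := by rw [hm]; exact_mod_cast hU
      nlinarith)
  choose! φ hφ1 hφ2 using hgood
  let z : P → E := fun A => ∑ i ∈ A.1, (SignType.sign (φ A.1 (x i)) : ℝ) • x i
  have hz : ∀ A : P, D * (A.1.card : ℝ) ^ (1 / q) ≤ ‖z A‖ := by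
    intro A
    refine (hφ2 A.1 A.2).trans ?_
    have h1 : φ A.1 (z A) = ∑ i ∈ A.1, |φ A.1 (x i)| := by
      simp only [z, map_sum, map_smul, smul_eq_mul, sign_mul_self]
    rw [← h1]
    refine (le_abs_self _).trans ?_
    refine ((φ A.1).le_opNorm _).trans ?_
    exact mul_le_of_le_one_left (norm_nonneg _) (hφ1 A.1 A.2)
  have hbound : ∀ ε : P → Bool, ‖∑ A, boolSign (ε A) • z A‖ ≤ W := by
    intro ε
    obtain ⟨ψ, hψ, hψv⟩ := exists_dual_vector'' ℝ (∑ A, boolSign (ε A) • z A)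
    have h1 : ψ (∑ A, boolSign (ε A) • z A) ≤ W := by
      refine le_trans ?_ (hW ψ hψ)
      rw [map_sum]
      calc ∑ A, ψ (boolSign (ε A) • z A) ≤ ∑ A : P, ∑ i ∈ A.1, |ψ (x i)| := by
            refine Finset.sum_le_sum fun A _ => (le_abs_self _).trans ?_
            rw [map_smul, smul_eq_mul, abs_mul, abs_boolSign, one_mul]
            simp only [z, map_sum, map_smul, smul_eq_mul]
            refine (Finset.abs_sum_le_sum_abs _ _).trans (Finset.sum_le_sum fun i _ => ?_)
            rw [abs_mul]
            refine mul_le_of_le_one_left (abs_nonneg _) ?_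
            rcases SignType.sign (φ A.1 (x i)) with _ | _ | _ <;> simp
        _ = ∑ i ∈ P.biUnion id, |ψ (x i)| := by
            rw [Finset.sum_biUnion hdisj, ← Finset.sum_coe_sort P]
            rfl
        _ ≤ ∑ i, |ψ (x i)| := Finset.sum_le_univ_sum_of_nonneg fun _ => abs_nonneg _
    rw [hψv] at h1
    exact h1
  have hrad : √(radSq z) ≤ W := by
    rw [Real.sqrt_le_left hW0]
    refine Finset.expect_le Finset.univ_nonempty fun ε _ => ?_
    exact pow_le_pow_left₀ (norm_nonneg _) (hbound ε) 2
  have hlow : (D * (m / 2) ^ (1 / q)) ^ q ≤ ∑ A, ‖z A‖ ^ q := by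
    have h1 : ∀ c : ℝ, 0 ≤ c → (D * c ^ (1 / q)) ^ q = D ^ q * c := fun c hc => by
      rw [Real.mul_rpow hD.le (by positivity), ← Real.rpow_mul hc, one_div_mul_cancel hq.ne',
        Real.rpow_one]
    have h2 : m / 2 ≤ ∑ A : P, (A.1.card : ℝ) := by
      have h3 : ∑ A : P, (A.1.card : ℝ) = (P.biUnion id).card := by
        rw [Finset.card_biUnion hdisj, Nat.cast_sum, ← Finset.sum_coe_sort P]
        rfl
      have h4 : m ≤ 2 * (P.biUnion id).card := by rw [hm]; exact_mod_cast hcard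
      rw [h3]; linarith
    calc (D * (m / 2) ^ (1 / q)) ^ q = D ^ q * (m / 2) := h1 _ (by positivity)
      _ ≤ D ^ q * ∑ A : P, (A.1.card : ℝ) := by gcongr
      _ = ∑ A : P, (D * (A.1.card : ℝ) ^ (1 / q)) ^ q := by
          rw [Finset.mul_sum]
          exact Finset.sum_congr rfl fun A _ => (h1 _ (by positivity)).symm
      _ ≤ _ := Finset.sum_le_sum fun A _ =>
          Real.rpow_le_rpow (by positivity) (hz A) hq.le
  have hfin : D * (m / 2) ^ (1 / q) ≤ C * W := by
    refine (Real.rpow_le_rpow_iff (by positivity) (by positivity) hq).mp ?_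
    refine hlow.trans ((h P z).trans ?_)
    gcongr
  rw [hDdef, div_mul_eq_mul_div, div_le_iff₀ (by positivity)] at hfin
  linarith

end LowerBound

/-! ### The case of cotype index larger than two -/

section LargeIndex

variable {E : Type*} [NormedAddCommGroup E] [NormedSpace ℝ E]

lemma CotypeBound.card_rpow_le_of_radSq {a p q C K Z : ℝ} (ha : 0 < a) (hp : 0 < p) (hq : 2 ≤ q)
    (hC : 0 < C) (hK : 0 < K) (h : CotypeBound q C E) (hb : SummingBound a p K E) (hZ0 : 0 < Z)
    (hZ : ∀ n : ℕ, ∑ k ∈ Finset.range n, ((k + 1 : ℕ) : ℝ) ^ (-((1 - 1 / q) * p)) ≤ Z)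
    {n : ℕ} (x : Fin n → E) (hx : ∀ i, 1 ≤ ‖x i‖) {m N : ℕ} (hm : 0 < m) (hN : 0 < N)
    (hmN : m * N ≤ n) :
    ((m : ℝ) / 2) ^ (1 / a) * ((m : ℝ) / 2) ^ (1 / q) ≤
      2 * K * Z ^ (1 / p) * C *
        (√(radSq x) * (√((m : ℝ) * N) / N + 2 * C * (N : ℝ) ^ (-(1 / q)))) := by
  have : NeZero N := ⟨hN.ne'⟩
  have : NeZero m := ⟨hm.ne'⟩
  let g : Fin m × Fin N → Fin n := fun i => Fin.castLE hmN (finProdFinEquiv i)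
  have hg : Function.Injective g := (Fin.castLE_injective hmN).comp finProdFinEquiv.injective
  obtain ⟨f, hf⟩ := h.exists_transversal hq hC (x ∘ g)
  have h1 := h.card_rpow_le ha hp (by linarith) hC hK hb hZ0 hZ (fun k => (x ∘ g) (k, f k))
    (fun k => hx _) hf
  simp only [Fintype.card_fin] at h1
  refine h1.trans ?_
  gcongr
  exact radSq_comp_injective_le hg x

/-- The growth rates in the case of a large cotype index are incompatible. -/
lemma rpow_growth_le {a α γ c n L C R : ℝ} {m N : ℕ} (ha : 1 ≤ a) (hγ0 : 0 < γ) (hγ : γ ≤ 1 / 2)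
    (hα : α + c - 1 / 2 ≤ c * γ + (α - γ)) (hn : 1 ≤ n) (hL : 0 ≤ L) (hC : 0 ≤ C)
    (hm1 : n ^ c / 2 ≤ m) (hm2 : m ≤ n ^ c) (hN0 : 0 < N) (hN : n ≤ 2 * m * N)
    (hR : R ≤ n ^ α)
    (h : ((m : ℝ) / 2) ^ (1 / a) * ((m : ℝ) / 2) ^ γ ≤
      L * (R * (√((m : ℝ) * N) / N + 2 * C * (N : ℝ) ^ (-γ)))) :
    n ^ (c / a - (α - γ)) ≤ 16 * L * (2 + 4 * C) := by
  have hn0 : 0 < n := by linarith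
  have hNpos : (0 : ℝ) < N := Nat.cast_pos.mpr hN0
  have hm0 : (0 : ℝ) < m := lt_of_lt_of_le (by positivity) hm1
  have quarter : ∀ t : ℝ, 0 ≤ t → t ≤ 1 → n ^ (c * t) / 4 ≤ ((m : ℝ) / 2) ^ t := by
    intro t ht0 ht1
    have h1 : (n ^ c / 4) ^ t ≤ ((m : ℝ) / 2) ^ t :=
      Real.rpow_le_rpow (by positivity) (by linarith) ht0
    refine le_trans ?_ h1
    rw [div_eq_mul_inv, div_eq_mul_inv, Real.mul_rpow (by positivity) (by norm_num),
      Real.rpow_mul hn0.le]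
    gcongr
    exact (Real.rpow_one _).symm.trans_le
      (Real.rpow_le_rpow_of_exponent_ge (by norm_num) (by norm_num) ht1)
  have h1 := quarter (1 / a) (by positivity) (by rw [div_le_one (by linarith)]; exact ha)
  have h2 := quarter γ hγ0.le (by linarith)
  have h3 : √((m : ℝ) * N) / N ≤ 2 * n ^ (c - 1 / 2) := by
    rw [div_le_iff₀ hNpos, Real.sqrt_le_left (by positivity)]
    have h4 : (n ^ (c - 1 / 2)) ^ 2 = n ^ c * n ^ c / n := by
      rw [← Real.rpow_natCast, ← Real.rpow_mul hn0.le, ← Real.rpow_add hn0,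
        ← Real.rpow_sub_one hn0.ne']
      congr 1; push_cast; ring
    have h5 : (2 * n ^ (c - 1 / 2) * N) ^ 2 = 4 * N * (N * (n ^ c * n ^ c) / n) := by
      rw [mul_pow, mul_pow, h4]; ring
    rw [h5]
    have h6 : (m : ℝ) / 2 ≤ N * (n ^ c * n ^ c) / n := by
      rw [le_div_iff₀ hn0]
      calc (m : ℝ) / 2 * n ≤ m / 2 * (2 * m * N) := by gcongr
        _ = N * (m * m) := by ring
        _ ≤ _ := by gcongr
    nlinarith
  have h4 : (N : ℝ) ^ (-γ) ≤ 2 * n ^ (c * γ - γ) := by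
    rw [Real.rpow_neg hNpos.le, inv_le_iff_one_le_mul₀ (by positivity)]
    have h5 : n ^ γ ≤ 2 ^ γ * (n ^ c) ^ γ * (N : ℝ) ^ γ := by
      rw [← Real.mul_rpow (by norm_num) (by positivity),
        ← Real.mul_rpow (by positivity) (by positivity)]
      refine Real.rpow_le_rpow hn0.le (hN.trans ?_) hγ0.le
      gcongr
    have h6 : (2 : ℝ) ^ γ ≤ 2 :=
      (Real.rpow_le_rpow_of_exponent_le (by norm_num) (by linarith)).trans_eq (Real.rpow_one _)
    rw [Real.rpow_sub hn0, Real.rpow_mul hn0.le, mul_div_assoc', div_mul_eq_mul_div,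
      one_le_div (by positivity)]
    refine h5.trans ?_
    gcongr
  have h5 : n ^ α * n ^ (c - 1 / 2) ≤ n ^ (c * γ + (α - γ)) := by
    rw [← Real.rpow_add hn0]
    exact Real.rpow_le_rpow_of_exponent_le hn (by linarith)
  have h6 : n ^ α * n ^ (c * γ - γ) = n ^ (c * γ + (α - γ)) := by
    rw [← Real.rpow_add hn0]
    congr 1; ring
  have h7 : n ^ (c * (1 / a)) / 4 * (n ^ (c * γ) / 4) ≤
      L * ((2 + 4 * C) * n ^ (c * γ + (α - γ))) := by
    calc n ^ (c * (1 / a)) / 4 * (n ^ (c * γ) / 4)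
        ≤ ((m : ℝ) / 2) ^ (1 / a) * ((m : ℝ) / 2) ^ γ := by gcongr
      _ ≤ L * (R * (√((m : ℝ) * N) / N + 2 * C * (N : ℝ) ^ (-γ))) := h
      _ ≤ L * (n ^ α * (2 * n ^ (c - 1 / 2) + 2 * C * (2 * n ^ (c * γ - γ)))) := by gcongr
      _ = L * (2 * (n ^ α * n ^ (c - 1 / 2)) + 4 * C * (n ^ α * n ^ (c * γ - γ))) := by ring
      _ ≤ L * (2 * n ^ (c * γ + (α - γ)) + 4 * C * n ^ (c * γ + (α - γ))) := by
          rw [h6]; gcongr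
      _ = _ := by ring
  have h8 : n ^ (c * (1 / a)) = n ^ (c / a - (α - γ)) * n ^ (α - γ) := by
    rw [← Real.rpow_add hn0]
    congr 1; ring
  rw [Real.rpow_add hn0, h8] at h7
  have h9 : 0 < n ^ (α - γ) * n ^ (c * γ) := by positivity
  refine le_of_mul_le_mul_right ?_ h9
  linarith

lemma not_absolutelySumming_of_two_lt {q₀ a : ℝ} (hq₀ : 2 < q₀) (ha : 1 ≤ a)
    (hlow : ∀ s, 2 ≤ s → s < q₀ → ¬ HasCotype s E)
    (hup : ∀ q, q₀ < q → ∃ C > 0, CotypeBound q C E) :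
    ¬ AbsolutelySumming a (1 + 1 / (q₀ - 1)) (ContinuousLinearMap.id ℝ E) := by
  intro habs
  set p : ℝ := 1 + 1 / (q₀ - 1) with hpdef
  have hp : 1 ≤ p := by
    have : 0 < 1 / (q₀ - 1) := one_div_pos.mpr (by linarith)
    linarith
  obtain ⟨K, hK, hb⟩ := habs.exists_summingBound hp
  set c : ℝ := (1 / 2 - 1 / q₀) / 2 with hc
  have hqinv : 1 / q₀ < 1 / 2 := one_div_lt_one_div_of_lt (by norm_num) hq₀
  have hqinv0 : 0 < 1 / q₀ := by positivity
  have hc0 : 0 < c := by rw [hc]; linarith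
  have hca : c / a ≤ c := div_le_self hc0.le ha
  have hca0 : 0 < c / a := by positivity
  set δ : ℝ := min (c / a / 4) (1 / q₀ / 2) with hδ
  have hδ0 : 0 < δ := lt_min (by positivity) (by positivity)
  have hδ1 : δ ≤ c / a / 4 := min_le_left _ _
  have hδ2 : δ ≤ 1 / q₀ / 2 := min_le_right _ _
  set α : ℝ := 1 / q₀ + δ with hα
  set γ : ℝ := 1 / q₀ - δ with hγ
  have hα0 : 0 < α := by linarith
  have hγ0 : 0 < γ := by linarith
  have hα2 : α < 1 / 2 := by linarith
  have hq : q₀ < 1 / γ := by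
    rw [lt_one_div (by linarith) hγ0]; linarith
  have hs : 1 / α < q₀ := by
    rw [one_div_lt hα0 (by linarith)]; linarith
  have hs2 : 2 < 1 / α := by
    rw [lt_one_div (by norm_num) hα0]; exact hα2
  obtain ⟨C, hC, hcot⟩ := hup _ hq
  have hexp : 1 < (1 - 1 / (1 / γ)) * p := by
    have h1 : (1 - 1 / q₀) * p = 1 := by
      rw [hpdef]
      have : q₀ - 1 ≠ 0 := by linarith
      field_simp
      ring
    rw [one_div_one_div]
    have h2 : 1 - 1 / q₀ < 1 - γ := by linarith
    nlinarith
  obtain ⟨Z, hZ0, hZ⟩ := exists_sum_rpow_neg_le hexp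
  set L : ℝ := 2 * K * Z ^ (1 / p) * C with hL
  have hL0 : 0 < L := by positivity
  have hexp2 : 0 < c / a - (α - γ) := by rw [hα, hγ]; linarith
  have htend := (tendsto_rpow_atTop hexp2).comp tendsto_natCast_atTop_atTop
  obtain ⟨n₀, hn₀⟩ := Filter.eventually_atTop.mp
    (htend.eventually_gt_atTop (16 * L * (2 + 4 * C)))
  obtain ⟨n, hn, x, hx, hrad⟩ := exists_sqrt_radSq_le_of_not_hasCotype
    (s := (1 / α + q₀) / 2) (r := 1 / α) (by linarith) (by linarith) (by linarith)
    (hlow _ (by linarith) (by linarith)) (n₀ + 1)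
  rw [one_div_one_div] at hrad
  have hn1 : (1 : ℝ) ≤ n := by exact_mod_cast (by omega : 1 ≤ n)
  have hnc1 : 1 ≤ (n : ℝ) ^ c := Real.one_le_rpow hn1 hc0.le
  have hncn : (n : ℝ) ^ c ≤ n :=
    (Real.rpow_le_rpow_of_exponent_le hn1 (by linarith : c ≤ 1)).trans_eq (Real.rpow_one _)
  set m : ℕ := ⌊(n : ℝ) ^ c⌋₊ with hm
  have hm2 : (m : ℝ) ≤ (n : ℝ) ^ c := Nat.floor_le (by positivity)
  have hm0 : 0 < m := Nat.floor_pos.mpr hnc1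
  have hm1 : (n : ℝ) ^ c / 2 ≤ m := by
    have h1 := Nat.lt_floor_add_one ((n : ℝ) ^ c)
    rw [← hm] at h1
    have h2 : (1 : ℝ) ≤ m := by exact_mod_cast hm0
    linarith
  have hmn : m ≤ n := by exact_mod_cast hm2.trans hncn
  have hN0 : 0 < n / m := Nat.div_pos hmn hm0
  have hN : n ≤ 2 * m * (n / m) := by
    have h1 := Nat.div_add_mod n m
    have h2 := Nat.mod_lt n hm0
    nlinarith
  have key := hcot.card_rpow_le_of_radSq (by linarith) (by linarith) (by linarith) hC hK hb hZ0 hZ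
    x hx hm0 hN0 (Nat.mul_div_le n m)
  rw [one_div_one_div] at key
  have := rpow_growth_le (c := c) ha hγ0 (by linarith) (by nlinarith) hn1 hL0.le hC.le hm1 hm2 hN0
    (by exact_mod_cast hN) hrad key
  exact absurd (hn₀ n (by omega)) (not_lt.mpr this)

end LargeIndex

/-! ### The case of cotype index two -/

section Ellipsoid

variable {E : Type*} [NormedAddCommGroup E] [NormedSpace ℝ E]
  {H : Type*} [NormedAddCommGroup H] [InnerProductSpace ℝ H] [FiniteDimensional ℝ H]

/-- Among the contractions with range in a fixed finite-dimensional space there is one of maximal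
determinant. -/
lemma exists_maximal_det (J : H →L[ℝ] E) (hJ : Function.Injective J) :
    ∃ T : H →L[ℝ] E, ‖T‖ ≤ 1 ∧ ∀ B : H →L[ℝ] H, ‖T ∘L B‖ ≤ 1 → |B.det| ≤ 1 := by
  obtain ⟨c, hc0, hc⟩ := (J : H →ₗ[ℝ] E).injective_iff_antilipschitz.mp hJ
  let S : Set (H →L[ℝ] H) := {A | ‖J ∘L A‖ ≤ 1}
  have hclosed : IsClosed S :=
    isClosed_le (((ContinuousLinearMap.compL ℝ H H E J).continuous).norm) continuous_const
  have hbdd : Bornology.IsBounded S := by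
    refine isBounded_iff_forall_norm_le.mpr ⟨c, fun A hA => ?_⟩
    refine A.opNorm_le_bound c.2 fun v => ?_
    have h1 : ‖A v‖ ≤ c * ‖J (A v)‖ := by
      simpa using hc.le_mul_dist (A v) 0
    refine h1.trans ?_
    gcongr
    simpa using (J ∘L A).le_of_opNorm_le hA v
  have hcomp : IsCompact S := Metric.isCompact_of_isClosed_isBounded hclosed hbdd
  obtain ⟨A, hA, hmax⟩ := hcomp.exists_isMaxOn (f := fun A : H →L[ℝ] H => |A.det|)
    ⟨0, by simp [S]⟩ (ContinuousLinearMap.continuous_det.abs.continuousOn)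
  have hdet : 0 < |A.det| := by
    set t : ℝ := (‖J‖ + 1)⁻¹ with ht
    have ht0 : 0 < t := by positivity
    have h1 : t • ContinuousLinearMap.id ℝ H ∈ S := by
      change ‖J ∘L (t • ContinuousLinearMap.id ℝ H)‖ ≤ 1
      rw [ContinuousLinearMap.comp_smul, ContinuousLinearMap.comp_id, norm_smul,
        Real.norm_of_nonneg ht0.le, ht, ← div_eq_inv_mul, div_le_one (by positivity)]
      linarith
    refine lt_of_lt_of_le ?_ (hmax h1)
    have h2 : (t • ContinuousLinearMap.id ℝ H).det = t ^ Module.finrank ℝ H := by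
      change LinearMap.det (t • (LinearMap.id : H →ₗ[ℝ] H)) = _
      rw [LinearMap.det_smul, LinearMap.det_id, mul_one]
    simp only [h2]
    positivity
  refine ⟨J ∘L A, hA, fun B hB => ?_⟩
  have h1 : |(A ∘L B).det| ≤ |A.det| := hmax (by
    change ‖J ∘L (A ∘L B)‖ ≤ 1
    rwa [← ContinuousLinearMap.comp_assoc])
  have h2 : (A ∘L B).det = A.det * B.det := LinearMap.det_comp _ _
  rw [h2, abs_mul] at h1
  exact le_of_mul_le_mul_left (by simpa using h1) hdet

lemma det_stretch (V : Submodule ℝ H) :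
    ((1 / 2 : ℝ) • ContinuousLinearMap.id ℝ H + (5 / 2 : ℝ) • V.starProjection).det =
      3 ^ Module.finrank ℝ V * (1 / 2) ^ Module.finrank ℝ (H ⧸ V) := by
  set e : H →ₗ[ℝ] H :=
    (((1 / 2 : ℝ) • ContinuousLinearMap.id ℝ H + (5 / 2 : ℝ) • V.starProjection :
      H →L[ℝ] H) : H →ₗ[ℝ] H) with he
  have happ : ∀ v, e v = (1 / 2 : ℝ) • v + (5 / 2 : ℝ) • V.starProjection v := fun v => rfl
  have hmem : ∀ v, V.starProjection v ∈ V := fun v => V.starProjection_apply_mem v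
  have hV : V ≤ V.comap e := fun v hv => by
    rw [Submodule.mem_comap, happ]
    exact V.add_mem (V.smul_mem _ hv) (V.smul_mem _ (hmem v))
  have h1 : e.restrict hV = (3 : ℝ) • LinearMap.id := by
    ext ⟨v, hv⟩
    simp only [LinearMap.coe_restrict_apply, happ, LinearMap.smul_apply, LinearMap.id_apply,
      Submodule.coe_smul, Submodule.starProjection_eq_self_iff.mpr hv, ← add_smul]
    norm_num
  have h2 : V.mapQ V e hV = (1 / 2 : ℝ) • LinearMap.id := by
    ext v
    simp only [LinearMap.comp_apply, Submodule.mkQ_apply, Submodule.mapQ_apply, happ,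
      LinearMap.smul_apply, LinearMap.id_apply]
    rw [← Submodule.Quotient.mk_smul, Submodule.Quotient.eq, add_sub_cancel_left]
    exact V.smul_mem _ (hmem v)
  change LinearMap.det e = _
  rw [LinearMap.det_eq_det_mul_det V e hV, h1, h2, LinearMap.det_smul, LinearMap.det_smul,
    LinearMap.det_id, LinearMap.det_id, mul_one, mul_one]

lemma exists_unit_vector_of_maximal_det {T : H →L[ℝ] E} (hT : ‖T‖ ≤ 1)
    (hmax : ∀ B : H →L[ℝ] H, ‖T ∘L B‖ ≤ 1 → |B.det| ≤ 1) (V : Submodule ℝ H)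
    (hV0 : 0 < Module.finrank ℝ V) (hV : Module.finrank ℝ H ≤ 2 * Module.finrank ℝ V) :
    ∃ v ∈ V, ‖v‖ = 1 ∧ 1 / 6 ≤ ‖T v‖ := by
  by_contra! hcon
  have hsmall : ∀ v ∈ V, ‖T v‖ ≤ 1 / 6 * ‖v‖ := by
    intro v hv
    rcases eq_or_ne v 0 with rfl | hv0
    · simp
    have hn : 0 < ‖v‖ := norm_pos_iff.mpr hv0
    have h1 := hcon (‖v‖⁻¹ • v) (V.smul_mem _ hv) (by
      rw [norm_smul, norm_inv, norm_norm, inv_mul_cancel₀ hn.ne'])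
    rw [map_smul, norm_smul, norm_inv, norm_norm, ← div_eq_inv_mul, div_lt_iff₀ hn] at h1
    exact h1.le
  have h1 := hmax ((1 / 2 : ℝ) • ContinuousLinearMap.id ℝ H + (5 / 2 : ℝ) • V.starProjection) (by
    refine ContinuousLinearMap.opNorm_le_bound _ zero_le_one fun v => ?_
    have hdec : (1 / 2 : ℝ) • v + (5 / 2 : ℝ) • V.starProjection v =
        (3 : ℝ) • V.starProjection v + (1 / 2 : ℝ) • Vᗮ.starProjection v := by
      conv_lhs => rw [← V.starProjection_add_starProjection_orthogonal v]
      simp only [map_add]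
      rw [Submodule.starProjection_eq_self_iff.mpr (V.starProjection_apply_mem v),
        V.starProjection_apply_eq_zero_iff.mpr (Vᗮ.starProjection_apply_mem v)]
      module
    have hP : ‖V.starProjection v‖ ≤ ‖v‖ := V.norm_starProjection_apply_le v
    have hP' : ‖Vᗮ.starProjection v‖ ≤ ‖v‖ := Vᗮ.norm_starProjection_apply_le v
    have h2 := hsmall _ (V.starProjection_apply_mem v)
    have h3 := T.le_of_opNorm_le hT (Vᗮ.starProjection v)
    change ‖T ((1 / 2 : ℝ) • v + (5 / 2 : ℝ) • V.starProjection v)‖ ≤ _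
    rw [hdec, map_add, map_smul, map_smul]
    refine (norm_add_le _ _).trans ?_
    rw [norm_smul, norm_smul, Real.norm_of_nonneg (by norm_num), Real.norm_of_nonneg (by norm_num)]
    linarith)
  rw [det_stretch, abs_of_pos (by positivity)] at h1
  have h2 := V.finrank_quotient_add_finrank
  have h3 : ((1 : ℝ) / 2) ^ Module.finrank ℝ V ≤ (1 / 2) ^ Module.finrank ℝ (H ⧸ V) :=
    pow_le_pow_of_le_one (by norm_num) (by norm_num) (by omega)
  have h4 : (1 : ℝ) < (3 / 2) ^ Module.finrank ℝ V := one_lt_pow₀ (by norm_num) hV0.ne'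
  have h5 : (3 / 2 : ℝ) ^ Module.finrank ℝ V =
      3 ^ Module.finrank ℝ V * (1 / 2) ^ Module.finrank ℝ V := by
    rw [← mul_pow]; norm_num
  have h6 : (3 : ℝ) ^ Module.finrank ℝ V * (1 / 2) ^ Module.finrank ℝ V ≤
      3 ^ Module.finrank ℝ V * (1 / 2) ^ Module.finrank ℝ (H ⧸ V) := by gcongr
  linarith

lemma exists_orthonormal_of_maximal_det {T : H →L[ℝ] E} (hT : ‖T‖ ≤ 1)
    (hmax : ∀ B : H →L[ℝ] H, ‖T ∘L B‖ ≤ 1 → |B.det| ≤ 1) (j : ℕ)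
    (hj : 2 * j ≤ Module.finrank ℝ H) :
    ∃ e : Fin j → H, Orthonormal ℝ e ∧ ∀ i, 1 / 6 ≤ ‖T (e i)‖ := by
  induction j with
  | zero => exact ⟨Fin.elim0, ⟨fun i => i.elim0, fun i => i.elim0⟩, fun i => i.elim0⟩
  | succ j ih =>
    obtain ⟨e, he, hTe⟩ := ih (by omega)
    set W := Submodule.span ℝ (Set.range e)
    have h1 : Module.finrank ℝ W ≤ j :=
      (finrank_range_le_card e).trans_eq (Fintype.card_fin j)
    have h2 := W.finrank_add_finrank_orthogonal
    obtain ⟨v, hv, hv1, hTv⟩ := exists_unit_vector_of_maximal_det hT hmax Wᗮ (by omega) (by omega)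
    have h3 : ∀ i, inner ℝ (e i) v = 0 := fun i =>
      hv (e i) (Submodule.subset_span (Set.mem_range_self i))
    refine ⟨Fin.cons v e, ⟨?_, ?_⟩, ?_⟩
    · exact Fin.cases (by simpa using hv1) fun i => by simpa using he.1 i
    · intro i k
      refine Fin.cases ?_ (fun i => ?_) i <;> refine Fin.cases ?_ (fun k => ?_) k
      · exact fun h => absurd rfl h
      · intro _; simpa [real_inner_comm] using h3 k
      · intro _; simpa using h3 i
      · intro h
        simpa using he.2 fun hik => h (congrArg _ hik)
    · exact Fin.cases (by simpa using hTv) fun i => by simpa using hTe i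

lemma Orthonormal.sum_sq_apply_le {ι : Type*} [Fintype ι] {e : ι → H} (he : Orthonormal ℝ e)
    (f : H →L[ℝ] ℝ) (hf : ‖f‖ ≤ 1) : ∑ i, f (e i) ^ 2 ≤ 1 := by
  set y := (InnerProductSpace.toDual ℝ H).symm f with hy
  have h1 : ∀ v, f v = inner ℝ v y := fun v => by
    rw [real_inner_comm, hy, InnerProductSpace.toDual_symm_apply]
  have h2 : ‖y‖ ≤ 1 := by rwa [hy, LinearIsometryEquiv.norm_map]
  have h3 := he.sum_inner_products_le y (s := Finset.univ)
  simp only [h1]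
  simp only [Real.norm_eq_abs, sq_abs] at h3
  refine h3.trans ?_
  exact pow_le_one₀ (norm_nonneg _) h2

end Ellipsoid

section IndexTwo

variable {E : Type*} [NormedAddCommGroup E] [NormedSpace ℝ E]

/-- A form of the Dvoretzky–Rogers lemma. -/
lemma exists_weakly_two_summable_family (hE : ¬ FiniteDimensional ℝ E) (k : ℕ) :
    ∃ x : Fin k → E, (∀ i, 1 / 6 ≤ ‖x i‖) ∧
      ∀ φ : E →L[ℝ] ℝ, ‖φ‖ ≤ 1 → ∑ i, φ (x i) ^ 2 ≤ 1 := by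
  obtain ⟨b, hb⟩ := exists_linearIndependent_of_le_rank (R := ℝ) (M := E) (n := 2 * k) (by
    rw [FiniteDimensional, ← Module.rank_lt_aleph0_iff, not_lt] at hE
    exact (Cardinal.natCast_lt_aleph0).le.trans hE)
  let H := EuclideanSpace ℝ (Fin (2 * k))
  let J₀ : H →ₗ[ℝ] E := Fintype.linearCombination ℝ b ∘ₗ
    (WithLp.linearEquiv 2 ℝ (Fin (2 * k) → ℝ)).toLinearMap
  have hJ : Function.Injective (LinearMap.toContinuousLinearMap J₀) :=
    (linearIndependent_iff_injective_fintypeLinearCombination.mp hb).comp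
      (WithLp.linearEquiv 2 ℝ (Fin (2 * k) → ℝ)).injective
  obtain ⟨T, hT, hmax⟩ := exists_maximal_det _ hJ
  obtain ⟨e, he, hTe⟩ := exists_orthonormal_of_maximal_det hT hmax k (by simp [H])
  refine ⟨fun i => T (e i), hTe, fun φ hφ => ?_⟩
  exact he.sum_sq_apply_le (φ ∘L T)
    ((φ.opNorm_comp_le T).trans (mul_le_one₀ hφ (norm_nonneg _) hT))

lemma not_absolutelySumming_two (hE : ¬ FiniteDimensional ℝ E) {a : ℝ} (ha : 0 < a) :
    ¬ AbsolutelySumming a 2 (ContinuousLinearMap.id ℝ E) := by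
  intro habs
  obtain ⟨K, hK, hb⟩ := habs.exists_summingBound one_le_two
  obtain ⟨k, hk⟩ := exists_nat_gt (K ^ a / (1 / 6) ^ a)
  obtain ⟨x, hx, hw⟩ := exists_weakly_two_summable_family hE k
  have h1 := hb Finset.univ x 1 one_pos fun φ hφ => by
    simpa using hw φ hφ
  have h2 := Finset.card_nsmul_le_sum Finset.univ (fun i => ‖x i‖ ^ a) ((1 / 6) ^ a)
    fun i _ => Real.rpow_le_rpow (by norm_num) (hx i) ha.le
  rw [Finset.card_fin, nsmul_eq_mul] at h2
  rw [mul_one] at h1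
  rw [div_lt_iff₀ (by positivity)] at hk
  linarith

end IndexTwo

/-! ### The cotype index -/

section CotypeIndex

variable {E : Type*} [NormedAddCommGroup E] [NormedSpace ℝ E]

lemma two_le_cot : 2 ≤ cot E := by
  refine le_sInf ?_
  rintro _ ⟨q, hq, rfl⟩
  rw [← ENNReal.ofReal_ofNat]
  exact ENNReal.ofReal_le_ofReal hq.1

lemma two_le_toReal_cot (hcot : cot E < ⊤) : 2 ≤ (cot E).toReal := by
  simpa using ENNReal.toReal_mono hcot.ne two_le_cot

lemma not_hasCotype_of_lt_cot {s : ℝ} (hs : 2 ≤ s) (h : s < (cot E).toReal) :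
    ¬ HasCotype s E := fun hcs => by
  have h1 : cot E ≤ ENNReal.ofReal s := sInf_le ⟨s, hcs, rfl⟩
  have h2 := ENNReal.toReal_mono ENNReal.ofReal_ne_top h1
  rw [ENNReal.toReal_ofReal (by linarith)] at h2
  linarith

lemma exists_cotypeBound_of_cot_lt (hcot : cot E < ⊤) {q : ℝ} (h : (cot E).toReal < q) :
    ∃ C > 0, CotypeBound q C E := by
  have h1 : cot E < ENNReal.ofReal q := (ENNReal.lt_ofReal_iff_toReal_lt hcot.ne).mpr h
  obtain ⟨_, ⟨r, hr, rfl⟩, hrq⟩ := sInf_lt_iff.mp h1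
  have h2 := hr.1
  have h3 : r ≤ q := by
    by_contra! hlt
    exact absurd hrq (not_lt.mpr (ENNReal.ofReal_le_ofReal hlt.le))
  obtain ⟨C, hC, hb⟩ := hr.exists_cotypeBound
  exact ⟨C, hC, hb.mono (by linarith) h3 hC⟩

lemma toReal_conjE_cot (hcot : cot E < ⊤) :
    (conjE (cot E)).toReal = 1 + 1 / ((cot E).toReal - 1) := by
  have h1 : 1 < cot E := ENNReal.one_lt_two.trans_le two_le_cot
  have h2 : cot E - 1 ≠ 0 := (tsub_pos_iff_lt.mpr h1).ne'
  rw [conjE, ENNReal.toReal_add ENNReal.one_ne_top (ENNReal.div_ne_top ENNReal.one_ne_top h2),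
    ENNReal.toReal_div, ENNReal.toReal_sub_of_le h1.le hcot.ne, ENNReal.toReal_one]

end CotypeIndex

/-- if `cot E < ∞` then `id_E` is not absolutely `(a, (cot E)*)`-summing for
any `a ≥ 1`. -/
theorem stmt2 (E : Type*) [NormedAddCommGroup E] [NormedSpace ℝ E] [CompleteSpace E]
    (hE : ¬ FiniteDimensional ℝ E) (hcot : cot E < ⊤) (a : ℝ) (ha : 1 ≤ a) :
    ¬ AbsolutelySumming a (conjE (cot E)).toReal (ContinuousLinearMap.id ℝ E) := by
  rw [toReal_conjE_cot hcot]
  rcases (two_le_toReal_cot hcot).eq_or_lt with h | h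
  · rw [← h]
    norm_num
    exact not_absolutelySumming_two hE (by linarith)
  · exact not_absolutelySumming_of_two_lt h ha (fun s => not_hasCotype_of_lt_cot)
      fun q => exists_cotypeBound_of_cot_lt hcot

end
end

section
/- Let E be an infinite dimensional Banach space with cot E < ∞. Then for every n ≥ 1 there exist vectors y_1, …, y_n ∈ E such that ‖y_i‖ ≥ 1/2 for every 1 ≤ i ≤ n, and sup over φ in the closed unit ball of E* of (Σ_{i=1}^n |φ(y_i)|^{(cot E)*})^{1/(cot E)*} ≤ 1. -/
open scoped ENNReal NNReal BigOperators ZeroAtInfty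

noncomputable section

namespace Cotype

open MeasureTheory

/-- The `k`-th Rademacher function with values in the group `{1, -1}`. -/
def signAt (k : ℕ) (t : ℝ) : ℤˣ := (-1) ^ ⌊(2 : ℝ) ^ (k + 1) * t⌋

lemma rademacher_eq_signAt (k : ℕ) (t : ℝ) : Rademacher k t = ((signAt k t : ℤ) : ℝ) := by
  rcases Int.even_or_odd ⌊(2 : ℝ) ^ (k + 1) * t⌋ with h | h
  · simp [Rademacher, signAt, h.neg_one_zpow]
  · simp [Rademacher, signAt, h.neg_one_zpow]

lemma signAt_succ (k : ℕ) (t : ℝ) : signAt (k + 1) t = signAt k (2 * t) := by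
  unfold signAt
  congr 2
  ring

lemma signAt_sub_one (k : ℕ) (t : ℝ) : signAt k (t - 1) = signAt k t := by
  have h : (2 : ℝ) ^ (k + 1) * (t - 1) = 2 ^ (k + 1) * t - ((2 ^ (k + 1) : ℤ) : ℝ) := by
    push_cast; ring
  have h2 : Even (2 ^ (k + 1) : ℤ) := by simp [Int.even_pow]
  unfold signAt
  rw [h, Int.floor_sub_intCast, zpow_sub, h2.neg_one_zpow]
  simp

lemma signAt_zero_of_lt_half {t : ℝ} (h0 : 0 < t) (h1 : t < 1 / 2) : signAt 0 t = 1 := by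
  have : ⌊(2 : ℝ) ^ (0 + 1) * t⌋ = 0 := by
    rw [Int.floor_eq_iff]; constructor <;> norm_num <;> linarith
  rw [signAt, this, zpow_zero]

lemma signAt_zero_of_half_lt {t : ℝ} (h0 : 1 / 2 < t) (h1 : t < 1) : signAt 0 t = -1 := by
  have : ⌊(2 : ℝ) ^ (0 + 1) * t⌋ = 1 := by
    rw [Int.floor_eq_iff]; constructor <;> norm_num <;> linarith
  rw [signAt, this, zpow_one]

lemma sum_signs_succ {n : ℕ} (G : (Fin (n + 1) → ℤˣ) → ℝ) :
    ∑ ε, G ε = ∑ ε : Fin n → ℤˣ, G (Fin.cons 1 ε) + ∑ ε : Fin n → ℤˣ, G (Fin.cons (-1) ε) := by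
  rw [← (Fin.consEquiv fun _ : Fin (n + 1) => ℤˣ).sum_comp, Fintype.sum_prod_type,
    UnitsInt.univ]
  simp [Fin.consEquiv]

lemma intervalIntegrable_congr_Ioo {f g : ℝ → ℝ} {a b : ℝ} (hab : a ≤ b)
    (h : ∀ t ∈ Set.Ioo a b, f t = g t) (hg : IntervalIntegrable g volume a b) :
    IntervalIntegrable f volume a b := by
  rw [intervalIntegrable_iff_integrableOn_Ioo_of_le hab] at hg ⊢
  exact hg.congr_fun (fun t ht => (h t ht).symm) measurableSet_Ioo

lemma integral_congr_Ioo {f g : ℝ → ℝ} {a b : ℝ} (hab : a ≤ b)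
    (h : ∀ t ∈ Set.Ioo a b, f t = g t) : ∫ t in a..b, f t = ∫ t in a..b, g t := by
  rw [intervalIntegral.integral_of_le hab, intervalIntegral.integral_of_le hab,
    integral_Ioc_eq_integral_Ioo, integral_Ioc_eq_integral_Ioo]
  exact setIntegral_congr_fun measurableSet_Ioo h

lemma integral_signAt (n : ℕ) (G : (Fin n → ℤˣ) → ℝ) :
    IntervalIntegrable (fun t => G fun k => signAt k t) volume 0 1 ∧
      ∫ t in (0 : ℝ)..1, G (fun k => signAt k t) = (∑ ε, G ε) / 2 ^ n := by
  induction n with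
  | zero =>
    have : (fun t : ℝ => G fun k : Fin 0 => signAt k t) = fun _ => G fun _ => 1 := by
      funext t; congr 1; exact Subsingleton.elim _ _
    rw [this]
    refine ⟨intervalIntegrable_const, ?_⟩
    rw [Fintype.sum_subsingleton G fun _ => 1]
    simp
  | succ n ih =>
    obtain ⟨hi1, hv1⟩ := ih fun ε => G (Fin.cons 1 ε)
    obtain ⟨hi2, hv2⟩ := ih fun ε => G (Fin.cons (-1) ε)
    have e1 : ∀ t ∈ Set.Ioo (0 : ℝ) (1 / 2), G (fun k => signAt k t) =
        (fun s => G (Fin.cons 1 fun k : Fin n => signAt k s)) (2 * t) := by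
      intro t ht
      dsimp only
      congr 1
      funext k
      refine Fin.cases ?_ (fun j => ?_) k
      · simpa using signAt_zero_of_lt_half ht.1 ht.2
      · simpa using signAt_succ j t
    have e2 : ∀ t ∈ Set.Ioo (1 / 2 : ℝ) 1, G (fun k => signAt k t) =
        (fun s => G (Fin.cons (-1) fun k : Fin n => signAt k s)) (2 * t - 1) := by
      intro t ht
      dsimp only
      congr 1
      funext k
      refine Fin.cases ?_ (fun j => ?_) k
      · simpa using signAt_zero_of_half_lt ht.1 ht.2
      · simpa [signAt_sub_one] using signAt_succ j t
    have h1 : IntervalIntegrable (fun t => G fun k => signAt k t) volume 0 (1 / 2) := by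
      refine intervalIntegrable_congr_Ioo (by norm_num) e1 ?_
      have := hi1.comp_mul_left (c := 2)
      simpa using this
    have h2 : IntervalIntegrable (fun t => G fun k => signAt k t) volume (1 / 2) 1 := by
      refine intervalIntegrable_congr_Ioo (by norm_num) e2 ?_
      have := (hi2.comp_sub_right 1).comp_mul_left (c := 2)
      norm_num at this
      simpa using this
    refine ⟨h1.trans h2, ?_⟩
    rw [← intervalIntegral.integral_add_adjacent_intervals h1 h2,
      integral_congr_Ioo (by norm_num) e1, integral_congr_Ioo (by norm_num) e2,
      intervalIntegral.integral_comp_mul_left (fun s => G (Fin.cons 1 fun k : Fin n => signAt k s))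
        two_ne_zero,
      intervalIntegral.integral_comp_mul_sub
        (fun s => G (Fin.cons (-1) fun k : Fin n => signAt k s)) two_ne_zero]
    norm_num
    rw [hv1, hv2, sum_signs_succ, pow_succ]
    ring

/-- The quadratic mean of `‖∑ i ∈ A, ± x i‖` over all choices of signs. -/
def signMean {ι E : Type*} [Fintype ι] [DecidableEq ι] [NormedAddCommGroup E] (x : ι → E)
    (A : Finset ι) : ℝ :=
  √(𝔼 ε : ι → ℤˣ, ‖∑ i ∈ A, ε i • x i‖ ^ 2)

lemma integral_rademacher_rpow_half {E : Type*} [NormedAddCommGroup E] [NormedSpace ℝ E] {n : ℕ}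
    (x : Fin n → E) :
    (∫ t in (0 : ℝ)..1, ‖∑ k : Fin n, Rademacher k.1 t • x k‖ ^ 2) ^ ((1 : ℝ) / 2) =
      signMean x Finset.univ := by
  rw [signMean, Real.sqrt_eq_rpow]
  congr 1
  have := (integral_signAt n fun ε => ‖∑ k, ε k • x k‖ ^ 2).2
  rw [Fintype.expect_eq_sum_div_card]
  simp only [rademacher_eq_signAt, Int.cast_smul_eq_zsmul, Fintype.card_pi, Fintype.card_units_int]
  simpa [Units.smul_def] using this

lemma le_of_sq_le {a b : ℝ} (h : a ^ 2 ≤ b ^ 2) (hb : 0 ≤ b) : a ≤ b :=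
  abs_le_of_sq_le_sq h hb |> (le_abs_self a).trans

section Signs

variable {ι κ E : Type*} [Fintype ι] [DecidableEq ι] [Fintype κ] [DecidableEq κ]
  [NormedAddCommGroup E]

lemma expect_signs_mul (δ : ι → ℤˣ) (f : (ι → ℤˣ) → ℝ) : 𝔼 ε, f (δ * ε) = 𝔼 ε, f ε :=
  Fintype.expect_equiv (Equiv.mulLeft δ) _ _ fun _ => rfl

lemma signMean_nonneg (x : ι → E) (A : Finset ι) : 0 ≤ signMean x A := Real.sqrt_nonneg _

lemma sq_signMean (x : ι → E) (A : Finset ι) :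
    signMean x A ^ 2 = 𝔼 ε : ι → ℤˣ, ‖∑ i ∈ A, ε i • x i‖ ^ 2 :=
  Real.sq_sqrt (Finset.expect_nonneg fun _ _ => by positivity)

lemma signMean_comp_equiv (e : κ ≃ ι) (x : ι → E) :
    signMean (x ∘ e) Finset.univ = signMean x Finset.univ := by
  unfold signMean
  congr 1
  refine Fintype.expect_equiv (e.arrowCongr (Equiv.refl _)) _ _ fun ε => ?_
  congr 2
  exact Fintype.sum_equiv e _ _ fun i => by simp

lemma signMean_singleton (x : ι → E) (i : ι) : signMean x {i} = ‖x i‖ := by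
  simp [signMean]

lemma signMean_empty (x : ι → E) : signMean x ∅ = 0 := by
  simp [signMean]

omit [Fintype ι] in
lemma exists_two_mul_norm_sum_le [NormedSpace ℝ E] (x : ι → E) {A B : Finset ι} (h : A ⊆ B) :
    ∃ τ : ι → ℤˣ, ∀ ε : ι → ℤˣ, 2 * ‖∑ i ∈ A, ε i • x i‖ ≤
      ‖∑ i ∈ B, ε i • x i‖ + ‖∑ i ∈ B, (τ * ε) i • x i‖ := by
  refine ⟨fun i => if i ∈ A then 1 else -1, fun ε => ?_⟩
  have hsum : ∑ i ∈ A, ε i • x i + ∑ i ∈ A, ε i • x i =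
      ∑ i ∈ B, ε i • x i + ∑ i ∈ B, ((fun i => if i ∈ A then 1 else -1 : ι → ℤˣ) * ε) i • x i := by
    rw [← Finset.sum_add_distrib, ← Finset.sum_add_distrib]
    refine Finset.sum_subset_zero_on_sdiff h (fun i hi => ?_) (fun i hi => ?_)
    · have : i ∉ A := (Finset.mem_sdiff.1 hi).2
      simp [this, Units.smul_def]
    · simp [hi]
  have hn : 2 * ‖∑ i ∈ A, ε i • x i‖ = ‖∑ i ∈ A, ε i • x i + ∑ i ∈ A, ε i • x i‖ := by
    rw [← two_smul ℝ, norm_smul, Real.norm_two]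
  rw [hn, hsum]
  exact norm_add_le _ _

lemma signMean_mono [NormedSpace ℝ E] (x : ι → E) {A B : Finset ι} (h : A ⊆ B) :
    signMean x A ≤ signMean x B := by
  refine le_of_sq_le ?_ (signMean_nonneg x B)
  rw [sq_signMean, sq_signMean]
  obtain ⟨τ, hτ⟩ := exists_two_mul_norm_sum_le x h
  have key : ∀ ε : ι → ℤˣ, ‖∑ i ∈ A, ε i • x i‖ ^ 2 ≤
      (‖∑ i ∈ B, ε i • x i‖ ^ 2 + ‖∑ i ∈ B, (τ * ε) i • x i‖ ^ 2) / 2 := by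
    intro ε
    nlinarith [hτ ε, norm_nonneg (∑ i ∈ A, ε i • x i),
      sq_nonneg (‖∑ i ∈ B, ε i • x i‖ - ‖∑ i ∈ B, (τ * ε) i • x i‖)]
  calc _ ≤ 𝔼 ε : ι → ℤˣ, (‖∑ i ∈ B, ε i • x i‖ ^ 2 + ‖∑ i ∈ B, (τ * ε) i • x i‖ ^ 2) / 2 :=
        Finset.expect_le_expect fun ε _ => key ε
    _ = _ := by
        rw [← Finset.expect_div, Finset.expect_add_distrib,
          expect_signs_mul τ fun ε => ‖∑ i ∈ B, ε i • x i‖ ^ 2]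
        ring

omit [Fintype ι] in
lemma exists_eq_on_parts {α : Type*} [Inhabited α] {P : Finset (Finset ι)}
    (hP : (P : Set (Finset ι)).PairwiseDisjoint id) (f : P → ι → α) :
    ∃ τ : ι → α, ∀ S : P, ∀ i ∈ S.1, τ i = f S i := by
  classical
  refine ⟨fun i => if h : ∃ S : P, i ∈ S.1 then f h.choose i else default, fun S i hi => ?_⟩
  have h : ∃ S : P, i ∈ S.1 := ⟨S, hi⟩
  have h2 : h.choose = S := by
    by_contra hne
    exact Finset.disjoint_left.1 (hP h.choose.2 S.2 fun e => hne (Subtype.ext e)) h.choose_spec hi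
  simp only [dif_pos h, h2]

lemma expect_sq_signMean_le [NormedSpace ℝ E] (x : ι → E) {A : Finset ι} {P : Finset (Finset ι)}
    (hPA : ∀ S ∈ P, S ⊆ A) (hP : (P : Set (Finset ι)).PairwiseDisjoint id) :
    𝔼 ε : ι → ℤˣ, signMean (fun S : P => ∑ i ∈ S.1, ε i • x i) Finset.univ ^ 2 ≤
      signMean x A ^ 2 := by
  have hU : P.biUnion id ⊆ A := Finset.biUnion_subset.2 hPA
  refine le_trans (le_of_eq ?_) (pow_le_pow_left₀ (signMean_nonneg _ _) (signMean_mono x hU) 2)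
  simp only [sq_signMean]
  rw [Finset.expect_comm]
  refine (Finset.expect_congr rfl fun δ _ => ?_).trans (Fintype.expect_const _)
  obtain ⟨τ, hτ⟩ := exists_eq_on_parts hP fun S _ => δ S
  rw [← expect_signs_mul τ fun ε => ‖∑ i ∈ P.biUnion id, ε i • x i‖ ^ 2]
  refine Finset.expect_congr rfl fun ε _ => ?_
  rw [Finset.sum_biUnion hP, ← Finset.sum_coe_sort P]
  congr 2
  refine Finset.sum_congr rfl fun S _ => ?_
  rw [Finset.smul_sum]
  refine Finset.sum_congr rfl fun i hi => ?_
  rw [Pi.mul_apply, hτ S i hi, mul_smul]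

/-- The maximum of `‖∑ i ∈ A, ± x i‖` over all choices of signs. -/
def signMax (x : ι → E) (A : Finset ι) : ℝ := ⨆ ε : ι → ℤˣ, ‖∑ i ∈ A, ε i • x i‖

omit [DecidableEq ι] in
lemma le_signMax (x : ι → E) (A : Finset ι) (ε : ι → ℤˣ) :
    ‖∑ i ∈ A, ε i • x i‖ ≤ signMax x A :=
  le_ciSup (f := fun ε : ι → ℤˣ => ‖∑ i ∈ A, ε i • x i‖) (Set.finite_range _).bddAbove ε

omit [DecidableEq ι] in
lemma exists_eq_signMax (x : ι → E) (A : Finset ι) :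
    ∃ ε : ι → ℤˣ, ‖∑ i ∈ A, ε i • x i‖ = signMax x A :=
  exists_eq_ciSup_of_finite

omit [Fintype ι] [DecidableEq ι] in
lemma signMax_empty (x : ι → E) : signMax x ∅ = 0 := by
  simp [signMax]

lemma signMax_mono [NormedSpace ℝ E] (x : ι → E) {A B : Finset ι} (h : A ⊆ B) :
    signMax x A ≤ signMax x B := by
  refine ciSup_le fun ε => ?_
  obtain ⟨τ, hτ⟩ := exists_two_mul_norm_sum_le x h
  linarith [hτ ε, le_signMax x B ε, le_signMax x B (τ * ε)]

lemma signMean_le_signMax (x : ι → E) (A : Finset ι) : signMean x A ≤ signMax x A := by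
  obtain ⟨ε₀, h₀⟩ := exists_eq_signMax x A
  have h : 0 ≤ signMax x A := h₀ ▸ norm_nonneg _
  refine le_of_sq_le ?_ h
  rw [sq_signMean]
  exact Finset.expect_le Finset.univ_nonempty fun ε _ =>
    pow_le_pow_left₀ (norm_nonneg _) (le_signMax x A ε) 2

end Signs

/-- The cotype `p` inequality with constant `C` for finite families. -/
def CotypeConst (p C : ℝ) (E : Type*) [NormedAddCommGroup E] : Prop :=
  ∀ {κ : Type} [Fintype κ] [DecidableEq κ] (z : κ → E),
    (∑ k, ‖z k‖ ^ p) ^ (1 / p) ≤ C * signMean z Finset.univ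

lemma _root_.HasCotype.exists_cotypeConst {p : ℝ} {E : Type*} [NormedAddCommGroup E]
    [NormedSpace ℝ E] (h : HasCotype p E) : ∃ C > 0, CotypeConst p C E := by
  obtain ⟨-, C, hC, h⟩ := h
  refine ⟨C, hC, fun {κ} _ _ z => ?_⟩
  have e := Fintype.equivFin κ
  have := h _ (z ∘ e.symm)
  rw [integral_rademacher_rpow_half, signMean_comp_equiv] at this
  refine le_trans (le_of_eq ?_) this
  congr 1
  exact Fintype.sum_equiv e _ _ fun k => by simp

/-- Minkowski's inequality in `ℓ_r` for finite averages. -/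
lemma rpow_sum_expect_le {Ω κ : Type*} [Fintype Ω] [Fintype κ] {r : ℝ} (hr : 1 ≤ r)
    (g : Ω → κ → ℝ) (hg : ∀ ω k, 0 ≤ g ω k) :
    (∑ k, (𝔼 ω, g ω k) ^ r) ^ (1 / r) ≤ 𝔼 ω, (∑ k, g ω k ^ r) ^ (1 / r) := by
  have hr0 : 0 < r := by linarith
  have := Finset.le_expect_of_subadditive (s := Finset.univ) (f := g)
    (m := fun v : κ → ℝ => (∑ k, |v k| ^ r) ^ (1 / r))
    (by simp [hr0.ne'])
    (fun a b => Real.Lp_add_le _ a b hr)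
    (fun n a => by
      have h0 : (0 : ℝ) ≤ (n : ℝ)⁻¹ := by positivity
      have e : ∀ b : ℝ, ((n : ℚ≥0)⁻¹ : ℚ≥0) • b = (n : ℝ)⁻¹ * b := fun b => by
        rw [NNRat.smul_def]; push_cast; rfl
      simp only [Pi.smul_apply, e, abs_mul, abs_of_nonneg h0]
      simp_rw [Real.mul_rpow h0 (abs_nonneg _)]
      rw [← Finset.mul_sum, Real.mul_rpow (by positivity) (by positivity), ← Real.rpow_mul h0,
        mul_one_div_cancel hr0.ne', Real.rpow_one])
  simp only [Finset.expect_apply] at this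
  have h2 : ∀ k, |𝔼 ω, g ω k| = 𝔼 ω, g ω k := fun k =>
    abs_of_nonneg (Finset.expect_nonneg fun ω _ => hg ω k)
  simpa only [h2, abs_of_nonneg (hg _ _)] using this

section Superadditivity

variable {ι : Type} {E : Type*} [Fintype ι] [DecidableEq ι] [NormedAddCommGroup E]
  [NormedSpace ℝ E] {p C : ℝ}

lemma CotypeConst.signMean_superadditive (hp : 2 ≤ p) (hC : 0 ≤ C) (h : CotypeConst p C E)
    (x : ι → E) {A : Finset ι} {P : Finset (Finset ι)}
    (hPA : ∀ S ∈ P, S ⊆ A) (hP : (P : Set (Finset ι)).PairwiseDisjoint id) :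
    (∑ S ∈ P, signMean x S ^ p) ^ (1 / p) ≤ C * signMean x A := by
  have hp0 : 0 < p := by linarith
  have hsum : 0 ≤ ∑ S ∈ P, signMean x S ^ p :=
    Finset.sum_nonneg fun S _ => Real.rpow_nonneg (signMean_nonneg _ _) _
  refine le_of_sq_le ?_ (mul_nonneg hC (signMean_nonneg _ _))
  have h1 := rpow_sum_expect_le (r := p / 2) (by linarith)
    (fun (ε : ι → ℤˣ) (S : P) => ‖∑ i ∈ S.1, ε i • x i‖ ^ 2) (fun _ _ => by positivity)
  have e1 : ∀ a : ℝ, 0 ≤ a → (a ^ 2) ^ (p / 2) = a ^ p := fun a ha => by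
    rw [← Real.rpow_natCast, ← Real.rpow_mul ha]; congr 1; push_cast; ring
  have e2 : ∀ a : ℝ, 0 ≤ a → a ^ (1 / (p / 2)) = (a ^ (1 / p)) ^ 2 := fun a ha => by
    rw [← Real.rpow_natCast, ← Real.rpow_mul ha]; congr 1; push_cast; field_simp
  simp only [← sq_signMean] at h1
  simp only [e1 _ (signMean_nonneg _ _), e1 _ (norm_nonneg _)] at h1
  rw [Finset.sum_coe_sort P (fun S => signMean x S ^ p), e2 _ hsum] at h1
  refine h1.trans ?_
  calc _ ≤ 𝔼 ε : ι → ℤˣ, C ^ 2 * signMean (fun S : P => ∑ i ∈ S.1, ε i • x i) Finset.univ ^ 2 := by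
        refine Finset.expect_le_expect fun ε _ => ?_
        rw [e2 _ (by positivity), ← mul_pow]
        exact pow_le_pow_left₀ (by positivity) (h _) 2
    _ ≤ (C * signMean x A) ^ 2 := by
        rw [← Finset.mul_expect, mul_pow]
        exact mul_le_mul_of_nonneg_left (expect_sq_signMean_le x hPA hP) (by positivity)

lemma CotypeConst.signMax_superadditive (hC : 0 ≤ C) (h : CotypeConst p C E)
    (x : ι → E) {A : Finset ι} {P : Finset (Finset ι)}
    (hPA : ∀ S ∈ P, S ⊆ A) (hP : (P : Set (Finset ι)).PairwiseDisjoint id) :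
    (∑ S ∈ P, signMax x S ^ p) ^ (1 / p) ≤ C * signMax x A := by
  choose ε hε using fun S => exists_eq_signMax x S
  have h1 := h fun S : P => ∑ i ∈ S.1, ε S i • x i
  simp only [hε] at h1
  rw [Finset.sum_coe_sort P (fun S => signMax x S ^ p)] at h1
  refine h1.trans (mul_le_mul_of_nonneg_left ?_ hC)
  refine (signMean_le_signMax _ _).trans (ciSup_le fun δ => ?_)
  obtain ⟨τ, hτ⟩ := exists_eq_on_parts hP fun S i => δ S * ε S i
  have hsum : ∑ S : P, δ S • ∑ i ∈ S.1, ε S i • x i = ∑ i ∈ P.biUnion id, τ i • x i := by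
    rw [Finset.sum_biUnion hP, ← Finset.sum_coe_sort P]
    refine Finset.sum_congr rfl fun S _ => ?_
    rw [Finset.smul_sum]
    exact Finset.sum_congr rfl fun i hi => by rw [hτ S i hi, mul_smul]
  rw [hsum]
  exact (le_signMax x _ τ).trans (signMax_mono x (Finset.biUnion_subset.2 hPA))

end Superadditivity

open Filter Topology

/-- If `F` is superadditive in the sense of `ℓ_p` and not too large on `A`, then `F` satisfies an
upper `p`-estimate on all subsets of some large part of `A`. -/
lemma exists_subset_forall_le {ι : Type*} [DecidableEq ι] (F : Finset ι → ℝ) {p C K : ℝ}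
    (hp : 0 < p) (hK : 0 ≤ K) (A : Finset ι)
    (hF : ∀ P : Finset (Finset ι), (∀ S ∈ P, S ⊆ A) → (P : Set (Finset ι)).PairwiseDisjoint id →
      (∑ S ∈ P, F S ^ p) ^ (1 / p) ≤ C * F A)
    (hF0 : F ∅ ≤ 0) (hA : C * F A < K * ((A.card : ℝ) / 2) ^ (1 / p)) :
    ∃ B ⊆ A, A.card ≤ 2 * B.card ∧ ∀ S ⊆ B, F S ≤ K * (S.card : ℝ) ^ (1 / p) := by
  classical
  set fam : Finset (Finset (Finset ι)) := A.powerset.powerset.filter fun P =>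
    (P : Set (Finset ι)).PairwiseDisjoint id ∧
      ∀ S ∈ P, K * (S.card : ℝ) ^ (1 / p) < F S with hfam
  have hne : fam.Nonempty := ⟨∅, by simp [hfam]⟩
  obtain ⟨P, hP, hmax⟩ := fam.exists_max_image Finset.card hne
  simp only [hfam, Finset.mem_filter, Finset.mem_powerset] at hP
  obtain ⟨hPA, hPd, hPF⟩ := hP
  have hPA' : ∀ S ∈ P, S ⊆ A := fun S hS => Finset.mem_powerset.1 (hPA hS)
  have hUA : P.biUnion id ⊆ A := Finset.biUnion_subset.2 hPA'
  refine ⟨A \ P.biUnion id, Finset.sdiff_subset, ?_, fun S hS => ?_⟩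
  · have hcard : (P.biUnion id).card = ∑ S ∈ P, S.card := Finset.card_biUnion hPd
    have hsd := Finset.card_sdiff_add_card_eq_card hUA
    by_contra! hlt
    have hbig : (A.card : ℝ) / 2 ≤ ∑ S ∈ P, (S.card : ℝ) := by
      rw [← Nat.cast_sum, ← hcard]
      have : A.card ≤ 2 * (P.biUnion id).card := by omega
      have : (A.card : ℝ) ≤ 2 * ((P.biUnion id).card : ℝ) := by exact_mod_cast this
      linarith
    refine absurd (hF P hPA' hPd) (not_le.2 (hA.trans_le ?_))
    have hKp : (K ^ p) ^ (1 / p) = K := by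
      rw [← Real.rpow_mul hK, mul_one_div_cancel hp.ne', Real.rpow_one]
    conv_lhs => rw [← hKp]
    clear hKp
    rw [← Real.mul_rpow (by positivity) (by positivity)]
    refine Real.rpow_le_rpow (by positivity) ?_ (by positivity)
    refine (mul_le_mul_of_nonneg_left hbig (by positivity)).trans ?_
    rw [Finset.mul_sum]
    refine Finset.sum_le_sum fun S hS => ?_
    have h1 := Real.rpow_le_rpow (by positivity) (hPF S hS).le hp.le
    rwa [Real.mul_rpow hK (by positivity), ← Real.rpow_mul (by positivity),
      one_div_mul_cancel hp.ne', Real.rpow_one] at h1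
  · rcases S.eq_empty_or_nonempty with rfl | hSne
    · exact hF0.trans (by positivity)
    by_contra! hbad
    have hdis : ∀ T ∈ P, Disjoint S T := fun T hT => by
      refine Finset.disjoint_left.2 fun i hi hiT => ?_
      exact (Finset.mem_sdiff.1 (hS hi)).2 (Finset.mem_biUnion.2 ⟨T, hT, hiT⟩)
    have hSP : S ∉ P := fun h => hSne.ne_empty (Finset.disjoint_self_iff_empty S |>.1 (hdis S h))
    have hmem : insert S P ∈ fam := by
      simp only [hfam, Finset.mem_filter, Finset.mem_powerset]
      refine ⟨Finset.insert_subset (Finset.mem_powerset.2 (hS.trans Finset.sdiff_subset)) hPA,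
        ?_, ?_⟩
      · rw [Finset.coe_insert]
        exact hPd.insert fun T hT _ => hdis T hT
      · intro T hT
        rcases Finset.mem_insert.1 hT with rfl | hT
        · exact hbad
        · exact hPF T hT
    have := hmax _ hmem
    rw [Finset.card_insert_of_notMem hSP] at this
    omega

/-- If every nonempty subset `B` has a point where `f` is at most `g #B`, then `∑ f` is at most
`∑ g`. -/
lemma sum_le_sum_range_of_exists_le {ι : Type*} [DecidableEq ι] (f : ι → ℝ) (g : ℕ → ℝ)
    (A : Finset ι) (h : ∀ B ⊆ A, B.Nonempty → ∃ i ∈ B, f i ≤ g B.card) :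
    ∑ i ∈ A, f i ≤ ∑ m ∈ Finset.range A.card, g (m + 1) := by
  induction hn : A.card generalizing A with
  | zero => simp [Finset.card_eq_zero.1 hn]
  | succ n ih =>
    obtain ⟨i, hi, hfi⟩ := h A subset_rfl (Finset.card_pos.1 (by omega))
    have h2 := ih (A.erase i) (fun B hB => h B (hB.trans (Finset.erase_subset _ _)))
      (by rw [Finset.card_erase_of_mem hi]; omega)
    rw [← Finset.sum_erase_add _ _ hi, Finset.sum_range_succ]
    rw [hn] at hfi
    linarith

lemma exists_nat_forall_lt_mul_rpow (C : ℝ) {c η : ℝ} (hc : 0 < c) (hη : 0 < η) :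
    ∃ N : ℕ, ∀ n : ℕ, N ≤ n → C < c * (n : ℝ) ^ η := by
  have h : Tendsto (fun n : ℕ => c * (n : ℝ) ^ η) atTop atTop :=
    ((tendsto_rpow_atTop hη).comp tendsto_natCast_atTop_atTop).const_mul_atTop hc
  exact eventually_atTop.1 (h.eventually_gt_atTop C)

/-- A growth rate `1 / q + o(1)` of `F` on large families of vectors of norm at least `1` can be
improved to a bound on all subfamilies. -/
lemma exists_forall_subset_le {E : Type*} [NormedAddCommGroup E] {q : ℝ} (hq : 2 ≤ q)
    (F : ∀ {n : ℕ}, (Fin n → E) → Finset (Fin n) → ℝ) (hF0 : ∀ {n} (x : Fin n → E), F x ∅ ≤ 0)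
    (hF : ∀ δ > 0, ∃ p, q ≤ p ∧ p < q + δ ∧ ∃ C > 0, ∀ {n} (x : Fin n → E) {A : Finset (Fin n)}
      {P : Finset (Finset (Fin n))}, (∀ S ∈ P, S ⊆ A) →
      (P : Set (Finset (Fin n))).PairwiseDisjoint id →
      (∑ S ∈ P, F x S ^ p) ^ (1 / p) ≤ C * F x A)
    (hgrow : ∀ η > 0, ∀ N : ℕ, ∃ n, ∃ x : Fin n → E, ∃ A : Finset (Fin n), N ≤ A.card ∧
      (∀ i ∈ A, 1 ≤ ‖x i‖) ∧ F x A ≤ (A.card : ℝ) ^ (1 / q + η))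
    {η : ℝ} (hη : 0 < η) (N : ℕ) :
    ∃ n, ∃ x : Fin n → E, ∃ A : Finset (Fin n), N ≤ A.card ∧ (∀ i ∈ A, 1 ≤ ‖x i‖) ∧
      ∀ B ⊆ A, F x B ≤ (A.card : ℝ) ^ η * (B.card : ℝ) ^ (1 / q) := by
  obtain ⟨p, hqp, hpq, C, hC, hsuper⟩ := hF (η / 4) (by positivity)
  have hq0 : 0 < q := by linarith
  have hp0 : 0 < p := by linarith
  obtain ⟨N₁, hN₁⟩ := exists_nat_forall_lt_mul_rpow C
    (c := (1 / 2) ^ (η + 1 / p)) (η := η / 2) (by positivity) (by positivity)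
  obtain ⟨n, x, A, hA, hx, hFA⟩ := hgrow (η / 4) (by positivity) (max (2 * N) (max N₁ 1))
  have hA1 : N₁ ≤ A.card := ((le_max_left _ _).trans (le_max_right _ _)).trans hA
  have hA2 : 1 ≤ A.card := ((le_max_right _ _).trans (le_max_right _ _)).trans hA
  have hA3 : 2 * N ≤ A.card := (le_max_left _ _).trans hA
  have hAr : (1 : ℝ) ≤ A.card := by exact_mod_cast hA2
  have hexp : 1 / q + η / 4 ≤ 1 / p + η / 2 := by
    have : 1 / q - 1 / p ≤ p - q := by
      rw [div_sub_div _ _ hq0.ne' hp0.ne', div_le_iff₀ (by positivity)]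
      nlinarith [mul_nonneg (sub_nonneg.2 hqp) (by nlinarith : 0 ≤ q * p - 1)]
    linarith
  obtain ⟨B, hBA, hcard, hB⟩ := exists_subset_forall_le (F x) (C := C)
    (K := ((A.card : ℝ) / 2) ^ η) hp0 (by positivity) A
    (fun P hPA hP => hsuper x hPA hP) (hF0 x) (by
      rw [← Real.rpow_add (by positivity)]
      calc C * F x A ≤ C * (A.card : ℝ) ^ (1 / p + η / 2) := by
            refine mul_le_mul_of_nonneg_left (hFA.trans ?_) hC.le
            exact Real.rpow_le_rpow_of_exponent_le hAr hexp
        _ < (1 / 2) ^ (η + 1 / p) * (A.card : ℝ) ^ (η / 2) * (A.card : ℝ) ^ (1 / p + η / 2) :=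
            mul_lt_mul_of_pos_right (hN₁ _ hA1) (by positivity)
        _ = ((A.card : ℝ) / 2) ^ (η + 1 / p) := by
            rw [mul_assoc, ← Real.rpow_add (by positivity), div_eq_mul_one_div (A.card : ℝ),
              Real.mul_rpow (by positivity) (by positivity), mul_comm]
            congr 2
            ring)
  refine ⟨n, x, B, by omega, fun i hi => hx i (hBA hi), fun S hS => ?_⟩
  rcases S.eq_empty_or_nonempty with rfl | hSne
  · exact (hF0 x).trans (by positivity)
  have hS1 : (1 : ℝ) ≤ S.card := by exact_mod_cast hSne.card_pos
  refine (hB S hS).trans ?_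
  have hAB : (A.card : ℝ) / 2 ≤ B.card := by
    have : (A.card : ℝ) ≤ 2 * B.card := by exact_mod_cast hcard
    linarith
  exact mul_le_mul (Real.rpow_le_rpow (by positivity) hAB hη.le)
    (Real.rpow_le_rpow_of_exponent_le hS1 (one_div_le_one_div_of_le hq0 hqp))
    (by positivity) (by positivity)

lemma signMean_smul {ι E : Type*} [Fintype ι] [DecidableEq ι] [NormedAddCommGroup E]
    [NormedSpace ℝ E] {c : ℝ} (hc : 0 ≤ c) (x : ι → E) (A : Finset ι) :
    signMean (c • x) A = c * signMean x A := by
  have h : ∀ ε : ι → ℤˣ, ‖∑ i ∈ A, ε i • (c • x) i‖ ^ 2 = c ^ 2 * ‖∑ i ∈ A, ε i • x i‖ ^ 2 := by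
    intro ε
    rw [← mul_pow, ← abs_of_nonneg hc, ← Real.norm_eq_abs c, ← norm_smul, Finset.smul_sum]
    congr 2
    refine Finset.sum_congr rfl fun i _ => ?_
    rw [Pi.smul_apply, smul_comm, Real.norm_eq_abs, abs_of_nonneg hc]
  unfold signMean
  simp only [h]
  rw [← Finset.mul_expect, Real.sqrt_mul (sq_nonneg c), Real.sqrt_sq hc]

/-- If `E` has no cotype below `q`, then some large families of vectors of norm at least `1` have
a small quadratic mean. -/
lemma exists_signMean_le {E : Type*} [NormedAddCommGroup E] [NormedSpace ℝ E] {q : ℝ}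
    (hq : 2 < q) (hnot : ∀ p < q, ¬ HasCotype p E) {η : ℝ} (hη : 0 < η) (N : ℕ) :
    ∃ n, ∃ x : Fin n → E, ∃ A : Finset (Fin n), N ≤ A.card ∧ (∀ i ∈ A, 1 ≤ ‖x i‖) ∧
      signMean x A ≤ (A.card : ℝ) ^ (1 / q + η) := by
  by_contra! H
  set σ := 1 / q + η with hσ
  have hq0 : 0 < q := by linarith
  have hσ0 : 0 < σ := by positivity
  have hσq : 1 / σ < q := by
    rw [div_lt_iff₀ hσ0, hσ, mul_add, mul_one_div_cancel hq0.ne']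
    linarith [mul_pos hq0 hη]
  obtain ⟨p, hp1, hpq⟩ := exists_between (max_lt hq hσq)
  have hp2 : 2 < p := (le_max_left _ _).trans_lt hp1
  have hp0 : 0 < p := by linarith
  have hpσ : 1 < p * σ := by
    have := (le_max_right _ _).trans_lt hp1
    rwa [div_lt_iff₀ hσ0] at this
  set D : ℝ := (max N 1 : ℕ) ^ σ with hD
  have hN1 : (1 : ℝ) ≤ (max N 1 : ℕ) := by exact_mod_cast le_max_right _ _
  have hD1 : 1 ≤ D := Real.one_le_rpow hN1 hσ0.le
  have hsum : Summable fun m : ℕ => (((m + 1 : ℕ) : ℝ)) ^ (-(p * σ)) :=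
    (summable_nat_add_iff 1).2 (Real.summable_nat_rpow.2 (by linarith))
  set T : ℝ := ∑' m : ℕ, (((m + 1 : ℕ) : ℝ)) ^ (-(p * σ)) with hT
  have hT0 : 0 ≤ T := tsum_nonneg fun _ => by positivity
  refine hnot p hpq ⟨hp2.le, D * (T + 1) ^ (1 / p), by positivity, fun n x => ?_⟩
  rw [integral_rademacher_rpow_half]
  set R := signMean x Finset.univ with hR
  have hR0 : 0 ≤ R := signMean_nonneg _ _
  have key : ∀ B ⊆ (Finset.univ : Finset (Fin n)), B.Nonempty →
      ∃ i ∈ B, ‖x i‖ ^ p ≤ (R * D) ^ p * (B.card : ℝ) ^ (-(p * σ)) := by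
    intro B _ hB
    obtain ⟨i, hi, hmin⟩ := B.exists_min_image (fun i => ‖x i‖) hB
    refine ⟨i, hi, ?_⟩
    have hB1 : (1 : ℝ) ≤ B.card := by exact_mod_cast hB.card_pos
    have hB0 : (0 : ℝ) < B.card := by linarith
    suffices h : ‖x i‖ * (B.card : ℝ) ^ σ ≤ R * D by
      have h2 := Real.rpow_le_rpow (by positivity) h hp0.le
      rw [Real.mul_rpow (by positivity) (by positivity), ← Real.rpow_mul hB0.le, mul_comm σ] at h2
      rw [Real.rpow_neg hB0.le, ← div_eq_mul_inv, le_div_iff₀ (by positivity)]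
      exact h2
    rcases lt_or_ge B.card N with hlt | hge
    · refine mul_le_mul ?_ ?_ (by positivity) hR0
      · rw [← signMean_singleton x i]
        exact signMean_mono x (Finset.subset_univ _)
      · refine Real.rpow_le_rpow hB0.le ?_ hσ0.le
        exact_mod_cast hlt.le.trans (le_max_left _ _)
    · rcases (norm_nonneg (x i)).eq_or_lt with h0 | h0
      · rw [← h0, zero_mul]
        positivity
      have h3 := H n (‖x i‖⁻¹ • x) B hge fun j hj => by
        rw [Pi.smul_apply, norm_smul, norm_inv, norm_norm, ← div_eq_inv_mul, one_le_div h0]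
        exact hmin j hj
      rw [signMean_smul (by positivity), ← div_eq_inv_mul, lt_div_iff₀ h0] at h3
      calc ‖x i‖ * (B.card : ℝ) ^ σ = (B.card : ℝ) ^ σ * ‖x i‖ := mul_comm _ _
        _ ≤ R := h3.le.trans (signMean_mono x (Finset.subset_univ _))
        _ ≤ R * D := le_mul_of_one_le_right hR0 hD1
  have h1 := sum_le_sum_range_of_exists_le (fun i => ‖x i‖ ^ p)
    (fun m => (R * D) ^ p * (m : ℝ) ^ (-(p * σ))) Finset.univ key
  have h2 : ∑ i, ‖x i‖ ^ p ≤ (R * D) ^ p * (T + 1) := by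
    refine h1.trans ?_
    rw [← Finset.mul_sum]
    refine mul_le_mul_of_nonneg_left ?_ (by positivity)
    exact (hsum.sum_le_tsum _ fun _ _ => by positivity).trans (by linarith)
  calc (∑ i, ‖x i‖ ^ p) ^ (1 / p) ≤ ((R * D) ^ p * (T + 1)) ^ (1 / p) :=
        Real.rpow_le_rpow (Finset.sum_nonneg fun _ _ => by positivity) h2 (by positivity)
    _ = D * (T + 1) ^ (1 / p) * R := by
        rw [Real.mul_rpow (by positivity) (by positivity), ← Real.rpow_mul (by positivity),
          mul_one_div_cancel hp0.ne', Real.rpow_one]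
        ring

section Contraction

variable {ι Φ : Type*} [Fintype ι] [DecidableEq ι]

omit [Fintype ι] [DecidableEq ι] in
lemma bddAbove_range_signed_sum {f : Φ → ι → ℝ} {M : ℝ} (hf : ∀ φ i, |f φ i| ≤ M) (A : Finset ι)
    (ε : ι → ℤˣ) : BddAbove (Set.range fun φ => ∑ i ∈ A, ((ε i : ℤ) : ℝ) * f φ i) := by
  refine ⟨∑ i ∈ A, M, ?_⟩
  rintro _ ⟨φ, rfl⟩
  refine Finset.sum_le_sum fun i _ => (le_abs_self _).trans ?_
  rcases Int.units_eq_one_or (ε i) with h | h <;> simpa [h] using hf φ i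

lemma ciSup_add_abs_le [Nonempty Φ] (G f : Φ → ℝ) (h1 : BddAbove (Set.range fun φ => G φ + f φ))
    (h2 : BddAbove (Set.range fun φ => G φ - f φ)) :
    (⨆ φ, G φ + |f φ|) + (⨆ φ, G φ - |f φ|) ≤ (⨆ φ, G φ + f φ) + ⨆ φ, G φ - f φ := by
  refine ciSup_add_ciSup_le fun φ ψ => ?_
  have a1 := le_ciSup h1 φ
  have a2 := le_ciSup h1 ψ
  have b1 := le_ciSup h2 φ
  have b2 := le_ciSup h2 ψ
  have := abs_sub_abs_le_abs_sub (f φ) (f ψ)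
  rcases abs_cases (f φ - f ψ) with h | h <;> linarith

/-- One step of the contraction principle: a coordinate may be replaced by its absolute value. -/
lemma expect_iSup_update_abs_le [Nonempty Φ] {f : Φ → ι → ℝ} {M : ℝ} (hf : ∀ φ i, |f φ i| ≤ M)
    (A : Finset ι) (a : ι) :
    𝔼 ε : ι → ℤˣ, ⨆ φ, ∑ i ∈ A, ((ε i : ℤ) : ℝ) * Function.update (f φ) a |f φ a| i ≤
      𝔼 ε : ι → ℤˣ, ⨆ φ, ∑ i ∈ A, ((ε i : ℤ) : ℝ) * f φ i := by
  by_cases ha : a ∈ A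
  swap
  · refine le_of_eq ?_
    congr! 5 with ε _ φ i hi
    rw [Function.update_of_ne]
    rintro rfl
    exact ha hi
  set δ : ι → ℤˣ := Pi.mulSingle a (-1) with hδ
  have hpair : ∀ u : (ι → ℤˣ) → ℝ, 𝔼 ε, u ε = (𝔼 ε, (u ε + u (δ * ε))) / 2 := fun u => by
    rw [Finset.expect_add_distrib, expect_signs_mul]
    ring
  rw [hpair, hpair fun ε => ⨆ φ, ∑ i ∈ A, ((ε i : ℤ) : ℝ) * f φ i]
  refine div_le_div_of_nonneg_right (Finset.expect_le_expect fun ε _ => ?_) zero_le_two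
  set G : Φ → ℝ := fun φ => ∑ i ∈ A.erase a, ((ε i : ℤ) : ℝ) * f φ i with hG
  have e1 : ∀ φ, ∑ i ∈ A, ((ε i : ℤ) : ℝ) * f φ i = G φ + ((ε a : ℤ) : ℝ) * f φ a := fun φ =>
    (Finset.sum_erase_add _ _ ha).symm
  have e2 : ∀ φ, ∑ i ∈ A, (((δ * ε) i : ℤ) : ℝ) * f φ i = G φ - ((ε a : ℤ) : ℝ) * f φ a := by
    intro φ
    rw [← Finset.sum_erase_add _ _ ha, sub_eq_add_neg]
    congr 1
    · refine Finset.sum_congr rfl fun i hi => ?_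
      simp [hδ, Pi.mulSingle_eq_of_ne (Finset.ne_of_mem_erase hi)]
    · simp [hδ]
  have e3 : ∀ φ, ∑ i ∈ A, ((ε i : ℤ) : ℝ) * Function.update (f φ) a |f φ a| i =
      G φ + ((ε a : ℤ) : ℝ) * |f φ a| := by
    intro φ
    rw [← Finset.sum_erase_add _ _ ha]
    congr 1
    · refine Finset.sum_congr rfl fun i hi => ?_
      rw [Function.update_of_ne (Finset.ne_of_mem_erase hi)]
    · simp
  have e4 : ∀ φ, ∑ i ∈ A, (((δ * ε) i : ℤ) : ℝ) * Function.update (f φ) a |f φ a| i =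
      G φ - ((ε a : ℤ) : ℝ) * |f φ a| := by
    intro φ
    rw [← Finset.sum_erase_add _ _ ha, sub_eq_add_neg]
    congr 1
    · refine Finset.sum_congr rfl fun i hi => ?_
      rw [Function.update_of_ne (Finset.ne_of_mem_erase hi)]
      simp [hδ, Pi.mulSingle_eq_of_ne (Finset.ne_of_mem_erase hi)]
    · simp [hδ]
  have hb1 := bddAbove_range_signed_sum hf A ε
  have hb2 := bddAbove_range_signed_sum hf A (δ * ε)
  simp only [e1, e2, e3, e4] at hb1 hb2 ⊢
  rcases Int.units_eq_one_or (ε a) with h | h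
  · simp only [h, Units.val_one, Int.cast_one, one_mul] at hb1 hb2 ⊢
    exact ciSup_add_abs_le G (fun φ => f φ a) hb1 hb2
  · simp only [h, Units.val_neg, Units.val_one, Int.cast_neg, Int.cast_one, neg_mul, one_mul,
      sub_neg_eq_add, ← sub_eq_add_neg] at hb1 hb2 ⊢
    rw [add_comm, add_comm (⨆ φ, G φ - f φ a)]
    exact ciSup_add_abs_le G (fun φ => f φ a) hb2 hb1

lemma expect_iSup_abs_le [Nonempty Φ] {f : Φ → ι → ℝ} {M : ℝ} (hf : ∀ φ i, |f φ i| ≤ M)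
    (A : Finset ι) :
    𝔼 ε : ι → ℤˣ, ⨆ φ, ∑ i ∈ A, ((ε i : ℤ) : ℝ) * |f φ i| ≤
      𝔼 ε : ι → ℤˣ, ⨆ φ, ∑ i ∈ A, ((ε i : ℤ) : ℝ) * f φ i := by
  have key : ∀ T : Finset ι,
      𝔼 ε : ι → ℤˣ, ⨆ φ, ∑ i ∈ A, ((ε i : ℤ) : ℝ) * (if i ∈ T then |f φ i| else f φ i) ≤
        𝔼 ε : ι → ℤˣ, ⨆ φ, ∑ i ∈ A, ((ε i : ℤ) : ℝ) * f φ i := by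
    intro T
    induction T using Finset.induction_on with
    | empty => simp
    | insert a T haT ih =>
      refine le_trans (le_of_eq ?_) ((expect_iSup_update_abs_le
        (f := fun φ i => if i ∈ T then |f φ i| else f φ i) (M := M) (fun φ i => ?_) A a).trans ih)
      · congr! 6 with ε _ φ i hi
        rcases eq_or_ne i a with rfl | hia
        · simp [haT]
        · simp [hia]
      · split_ifs
        · simpa using hf φ i
        · exact hf φ i
  simpa using key Finset.univ

end Contraction

section Halving

variable {ι E : Type*} [Fintype ι] [DecidableEq ι] [NormedAddCommGroup E] [NormedSpace ℝ E]

omit [NormedSpace ℝ E] in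
lemma expect_norm_le_signMean (x : ι → E) (A : Finset ι) :
    𝔼 ε : ι → ℤˣ, ‖∑ i ∈ A, ε i • x i‖ ≤ signMean x A := by
  refine Real.le_sqrt_of_sq_le ?_
  set m := 𝔼 ε : ι → ℤˣ, ‖∑ i ∈ A, ε i • x i‖ with hm
  have h : 0 ≤ 𝔼 ε : ι → ℤˣ, (‖∑ i ∈ A, ε i • x i‖ - m) ^ 2 :=
    Finset.expect_nonneg fun _ _ => sq_nonneg _
  have e : ∀ ε : ι → ℤˣ, (‖∑ i ∈ A, ε i • x i‖ - m) ^ 2 =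
      ‖∑ i ∈ A, ε i • x i‖ ^ 2 - 2 * m * ‖∑ i ∈ A, ε i • x i‖ + m ^ 2 := fun ε => by ring
  simp only [e] at h
  rw [Finset.expect_add_distrib, Finset.expect_sub_distrib, ← Finset.mul_expect,
    Finset.expect_const Finset.univ_nonempty, ← hm] at h
  linarith

/-- Half of the vectors can be discarded in such a way that the weak `ℓ_1` norm is also nearly
halved. -/
lemma exists_half_subset (x : ι → E) (A : Finset ι) {W : ℝ}
    (hW : ∀ φ : E →L[ℝ] ℝ, ‖φ‖ ≤ 1 → ∑ i ∈ A, |φ (x i)| ≤ W) :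
    ∃ S ⊆ A, A.card ≤ 2 * S.card ∧
      ∀ φ : E →L[ℝ] ℝ, ‖φ‖ ≤ 1 → ∑ i ∈ S, |φ (x i)| ≤ W / 2 + signMean x A := by
  set f : {φ : E →L[ℝ] ℝ // ‖φ‖ ≤ 1} → ι → ℝ := fun φ i => φ.1 (x i) with hf
  have : Nonempty {φ : E →L[ℝ] ℝ // ‖φ‖ ≤ 1} := ⟨⟨0, by simp⟩⟩
  have hle : ∀ φ : {φ : E →L[ℝ] ℝ // ‖φ‖ ≤ 1}, ∀ z : E, |φ.1 z| ≤ ‖z‖ := fun φ z => by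
    simpa using φ.1.le_of_opNorm_le φ.2 z
  have hM : ∀ φ i, |f φ i| ≤ ∑ j, ‖x j‖ := fun φ i =>
    (hle φ (x i)).trans (Finset.single_le_sum (f := fun j => ‖x j‖)
      (fun _ _ => norm_nonneg _) (Finset.mem_univ i))
  have hM' : ∀ φ i, |(|f φ i|)| ≤ ∑ j, ‖x j‖ := fun φ i => by simpa using hM φ i
  set G : (ι → ℤˣ) → ℝ := fun ε => ⨆ φ, ∑ i ∈ A, ((ε i : ℤ) : ℝ) * |f φ i| with hG
  have hleG : ∀ ε φ, ∑ i ∈ A, ((ε i : ℤ) : ℝ) * |f φ i| ≤ G ε := fun ε φ =>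
    le_ciSup (bddAbove_range_signed_sum hM' A ε) φ
  have hG0 : ∀ ε, 0 ≤ G ε := fun ε => by
    simpa [hf] using hleG ε ⟨0, by simp⟩
  have hE : 𝔼 ε, G ε ≤ signMean x A := by
    refine (expect_iSup_abs_le hM A).trans (le_trans ?_ (expect_norm_le_signMean x A))
    refine Finset.expect_le_expect fun ε _ => ciSup_le fun φ => ?_
    refine le_trans (le_of_eq ?_) ((le_abs_self _).trans (hle φ _))
    rw [map_sum]
    refine Finset.sum_congr rfl fun i _ => ?_
    rw [Units.smul_def, map_zsmul, zsmul_eq_mul]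
  have hE2 : 𝔼 ε, (G ε + G ((fun _ => -1) * ε)) ≤ 2 * signMean x A := by
    rw [Finset.expect_add_distrib, expect_signs_mul]
    linarith
  obtain ⟨ε, -, hε⟩ := Finset.exists_le_of_expect_le Finset.univ_nonempty hE2
  have main : ∀ τ : ι → ℤˣ, G τ ≤ 2 * signMean x A → ∀ φ : E →L[ℝ] ℝ, ‖φ‖ ≤ 1 →
      ∑ i ∈ A with τ i = 1, |φ (x i)| ≤ W / 2 + signMean x A := by
    intro τ hτ φ hφ
    have h1 := hleG τ ⟨φ, hφ⟩
    have h2 := hW φ hφ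
    have h3 : 2 * ∑ i ∈ A with τ i = 1, |φ (x i)| =
        ∑ i ∈ A, |φ (x i)| + ∑ i ∈ A, ((τ i : ℤ) : ℝ) * |f ⟨φ, hφ⟩ i| := by
      rw [Finset.sum_filter, Finset.mul_sum, ← Finset.sum_add_distrib]
      refine Finset.sum_congr rfl fun i _ => ?_
      rcases Int.units_eq_one_or (τ i) with h | h
      · simp [h, hf]; ring
      · simp [h, hf]
    linarith
  have h1 := main ε (by linarith [hG0 ((fun _ => -1) * ε)])
  have h2 := main ((fun _ => -1) * ε) (by linarith [hG0 ε])
  have hcard := Finset.card_filter_add_card_filter_not (s := A) fun i => ε i = 1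
  have hfilter : (A.filter fun i => ((fun _ => -1) * ε : ι → ℤˣ) i = 1) =
      A.filter fun i => ¬ ε i = 1 := by
    refine Finset.filter_congr fun i _ => ?_
    rcases Int.units_eq_one_or (ε i) with h | h <;> simp [h]
  rw [hfilter] at h2
  rcases le_total (A.filter fun i => ε i = 1).card (A.filter fun i => ¬ ε i = 1).card with h | h
  · exact ⟨_, Finset.filter_subset _ _, by omega, h2⟩
  · exact ⟨_, Finset.filter_subset _ _, by omega, h1⟩

end Halving

section Weak

variable {ι E : Type*} [Fintype ι] [DecidableEq ι]

lemma expect_sq_signed_sum (a : ι → ℝ) (A : Finset ι) :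
    𝔼 ε : ι → ℤˣ, (∑ i ∈ A, ((ε i : ℤ) : ℝ) * a i) ^ 2 = ∑ i ∈ A, a i ^ 2 := by
  induction A using Finset.induction_on with
  | empty => simp
  | insert k A hk ih =>
    set δ : ι → ℤˣ := Pi.mulSingle k (-1) with hδ
    have hpair : ∀ u : (ι → ℤˣ) → ℝ, 𝔼 ε, u ε = (𝔼 ε, (u ε + u (δ * ε))) / 2 := fun u => by
      rw [Finset.expect_add_distrib, expect_signs_mul]
      ring
    have e : ∀ ε : ι → ℤˣ, (∑ i ∈ insert k A, ((ε i : ℤ) : ℝ) * a i) ^ 2 +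
        (∑ i ∈ insert k A, (((δ * ε) i : ℤ) : ℝ) * a i) ^ 2 =
          2 * (∑ i ∈ A, ((ε i : ℤ) : ℝ) * a i) ^ 2 + 2 * a k ^ 2 := by
      intro ε
      have h1 : ∑ i ∈ A, (((δ * ε) i : ℤ) : ℝ) * a i = ∑ i ∈ A, ((ε i : ℤ) : ℝ) * a i := by
        refine Finset.sum_congr rfl fun i hi => ?_
        have : i ≠ k := fun h => hk (h ▸ hi)
        simp [hδ, Pi.mulSingle_eq_of_ne this]
      rw [Finset.sum_insert hk, Finset.sum_insert hk, h1]
      rcases Int.units_eq_one_or (ε k) with h | h <;> simp [hδ, h] <;> ring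
    rw [hpair]
    simp only [e]
    rw [Finset.expect_add_distrib, ← Finset.mul_expect, Finset.expect_const Finset.univ_nonempty,
      ih, Finset.sum_insert hk]
    ring

variable [NormedAddCommGroup E] [NormedSpace ℝ E]

lemma sum_abs_le_sqrt_card_mul_signMean (x : ι → E) (A : Finset ι) {φ : E →L[ℝ] ℝ}
    (hφ : ‖φ‖ ≤ 1) : ∑ i ∈ A, |φ (x i)| ≤ √A.card * signMean x A := by
  have h1 : ∑ i ∈ A, φ (x i) ^ 2 ≤ signMean x A ^ 2 := by
    rw [← expect_sq_signed_sum, sq_signMean]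
    refine Finset.expect_le_expect fun ε _ => ?_
    have h2 := φ.le_of_opNorm_le hφ (∑ i ∈ A, ε i • x i)
    rw [one_mul, Real.norm_eq_abs, map_sum] at h2
    have e : ∑ i ∈ A, ((ε i : ℤ) : ℝ) * φ (x i) = ∑ i ∈ A, φ (ε i • x i) :=
      Finset.sum_congr rfl fun i _ => by rw [Units.smul_def, map_zsmul, zsmul_eq_mul]
    rw [e, ← sq_abs]
    exact pow_le_pow_left₀ (abs_nonneg _) h2 2
  refine le_of_sq_le ?_ (mul_nonneg (Real.sqrt_nonneg _) (signMean_nonneg _ _))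
  rw [mul_pow, Real.sq_sqrt (Nat.cast_nonneg _)]
  refine sq_sum_le_card_mul_sum_sq.trans ?_
  simp only [sq_abs]
  exact mul_le_mul_of_nonneg_left h1 (Nat.cast_nonneg _)

omit [DecidableEq ι] in
lemma sum_abs_le_signMax (x : ι → E) (A : Finset ι) {φ : E →L[ℝ] ℝ} (hφ : ‖φ‖ ≤ 1) :
    ∑ i ∈ A, |φ (x i)| ≤ signMax x A := by
  refine le_trans ?_ (le_signMax x A fun i => if 0 ≤ φ (x i) then 1 else -1)
  have h2 := φ.le_of_opNorm_le hφ (∑ i ∈ A, (if 0 ≤ φ (x i) then 1 else -1 : ℤˣ) • x i)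
  rw [one_mul] at h2
  refine le_trans (le_of_eq ?_) ((le_abs_self _).trans h2)
  rw [map_sum]
  refine Finset.sum_congr rfl fun i _ => ?_
  split_ifs with h
  · rw [one_smul, abs_of_nonneg h]
  · rw [Units.neg_smul, one_smul, map_neg, abs_of_neg (not_le.1 h)]

omit [Fintype ι] [DecidableEq ι] in
lemma signMax_le (x : ι → E) (A : Finset ι) {W : ℝ}
    (hW : ∀ φ : E →L[ℝ] ℝ, ‖φ‖ ≤ 1 → ∑ i ∈ A, |φ (x i)| ≤ W) : signMax x A ≤ W := by
  refine ciSup_le fun ε => ?_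
  obtain ⟨φ, hφ, h⟩ := exists_dual_vector'' ℝ (∑ i ∈ A, ε i • x i)
  refine le_trans (le_of_eq h.symm) (le_trans ?_ (hW φ hφ))
  rw [map_sum]
  refine Finset.sum_le_sum fun i _ => ?_
  refine (le_abs_self _).trans (le_of_eq ?_)
  rcases Int.units_eq_one_or (ε i) with h | h <;> simp [h]

/-- Repeated halving of a family with small quadratic means. -/
lemma exists_subset_weak_le (x : ι → E) (A : Finset ι) {K W r : ℝ} (hK : 0 ≤ K)
    (hr : r ≤ 1 / 2) {L : ℕ} (hL : A.card = 2 ^ L)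
    (hA : ∀ B ⊆ A, signMean x B ≤ K * (B.card : ℝ) ^ r)
    (hW : ∀ φ : E →L[ℝ] ℝ, ‖φ‖ ≤ 1 → ∑ i ∈ A, |φ (x i)| ≤ W) (j b : ℕ) (hjb : b + j = L) :
    ∃ B ⊆ A, B.card = 2 ^ b ∧ ∀ φ : E →L[ℝ] ℝ, ‖φ‖ ≤ 1 →
      ∑ i ∈ B, |φ (x i)| ≤ W / 2 ^ j + 6 * K * ((2 : ℝ) ^ b) ^ r := by
  induction j generalizing b with
  | zero =>
    refine ⟨A, subset_rfl, by rw [hL, ← hjb, add_zero], fun φ hφ => (hW φ hφ).trans ?_⟩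
    rw [pow_zero, div_one]
    exact le_add_of_nonneg_right (by positivity)
  | succ j ih =>
    obtain ⟨B, hBA, hBc, hB⟩ := ih (b + 1) (by omega)
    obtain ⟨S, hSB, hSc, hS⟩ := exists_half_subset x B hB
    obtain ⟨T, hTS, hTc⟩ := Finset.exists_subset_card_eq (s := S) (n := 2 ^ b)
      (by rw [hBc, pow_succ] at hSc; omega)
    refine ⟨T, hTS.trans (hSB.trans hBA), hTc, fun φ hφ => ?_⟩
    have h1 := hA B hBA
    have h2 : ((B.card : ℕ) : ℝ) = 2 ^ (b + 1) := by rw [hBc]; push_cast; rfl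
    rw [h2] at h1
    have h3 : ((2 : ℝ) ^ (b + 1)) ^ r ≤ 3 / 2 * (2 ^ b) ^ r := by
      rw [pow_succ, Real.mul_rpow (by positivity) (by positivity), mul_comm]
      refine mul_le_mul_of_nonneg_right ?_ (by positivity)
      refine (Real.rpow_le_rpow_of_exponent_le one_le_two hr).trans ?_
      rw [← Real.sqrt_eq_rpow]
      exact Real.sqrt_le_iff.2 (by norm_num)
    have h4 : ∑ i ∈ T, |φ (x i)| ≤ ∑ i ∈ S, |φ (x i)| :=
      Finset.sum_le_sum_of_subset_of_nonneg hTS fun _ _ _ => abs_nonneg _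
    refine h4.trans ((hS φ hφ).trans ?_)
    have h5 := mul_le_mul_of_nonneg_left h3 hK
    have h6 : (W / 2 ^ j) / 2 = W / 2 ^ (j + 1) := by rw [pow_succ, div_div]
    rw [add_div, h6]
    linarith

end Weak

/-- Passing from quadratic means of random signs to the maximum over all signs. -/
lemma exists_signMax_le {E : Type*} [NormedAddCommGroup E] [NormedSpace ℝ E] {q : ℝ}
    (hq : 2 < q) (hmean : ∀ η : ℝ, 0 < η → ∀ N : ℕ, ∃ n, ∃ x : Fin n → E, ∃ A : Finset (Fin n),
      N ≤ A.card ∧ (∀ i ∈ A, 1 ≤ ‖x i‖) ∧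
      ∀ B ⊆ A, signMean x B ≤ (A.card : ℝ) ^ η * (B.card : ℝ) ^ (1 / q))
    {η : ℝ} (hη : 0 < η) (N : ℕ) :
    ∃ n, ∃ x : Fin n → E, ∃ A : Finset (Fin n), N ≤ A.card ∧ (∀ i ∈ A, 1 ≤ ‖x i‖) ∧
      signMax x A ≤ (A.card : ℝ) ^ (1 / q + η) := by
  have hq0 : 0 < q := by linarith
  have hqh : 1 / q < 1 / 2 := one_div_lt_one_div_of_lt two_pos hq
  obtain ⟨h, hh⟩ := exists_nat_ge (1 / (1 / 2 - 1 / q))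
  rw [div_le_iff₀ (by linarith)] at hh
  have hh1 : 1 ≤ h := by
    rcases Nat.eq_zero_or_pos h with rfl | h0
    · norm_num at hh
    · exact h0
  obtain ⟨N₂, hN₂⟩ := exists_nat_forall_lt_mul_rpow 7 (c := 1) (η := η / 2) one_pos (by positivity)
  set m₀ := max N N₂ + 1 with hm₀
  have hh0 : (0 : ℝ) < h := by exact_mod_cast hh1
  obtain ⟨n, x, A₀, hA₀, hx, hmA⟩ := hmean (η / (4 * h)) (by positivity) ((2 ^ h) ^ m₀)
  have h2h : 1 < 2 ^ h := Nat.one_lt_two_pow (by omega)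
  have hA₀0 : A₀.card ≠ 0 := by
    have : 0 < (2 ^ h) ^ m₀ := by positivity
    omega
  set m := Nat.log (2 ^ h) A₀.card with hm
  have hlow : (2 ^ h) ^ m ≤ A₀.card := Nat.pow_log_le_self _ hA₀0
  have hup : A₀.card < (2 ^ h) ^ (m + 1) := Nat.lt_pow_succ_log_self h2h _
  have hmm : m₀ ≤ m := Nat.le_log_of_pow_le h2h hA₀
  obtain ⟨A, hAA, hAc⟩ := Finset.exists_subset_card_eq hlow
  set K := (A₀.card : ℝ) ^ (η / (4 * h)) with hK
  have hK0 : 0 ≤ K := by positivity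
  have hL : A.card = 2 ^ (h * m) := by rw [hAc, pow_mul]
  have hLr : (A.card : ℝ) = (2 : ℝ) ^ ((h * m : ℕ) : ℝ) := by
    rw [Real.rpow_natCast, hL]; push_cast; rfl
  have hAK : ∀ B ⊆ A, signMean x B ≤ K * (B.card : ℝ) ^ (1 / q) := fun B hB =>
    hmA B (hB.trans hAA)
  obtain ⟨B, hBA, hBc, hB⟩ := exists_subset_weak_le x A hK0 hqh.le hL hAK
    (fun φ hφ => (sum_abs_le_sqrt_card_mul_signMean x A hφ).trans
      (mul_le_mul_of_nonneg_left (hAK A subset_rfl) (Real.sqrt_nonneg _)))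
    ((h - 1) * m) m (by
      obtain ⟨k, rfl⟩ := Nat.exists_eq_add_of_le hh1
      rw [Nat.add_sub_cancel_left]
      ring)
  have hBr : (B.card : ℝ) = (2 : ℝ) ^ m := by rw [hBc]; push_cast; rfl
  have hm2 : max N N₂ < 2 ^ m :=
    lt_of_lt_of_le (by omega : max N N₂ < m) Nat.lt_two_pow_self.le
  refine ⟨n, x, B, ?_, fun i hi => hx i (hAA (hBA hi)), (signMax_le x B hB).trans ?_⟩
  · rw [hBc]
    exact ((le_max_left _ _).trans hm2.le)
  have h7 : 7 < ((2 : ℝ) ^ m) ^ (η / 2) := by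
    simpa using hN₂ (2 ^ m) ((le_max_right _ _).trans hm2.le)
  have hmr : (1 : ℝ) ≤ m := by
    have : 1 ≤ m := by omega
    exact_mod_cast this
  have hKle : K ≤ ((2 : ℝ) ^ m) ^ (η / 2) := by
    calc K ≤ (((2 : ℝ) ^ h) ^ (m + 1)) ^ (η / (4 * h)) :=
          Real.rpow_le_rpow (Nat.cast_nonneg _) (by exact_mod_cast hup.le) (by positivity)
      _ = (2 : ℝ) ^ ((m + 1) * η / 4) := by
          rw [← pow_mul, ← Real.rpow_natCast, ← Real.rpow_mul two_pos.le]
          congr 1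
          push_cast
          field_simp
      _ ≤ (2 : ℝ) ^ ((m : ℝ) * (η / 2)) := by
          refine Real.rpow_le_rpow_of_exponent_le one_le_two ?_
          nlinarith
      _ = ((2 : ℝ) ^ m) ^ (η / 2) := by
          rw [Real.rpow_mul two_pos.le, Real.rpow_natCast]
  have hW : √A.card * (K * (A.card : ℝ) ^ (1 / q)) / 2 ^ ((h - 1) * m) ≤
      K * ((2 : ℝ) ^ m) ^ (1 / q) := by
    rw [div_le_iff₀ (by positivity), Real.sqrt_eq_rpow, hLr, ← Real.rpow_mul two_pos.le,
      ← Real.rpow_mul two_pos.le, ← Real.rpow_natCast 2 m, ← Real.rpow_mul two_pos.le,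
      ← Real.rpow_natCast 2 ((h - 1) * m), mul_left_comm, mul_assoc, ← Real.rpow_add two_pos,
      ← Real.rpow_add two_pos]
    refine mul_le_mul_of_nonneg_left (Real.rpow_le_rpow_of_exponent_le one_le_two ?_) hK0
    push_cast [Nat.cast_sub hh1]
    have : 0 < 1 / q := by positivity
    nlinarith [mul_nonneg (by linarith : (0 : ℝ) ≤ m)
      (by linarith : 0 ≤ (h : ℝ) * (1 / 2 - 1 / q) - 1 + 1 / q)]
  rw [hBr, Real.rpow_add (by positivity)]
  have hs : ((2 : ℝ) ^ m) ^ η = ((2 : ℝ) ^ m) ^ (η / 2) * ((2 : ℝ) ^ m) ^ (η / 2) := by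
    rw [← Real.rpow_add (by positivity), add_halves]
  calc _ ≤ K * ((2 : ℝ) ^ m) ^ (1 / q) + 6 * K * ((2 : ℝ) ^ m) ^ (1 / q) := by gcongr
    _ = ((2 : ℝ) ^ m) ^ (1 / q) * (7 * K) := by ring
    _ ≤ ((2 : ℝ) ^ m) ^ (1 / q) * ((2 : ℝ) ^ m) ^ η := by
        rw [hs]
        gcongr

/-- A bound on all subfamilies implies a weak `ℓ_s` estimate up to an arbitrarily small power. -/
lemma exists_weak_rpow_le {E : Type*} [NormedAddCommGroup E] [NormedSpace ℝ E] {s q : ℝ}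
    (hsq : s.HolderConjugate q) (hmax : ∀ η : ℝ, 0 < η → ∀ N : ℕ, ∃ n, ∃ x : Fin n → E,
      ∃ A : Finset (Fin n), N ≤ A.card ∧ (∀ i ∈ A, 1 ≤ ‖x i‖) ∧
      ∀ B ⊆ A, signMax x B ≤ (A.card : ℝ) ^ η * (B.card : ℝ) ^ (1 / q))
    {η : ℝ} (hη : 0 < η) (N : ℕ) :
    ∃ n, ∃ x : Fin n → E, ∃ A : Finset (Fin n), N ≤ A.card ∧ (∀ i ∈ A, 1 ≤ ‖x i‖) ∧
      ∀ φ : E →L[ℝ] ℝ, ‖φ‖ ≤ 1 → ∑ i ∈ A, |φ (x i)| ^ s ≤ (A.card : ℝ) ^ η := by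
  have hs := hsq.pos
  obtain ⟨N₁, hN₁⟩ := exists_nat_forall_lt_mul_rpow (1 + 1 / (η / 4)) (c := 1) (η := η / 4)
    one_pos (by positivity)
  obtain ⟨n, x, A, hA, hx, hxA⟩ := hmax (η / (2 * s)) (by positivity) (max N (max N₁ 1))
  refine ⟨n, x, A, (le_max_left _ _).trans hA, hx, fun φ hφ => ?_⟩
  have hA1 : 1 ≤ A.card := (le_max_right _ _).trans ((le_max_right _ _).trans hA)
  have hAr : (1 : ℝ) ≤ A.card := by exact_mod_cast hA1
  have hA0 : (0 : ℝ) < A.card := by linarith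
  have key : ∀ B ⊆ A, B.Nonempty →
      ∃ i ∈ B, |φ (x i)| ^ s ≤ (A.card : ℝ) ^ (η / 2) * ((B.card : ℕ) : ℝ)⁻¹ := by
    intro B hBA hB
    obtain ⟨i, hi, hmin⟩ := B.exists_min_image (fun i => |φ (x i)|) hB
    refine ⟨i, hi, ?_⟩
    have hB0 : (0 : ℝ) < B.card := by exact_mod_cast hB.card_pos
    have h1 : (B.card : ℝ) * |φ (x i)| ≤ (A.card : ℝ) ^ (η / (2 * s)) * (B.card : ℝ) ^ (1 / q) := by
      refine le_trans ?_ ((sum_abs_le_signMax x B hφ).trans (hxA B hBA))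
      rw [← nsmul_eq_mul]
      exact Finset.card_nsmul_le_sum _ _ _ hmin
    have h2 := Real.rpow_le_rpow (by positivity) h1 hs.le
    rw [Real.mul_rpow hB0.le (abs_nonneg _), Real.mul_rpow (by positivity) (by positivity),
      ← Real.rpow_mul hA0.le, ← Real.rpow_mul hB0.le] at h2
    have e1 : η / (2 * s) * s = η / 2 := by field_simp
    have e2 : 1 / q * s = s - 1 := by
      rw [one_div, ← hsq.one_sub_inv]
      field_simp
    rw [e1, e2, Real.rpow_sub_one hB0.ne', div_eq_mul_inv ((B.card : ℝ) ^ s), mul_left_comm] at h2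
    exact le_of_mul_le_mul_left h2 (by positivity)
  refine (sum_le_sum_range_of_exists_le _
    (fun m => (A.card : ℝ) ^ (η / 2) * ((m : ℕ) : ℝ)⁻¹) A key).trans ?_
  rw [← Finset.mul_sum]
  have h3 : ∑ m ∈ Finset.range A.card, (((m + 1 : ℕ) : ℝ))⁻¹ ≤ (A.card : ℝ) ^ (η / 2) := by
    have h4 := harmonic_le_one_add_log A.card
    rw [harmonic] at h4
    push_cast at h4 ⊢
    have h5 := Real.log_le_rpow_div hA0.le (ε := η / 4) (by positivity)
    have h6 := hN₁ _ ((le_max_left _ _).trans ((le_max_right _ _).trans hA))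
    have h7 : (1 : ℝ) ≤ (A.card : ℝ) ^ (η / 4) := Real.one_le_rpow hAr (by positivity)
    have h8 : (A.card : ℝ) ^ (η / 2) = (A.card : ℝ) ^ (η / 4) * (A.card : ℝ) ^ (η / 4) := by
      rw [← Real.rpow_add hA0]
      congr 1
      ring
    rw [h8]
    refine h4.trans ?_
    calc 1 + Real.log A.card ≤ (A.card : ℝ) ^ (η / 4) + (A.card : ℝ) ^ (η / 4) / (η / 4) :=
          add_le_add h7 h5
      _ = (A.card : ℝ) ^ (η / 4) * (1 + 1 / (η / 4)) := by ring
      _ ≤ _ := mul_le_mul_of_nonneg_left (by linarith) (by positivity)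
  calc _ ≤ (A.card : ℝ) ^ (η / 2) * (A.card : ℝ) ^ (η / 2) :=
        mul_le_mul_of_nonneg_left h3 (by positivity)
    _ = (A.card : ℝ) ^ η := by rw [← Real.rpow_add hA0, add_halves]

/-- There are `n` vectors in `E` of norm at least `1` whose weak `ℓ_s` norm is at most
`T ^ (1 / s)`. -/
def UpperEst (E : Type*) [NormedAddCommGroup E] [NormedSpace ℝ E] (s : ℝ) (n : ℕ) (T : ℝ) : Prop :=
  ∃ y : Fin n → E, (∀ i, 1 ≤ ‖y i‖) ∧ ∀ φ : E →L[ℝ] ℝ, ‖φ‖ ≤ 1 → ∑ i, |φ (y i)| ^ s ≤ T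

lemma exists_dual_coeff {ι : Type*} [Fintype ι] {s q : ℝ} (hsq : s.HolderConjugate q)
    (f : ι → ℝ) :
    ∃ a : ι → ℝ, ∑ i, |a i| ^ q ≤ 1 ∧ ∑ i, a i * f i = (∑ i, |f i| ^ s) ^ (1 / s) := by
  obtain ⟨g, hg1, hg2⟩ :=
    (NNReal.isGreatest_Lp Finset.univ (fun i => ‖f i‖₊) hsq).1
  refine ⟨fun i => if 0 ≤ f i then g i else -g i, ?_, ?_⟩
  · have h : ∀ i, |(if 0 ≤ f i then (g i : ℝ) else -g i)| = g i := fun i => by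
      split_ifs <;> simp
    simp only [h]
    exact_mod_cast hg1
  · have h := congrArg ((↑) : ℝ≥0 → ℝ) hg2
    push_cast at h
    simp only [Real.norm_eq_abs] at h
    rw [← h]
    refine Finset.sum_congr rfl fun i _ => ?_
    dsimp only
    split_ifs with h0
    · rw [abs_of_nonneg h0, mul_comm]
    · rw [abs_of_neg (not_le.1 h0)]
      ring

lemma UpperEst.of_mul {E : Type*} [NormedAddCommGroup E] [NormedSpace ℝ E] {s q : ℝ}
    (hsq : s.HolderConjugate q) {n m : ℕ} {T : ℝ} (hn : ¬ UpperEst E s n (2 ^ s))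
    (h : UpperEst E s (n * m) T) : UpperEst E s m (T / 2 ^ s) := by
  have hs := hsq.pos
  obtain ⟨y, hy1, hy⟩ := h
  have hrow : ∀ i : Fin m, ∃ φ : E →L[ℝ] ℝ, ‖φ‖ ≤ 1 ∧
      2 ^ s < ∑ j : Fin n, |φ (y (finProdFinEquiv (j, i)))| ^ s := by
    intro i
    by_contra! hcon
    exact hn ⟨fun j => y (finProdFinEquiv (j, i)), fun j => hy1 _, hcon⟩
  choose φ hφ hφ2 using hrow
  choose a ha1 ha2 using fun i => exists_dual_coeff hsq fun j => φ i (y (finProdFinEquiv (j, i)))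
  refine ⟨fun i => (1 / 2 : ℝ) • ∑ j, a i j • y (finProdFinEquiv (j, i)), fun i => ?_,
    fun ψ hψ => ?_⟩
  · have h1 := (φ i).le_of_opNorm_le (hφ i) (∑ j, a i j • y (finProdFinEquiv (j, i)))
    simp only [map_sum, map_smul, smul_eq_mul, ha2, one_mul] at h1
    have h2 : 2 < (∑ j, |φ i (y (finProdFinEquiv (j, i)))| ^ s) ^ (1 / s) := by
      calc (2 : ℝ) = (2 ^ s) ^ (1 / s) := by
            rw [← Real.rpow_mul two_pos.le, mul_one_div_cancel hs.ne', Real.rpow_one]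
        _ < _ := Real.rpow_lt_rpow (by positivity) (hφ2 i) (by positivity)
    rw [norm_smul]
    have h3 := (le_abs_self _).trans h1
    norm_num
    linarith
  · have h1 : ∀ i, |ψ ((1 / 2 : ℝ) • ∑ j, a i j • y (finProdFinEquiv (j, i)))| ^ s ≤
        (∑ j, |ψ (y (finProdFinEquiv (j, i)))| ^ s) / 2 ^ s := by
      intro i
      have h2 : |∑ j, a i j * ψ (y (finProdFinEquiv (j, i)))| ≤
          (∑ j, |ψ (y (finProdFinEquiv (j, i)))| ^ s) ^ (1 / s) := by
        refine (Finset.abs_sum_le_sum_abs _ _).trans ?_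
        simp only [abs_mul]
        refine (Real.inner_le_Lp_mul_Lq Finset.univ _ _ hsq.symm).trans ?_
        simp only [abs_abs]
        refine mul_le_of_le_one_left (by positivity) ?_
        exact Real.rpow_le_one (by positivity) (ha1 i) (by simpa using hsq.symm.nonneg)
      have h3 := Real.rpow_le_rpow (abs_nonneg _) h2 hs.le
      rw [← Real.rpow_mul (by positivity), one_div_mul_cancel hs.ne', Real.rpow_one] at h3
      simp only [map_smul, map_sum, smul_eq_mul, abs_mul]
      rw [Real.mul_rpow (abs_nonneg _) (abs_nonneg _), abs_of_nonneg (by norm_num : (0 : ℝ) ≤ 1 / 2),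
        one_div, Real.inv_rpow two_pos.le, div_eq_inv_mul]
      exact mul_le_mul_of_nonneg_left h3 (by positivity)
    refine (Finset.sum_le_sum fun i _ => h1 i).trans ?_
    rw [← Finset.sum_div]
    refine div_le_div_of_nonneg_right (le_trans (le_of_eq ?_) (hy ψ hψ)) (by positivity)
    rw [Finset.sum_comm, ← Fintype.sum_prod_type']
    exact Fintype.sum_equiv finProdFinEquiv _ _ fun _ => rfl

lemma upperEst_of_subpolynomial {E : Type*} [NormedAddCommGroup E] [NormedSpace ℝ E]
    [Nontrivial E] {s q : ℝ} (hsq : s.HolderConjugate q)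
    (hsub : ∀ η : ℝ, 0 < η → ∀ N : ℕ, ∃ n, ∃ x : Fin n → E, ∃ A : Finset (Fin n), N ≤ A.card ∧
      (∀ i ∈ A, 1 ≤ ‖x i‖) ∧
      ∀ φ : E →L[ℝ] ℝ, ‖φ‖ ≤ 1 → ∑ i ∈ A, |φ (x i)| ^ s ≤ (A.card : ℝ) ^ η)
    {n : ℕ} (hn : 1 ≤ n) : UpperEst E s n (2 ^ s) := by
  have hs := hsq.pos
  rcases hn.eq_or_lt with rfl | hn2
  · obtain ⟨z, hz⟩ := exists_norm_eq E zero_le_one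
    refine ⟨fun _ => z, fun _ => hz.ge, fun φ hφ => ?_⟩
    have h1 := φ.le_of_opNorm_le hφ z
    rw [one_mul, hz, Real.norm_eq_abs] at h1
    rw [Fin.sum_univ_one]
    exact Real.rpow_le_rpow (abs_nonneg _) (h1.trans one_le_two) hs.le
  by_contra hcon
  have hpow : ∀ k T, UpperEst E s (n ^ (k + 1)) T → ((2 : ℝ) ^ s) ^ (k + 1) < T := by
    intro k
    induction k with
    | zero =>
      intro T h
      rw [zero_add, pow_one] at h ⊢
      by_contra! hle
      obtain ⟨y, hy1, hy⟩ := h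
      exact hcon ⟨y, hy1, fun φ hφ => (hy φ hφ).trans hle⟩
    | succ k ih =>
      intro T h
      rw [pow_succ' n] at h
      have h1 := ih _ (h.of_mul hsq hcon)
      rwa [lt_div_iff₀ (by positivity), ← pow_succ] at h1
  have hn0 : (0 : ℝ) < n := by exact_mod_cast hn
  obtain ⟨l, x, A, hA, hx, hxA⟩ := hsub (s / (2 * n)) (by positivity) n
  have hA0 : A.card ≠ 0 := by omega
  obtain ⟨k, hk⟩ : ∃ k, Nat.log n A.card = k + 1 :=
    Nat.exists_eq_succ_of_ne_zero (Nat.log_pos hn2 hA).ne'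
  have hlow : n ^ (k + 1) ≤ A.card := hk ▸ Nat.pow_log_le_self n hA0
  have hup : A.card < n ^ (k + 2) := by
    simpa [hk] using Nat.lt_pow_succ_log_self hn2 A.card
  obtain ⟨B, hBA, hBc⟩ := Finset.exists_subset_card_eq hlow
  have e := Finset.equivFinOfCardEq hBc
  have hU : UpperEst E s (n ^ (k + 1)) ((A.card : ℝ) ^ (s / (2 * n))) := by
    refine ⟨fun i => x (e.symm i).1, fun i => hx _ (hBA (e.symm i).2), fun φ hφ => ?_⟩
    refine le_trans (le_of_eq ?_) ((Finset.sum_le_sum_of_subset_of_nonneg hBA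
      fun _ _ _ => by positivity).trans (hxA φ hφ))
    rw [← Finset.sum_coe_sort B]
    exact Fintype.sum_equiv e.symm _ _ fun _ => rfl
  refine (hpow k _ hU).not_ge ?_
  have h1 : (A.card : ℝ) ≤ (2 : ℝ) ^ ((n * (k + 2) : ℕ) : ℝ) := by
    have h2 : n ^ (k + 2) ≤ 2 ^ (n * (k + 2)) := by
      rw [pow_mul]
      exact Nat.pow_le_pow_left Nat.lt_two_pow_self.le _
    rw [Real.rpow_natCast]
    exact_mod_cast hup.le.trans h2
  calc (A.card : ℝ) ^ (s / (2 * n)) ≤ ((2 : ℝ) ^ ((n * (k + 2) : ℕ) : ℝ)) ^ (s / (2 * n)) :=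
        Real.rpow_le_rpow (Nat.cast_nonneg _) h1 (by positivity)
    _ = 2 ^ (s * ((k + 2) / 2)) := by
        rw [← Real.rpow_mul two_pos.le]
        congr 1
        push_cast
        field_simp
    _ ≤ 2 ^ (s * (k + 1)) := by
        refine Real.rpow_le_rpow_of_exponent_le one_le_two (mul_le_mul_of_nonneg_left ?_ hs.le)
        linarith [(Nat.cast_nonneg k : (0 : ℝ) ≤ k)]
    _ = (2 ^ s) ^ (k + 1) := by
        rw [Real.rpow_mul two_pos.le]
        exact_mod_cast Real.rpow_natCast _ (k + 1)

section DvoretzkyRogers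

variable {F E : Type*} [NormedAddCommGroup F] [InnerProductSpace ℝ F] [FiniteDimensional ℝ F]
  [NormedAddCommGroup E] [NormedSpace ℝ E]

lemma trace_le_of_det_le {ι : Type*} [Fintype ι] [DecidableEq ι] (M : Matrix ι ι ℝ) {β : ℝ} {N : ℕ}
    (h : ∀ t : ℝ, 0 < t → (1 + t • M).det ≤ (1 + t * β) ^ N) : M.trace ≤ N * β := by
  set Q := (Matrix.det (1 + (Polynomial.X : Polynomial ℝ) • M.map Polynomial.C)).divX.divX
  have hd : HasDerivAt (fun t : ℝ => (1 + t * β) ^ N - (1 + M.trace * t + Q.eval t * t ^ 2))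
      (N * β - M.trace) 0 := by
    have h1 : HasDerivAt (fun t : ℝ => (1 + t * β) ^ N) (N * (1 + 0 * β) ^ (N - 1) * (1 * β)) 0 :=
      (((hasDerivAt_id (0 : ℝ)).mul_const β).const_add 1).pow N
    have h2 : HasDerivAt (fun t : ℝ => 1 + M.trace * t) (M.trace * 1) 0 :=
      ((hasDerivAt_id (0 : ℝ)).const_mul M.trace).const_add 1
    have h3 := (Q.hasDerivAt 0).mul (hasDerivAt_pow 2 (0 : ℝ))
    have h4 := h1.sub (h2.add h3)
    convert! h4 using 1
    simp
  have h0 := ge_of_tendsto hd.tendsto_slope_zero_right (b := 0) (by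
    filter_upwards [self_mem_nhdsWithin] with t ht
    have ht0 : 0 < t := ht
    have h5 := h t ht0
    rw [Matrix.det_one_add_smul] at h5
    simp only [zero_add, zero_mul, add_zero, one_pow, mul_zero, ne_eq, OfNat.ofNat_ne_zero,
      not_false_eq_true, zero_pow, sub_self, sub_zero, smul_eq_mul]
    exact mul_nonneg (inv_nonneg.2 ht0.le) (sub_nonneg.2 h5))
  linarith

/-- A maximal volume argument: there is an operator of norm at most `1` from a finite-dimensional
Hilbert space embedded in `E` which is large in the trace duality. -/
lemma exists_trace_le (j : F →L[ℝ] E) (hj : Function.Injective j) :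
    ∃ u : F →L[ℝ] E, ‖u‖ ≤ 1 ∧ ∀ V : F →L[ℝ] F,
      LinearMap.trace ℝ F V ≤ Module.finrank ℝ F * ‖u.comp V‖ := by
  obtain ⟨K, hK, hKj⟩ := LinearMap.exists_antilipschitzWith (j : F →ₗ[ℝ] E)
    (LinearMap.ker_eq_bot.2 hj)
  have hlow : ∀ a, ‖a‖ ≤ K * ‖j a‖ := fun a => by
    simpa using hKj.le_mul_dist a 0
  have : ProperSpace (F →L[ℝ] F) := FiniteDimensional.proper_real _
  set B : Set (F →L[ℝ] F) := {T | ‖j.comp T‖ ≤ 1} with hB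
  have hcl : IsClosed B := by
    refine isClosed_le ?_ continuous_const
    fun_prop
  have hbd : B ⊆ Metric.closedBall 0 K := by
    intro T hT
    rw [mem_closedBall_zero_iff]
    refine T.opNorm_le_bound K.2 fun a => (hlow _).trans ?_
    refine mul_le_mul_of_nonneg_left ?_ K.2
    simpa using (j.comp T).le_of_opNorm_le hT a
  have hco : IsCompact B := (isCompact_closedBall _ _).of_isClosed_subset hcl hbd
  obtain ⟨T, hT, hmax⟩ := hco.exists_isMaxOn ⟨0, by simp [hB]⟩
    (ContinuousLinearMap.continuous_det (𝕜 := ℝ) (E := F)).continuousOn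
  have hdet : 0 < T.det := by
    have hc : 0 < ‖j‖ + 1 := by positivity
    have h1 : (‖j‖ + 1)⁻¹ • ContinuousLinearMap.id ℝ F ∈ B := by
      rw [hB, Set.mem_ofPred_eq, ContinuousLinearMap.comp_smul, ContinuousLinearMap.comp_id,
        norm_smul, norm_inv, Real.norm_of_nonneg hc.le, inv_mul_le_one₀ hc]
      linarith
    refine lt_of_lt_of_le ?_ (hmax h1)
    change 0 < LinearMap.det ((‖j‖ + 1)⁻¹ • LinearMap.id : F →ₗ[ℝ] F)
    rw [LinearMap.det_smul, LinearMap.det_id, mul_one]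
    positivity
  refine ⟨j.comp T, hT, fun V => ?_⟩
  set β := ‖(j.comp T).comp V‖ with hβ
  have hβ0 : 0 ≤ β := norm_nonneg _
  set b := (stdOrthonormalBasis ℝ F).toBasis
  rw [LinearMap.trace_eq_matrix_trace ℝ b]
  refine trace_le_of_det_le _ fun t ht => ?_
  have hp : 0 < 1 + t * β := by positivity
  have hmem : (1 + t * β)⁻¹ • (T.comp (1 + t • V)) ∈ B := by
    rw [hB, Set.mem_ofPred_eq, ContinuousLinearMap.comp_smul, norm_smul, norm_inv,
      Real.norm_of_nonneg hp.le, inv_mul_le_one₀ hp, ← ContinuousLinearMap.comp_assoc,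
      ContinuousLinearMap.comp_add, ContinuousLinearMap.comp_smul]
    refine (norm_add_le _ _).trans (add_le_add hT ?_)
    rw [norm_smul, Real.norm_of_nonneg ht.le]
  have h2 : ((1 + t * β)⁻¹ • (T.comp (1 + t • V))).det ≤ T.det := hmax hmem
  rw [ContinuousLinearMap.det, ContinuousLinearMap.toLinearMap_smul, LinearMap.det_smul,
    ContinuousLinearMap.toLinearMap_comp, LinearMap.det_comp, inv_pow, inv_mul_le_iff₀ (by positivity),
    mul_comm, ← ContinuousLinearMap.det] at h2
  have h3 := le_of_mul_le_mul_right h2 hdet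
  refine le_trans (le_of_eq ?_) h3
  rw [ContinuousLinearMap.det, ← LinearMap.det_toMatrix b]
  congr 1
  simp only [ContinuousLinearMap.toLinearMap_add, ContinuousLinearMap.toLinearMap_smul, map_add,
    map_smul]
  congr 1
  exact (LinearMap.toMatrix_one b).symm

lemma exists_orthonormal_norm_ge {N : ℕ} (u : F →L[ℝ] E)
    (hN : Module.finrank ℝ F = 2 * N)
    (hu : ∀ V : F →L[ℝ] F, LinearMap.trace ℝ F V ≤ Module.finrank ℝ F * ‖u.comp V‖)
    (m : ℕ) (hm : m ≤ N) :
    ∃ e : Fin m → F, Orthonormal ℝ e ∧ ∀ i, 1 / 2 ≤ ‖u (e i)‖ := by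
  induction m with
  | zero => exact ⟨Fin.elim0, ⟨fun i => i.elim0, fun i => i.elim0⟩, fun i => i.elim0⟩
  | succ m ih =>
    obtain ⟨e, he, hue⟩ := ih (by omega)
    set W := (Submodule.span ℝ (Set.range e))ᗮ with hW
    suffices h : ∃ v ∈ W, ‖v‖ = 1 ∧ 1 / 2 ≤ ‖u v‖ by
      obtain ⟨v, hv, hv1, huv⟩ := h
      refine ⟨Matrix.vecCons v e, orthonormal_vecCons_iff.2 ⟨hv1, fun i => ?_, he⟩, fun i => ?_⟩
      · rw [real_inner_comm]
        exact (Submodule.mem_orthogonal _ _).1 hv _ (Submodule.subset_span ⟨i, rfl⟩)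
      · refine Fin.cases ?_ (fun i => ?_) i
        · simpa using huv
        · simpa using hue i
    by_contra! hcon
    have hle : ∀ v ∈ W, ‖u v‖ ≤ 1 / 2 * ‖v‖ := by
      intro v hv
      rcases eq_or_ne v 0 with rfl | hv0
      · simp
      have hn : 0 < ‖v‖ := norm_pos_iff.2 hv0
      have h1 := hcon (‖v‖⁻¹ • v) (W.smul_mem _ hv) (norm_smul_inv_norm hv0)
      rw [map_smul, norm_smul, norm_inv, norm_norm, inv_mul_lt_iff₀ hn] at h1
      linarith
    have hP : ‖u.comp W.starProjection‖ ≤ 1 / 2 := by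
      refine ContinuousLinearMap.opNorm_le_bound _ (by norm_num) fun a => ?_
      have h1 := hle _ (Submodule.starProjection_apply_mem W a)
      have h2 := W.starProjection.le_of_opNorm_le W.starProjection_norm_le a
      rw [ContinuousLinearMap.comp_apply]
      linarith
    have htr := hu W.starProjection
    have hproj : LinearMap.IsProj W (W.starProjection : F →ₗ[ℝ] F) :=
      ⟨fun a => Submodule.starProjection_apply_mem W a,
        fun a ha => Submodule.starProjection_eq_self_iff.2 ha⟩
    rw [hproj.trace, hN] at htr
    have hfr := Submodule.finrank_add_finrank_orthogonal (Submodule.span ℝ (Set.range e))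
    rw [finrank_span_eq_card he.linearIndependent, Fintype.card_fin, hN, ← hW] at hfr
    have hfr' : (m : ℝ) + Module.finrank ℝ W = 2 * N := by exact_mod_cast hfr
    have hm' : (m : ℝ) + 1 ≤ N := by exact_mod_cast hm
    push_cast at htr
    nlinarith [mul_le_mul_of_nonneg_left hP (by positivity : (0 : ℝ) ≤ 2 * N)]

/-- The Dvoretzky–Rogers lemma. -/
lemma exists_dvoretzky_rogers (hE : ¬ FiniteDimensional ℝ E) (n : ℕ) :
    ∃ y : Fin n → E, (∀ i, 1 / 2 ≤ ‖y i‖) ∧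
      ∀ φ : E →L[ℝ] ℝ, ‖φ‖ ≤ 1 → ∑ i, |φ (y i)| ^ 2 ≤ 1 := by
  have hrank : ((2 * n : ℕ) : Cardinal) ≤ Module.rank ℝ E := by
    have : Cardinal.aleph0 ≤ Module.rank ℝ E := not_lt.1 fun h => hE (Module.rank_lt_aleph0_iff.1 h)
    exact (Cardinal.natCast_le_aleph0).trans this
  obtain ⟨g, hg⟩ := Module.le_rank_iff_exists_linearMap.1 hrank
  let e := WithLp.linearEquiv 2 ℝ (Fin (2 * n) → ℝ)
  obtain ⟨u, hu1, hu⟩ := exists_trace_le (F := EuclideanSpace ℝ (Fin (2 * n)))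
    (LinearMap.toContinuousLinearMap (g.comp (e : _ →ₗ[ℝ] (Fin (2 * n) → ℝ))))
    (hg.comp e.injective)
  obtain ⟨v, hv, huv⟩ := exists_orthonormal_norm_ge u (by simp) hu n le_rfl
  refine ⟨fun i => u (v i), huv, fun φ hφ => ?_⟩
  set w := (InnerProductSpace.toDual ℝ (EuclideanSpace ℝ (Fin (2 * n)))).symm (φ.comp u) with hw
  have hw1 : ‖w‖ ≤ 1 := by
    rw [hw, LinearIsometryEquiv.norm_map]
    exact (φ.opNorm_comp_le u).trans (mul_le_one₀ hφ (norm_nonneg _) hu1)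
  have h1 := hv.sum_inner_products_le w (s := Finset.univ)
  refine le_trans (le_of_eq ?_) (h1.trans (pow_le_one₀ (norm_nonneg _) hw1))
  refine Finset.sum_congr rfl fun i _ => ?_
  rw [real_inner_comm, hw, InnerProductSpace.toDual_symm_apply, Real.norm_eq_abs,
    ContinuousLinearMap.comp_apply]

end DvoretzkyRogers

section Cot

variable {E : Type*} [NormedAddCommGroup E] [NormedSpace ℝ E]

variable (E) in
lemma two_le_cot : 2 ≤ cot E := by
  refine le_sInf ?_
  rintro _ ⟨p, hp, rfl⟩
  simpa using ENNReal.ofReal_le_ofReal hp.1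

lemma two_le_toReal_cot (h : cot E < ⊤) : 2 ≤ (cot E).toReal := by
  simpa using ENNReal.toReal_mono h.ne (two_le_cot E)

lemma _root_.HasCotype.toReal_cot_le {p : ℝ} (hp : HasCotype p E) : (cot E).toReal ≤ p := by
  refine ENNReal.toReal_le_of_le_ofReal (by linarith [hp.1]) (sInf_le ⟨p, hp, rfl⟩)

lemma exists_hasCotype_lt (h : cot E < ⊤) {δ : ℝ} (hδ : 0 < δ) :
    ∃ p, (cot E).toReal ≤ p ∧ p < (cot E).toReal + δ ∧ HasCotype p E := by
  have h1 : cot E < ENNReal.ofReal ((cot E).toReal + δ) := by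
    rw [ENNReal.lt_ofReal_iff_toReal_lt h.ne]
    linarith
  obtain ⟨_, ⟨p, hp, rfl⟩, hlt⟩ := sInf_lt_iff.1 h1
  exact ⟨p, hp.toReal_cot_le, (ENNReal.ofReal_lt_ofReal_iff_of_nonneg (by linarith [hp.1])).1 hlt,
    hp⟩

lemma toReal_conjE {c : ℝ≥0∞} (hc : c ≠ ⊤) (h2 : 2 ≤ c) :
    (conjE c).toReal = Real.conjExponent c.toReal := by
  have h2' : 2 ≤ c.toReal := by simpa using ENNReal.toReal_mono hc h2
  have h1 : 1 ≤ c := one_le_two.trans h2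
  have h3 : (c - 1).toReal = c.toReal - 1 := by
    simpa using ENNReal.toReal_sub_of_le h1 hc
  have h4 : c - 1 ≠ 0 := fun h => by
    rw [h, ENNReal.toReal_zero] at h3
    linarith
  have h5 : c.toReal - 1 ≠ 0 := by linarith
  rw [conjE, ENNReal.toReal_add ENNReal.one_ne_top (ENNReal.div_ne_top ENNReal.one_ne_top h4),
    ENNReal.toReal_div, h3, ENNReal.toReal_one, Real.conjExponent]
  field_simp
  ring

lemma upperEst_of_two_lt_cot [Nontrivial E] (h : cot E < ⊤) (h2 : 2 < (cot E).toReal) {s : ℝ}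
    (hsq : s.HolderConjugate (cot E).toReal) {n : ℕ} (hn : 1 ≤ n) : UpperEst E s n (2 ^ s) := by
  refine upperEst_of_subpolynomial hsq (fun η hη N => exists_weak_rpow_le hsq
    (fun η hη N => ?_) hη N) hn
  refine exists_forall_subset_le h2.le signMax (fun x => (signMax_empty x).le) (fun δ hδ => ?_)
    (fun η hη N => exists_signMax_le h2 (fun η hη N => ?_) hη N) hη N
  · obtain ⟨p, hp1, hp2, hp⟩ := exists_hasCotype_lt h hδ
    obtain ⟨C, hC, hpC⟩ := hp.exists_cotypeConst
    exact ⟨p, hp1, hp2, C, hC, fun x _ _ hPA hP => hpC.signMax_superadditive hC.le x hPA hP⟩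
  · refine exists_forall_subset_le h2.le signMean (fun x => (signMean_empty x).le) (fun δ hδ => ?_)
      (fun η hη N => exists_signMean_le h2 (fun p hp hp' => hp.not_ge hp'.toReal_cot_le) hη N) hη N
    obtain ⟨p, hp1, hp2, hp⟩ := exists_hasCotype_lt h hδ
    obtain ⟨C, hC, hpC⟩ := hp.exists_cotypeConst
    exact ⟨p, hp1, hp2, C, hC, fun x _ _ hPA hP =>
      hpC.signMean_superadditive hp.1 hC.le x hPA hP⟩

end Cot

end Cotype

/-- if `cot E < ∞` then for every `n ≥ 1` there are `y_1, …, y_n ∈ E` with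
`‖y_i‖ ≥ 1/2` and `sup_{φ ∈ B_{E*}} (∑ |φ(y_i)|^{(cot E)*})^{1/(cot E)*} ≤ 1`. -/
theorem stmt3 (E : Type*) [NormedAddCommGroup E] [NormedSpace ℝ E] [CompleteSpace E]
    (hE : ¬ FiniteDimensional ℝ E) (hcot : cot E < ⊤) (n : ℕ) (hn : 1 ≤ n) :
    ∃ y : Fin n → E, (∀ i, 1 / 2 ≤ ‖y i‖) ∧
      ∀ φ : E →L[ℝ] ℝ, ‖φ‖ ≤ 1 →
        (∑ i : Fin n, |φ (y i)| ^ (conjE (cot E)).toReal) ^ (1 / (conjE (cot E)).toReal)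
          ≤ 1 := by
  have h2 := Cotype.two_le_toReal_cot hcot
  have hsq := (Real.HolderConjugate.conjExponent (one_lt_two.trans_le h2)).symm
  rw [Cotype.toReal_conjE hcot.ne (Cotype.two_le_cot E)]
  set s := Real.conjExponent (cot E).toReal with hs
  have hs0 := hsq.pos
  suffices h : ∃ y : Fin n → E, (∀ i, 1 / 2 ≤ ‖y i‖) ∧
      ∀ φ : E →L[ℝ] ℝ, ‖φ‖ ≤ 1 → ∑ i, |φ (y i)| ^ s ≤ 1 by
    obtain ⟨y, hy1, hy⟩ := h
    exact ⟨y, hy1, fun φ hφ => Real.rpow_le_one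
      (Finset.sum_nonneg fun i _ => Real.rpow_nonneg (abs_nonneg _) _) (hy φ hφ) (by positivity)⟩
  rcases h2.eq_or_lt with heq | hlt
  · have hs2 : s = ((2 : ℕ) : ℝ) := by
      rw [hs, ← heq, Real.conjExponent]
      norm_num
    simp only [hs2, Real.rpow_natCast]
    exact Cotype.exists_dvoretzky_rogers hE n
  · have : Nontrivial E := by
      by_contra hcon
      have := not_nontrivial_iff_subsingleton.1 hcon
      exact hE inferInstance
    obtain ⟨y, hy1, hy⟩ := Cotype.upperEst_of_two_lt_cot hcot hlt hsq hn
    refine ⟨fun i => (1 / 2 : ℝ) • y i, fun i => ?_, fun φ hφ => ?_⟩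
    · rw [norm_smul]
      norm_num
      linarith [hy1 i]
    · have h1 : ∀ i, |φ ((1 / 2 : ℝ) • y i)| ^ s = |φ (y i)| ^ s / 2 ^ s := fun i => by
        rw [map_smul, smul_eq_mul, one_div_mul_eq_div, abs_div, Nat.abs_ofNat,
          Real.div_rpow (abs_nonneg _) two_pos.le]
      simp only [h1]
      rw [← Finset.sum_div]
      exact div_le_one_of_le₀ (hy φ hφ) (by positivity)
end
end
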